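/- Let d ≥ 3 and δ ∈ (1/2, 1). Equip ℝ^d and each ℚ_p^d with the supremum norm ‖·‖_p. Let ρ_∞ : {v ∈ ℝ^d : ‖v‖_∞ = 1} → ℝ_{>0} and, for each p ∈ S_f, ρ_p : {v ∈ ℚ_p^d : ‖v‖_p = 1} → ℝ_{>0} be bounded Borel functions, and let A = A_∞ × ∏_{p∈S_f} A_p be the associated star-shaped set: A_∞ = {v ∈ ℝ^d ∖ {0} : ‖v‖_∞ < ρ_∞(v/‖v‖_∞)} and A_p = {v ∈ ℚ_p^d ∖ {0} : ‖v‖_p < ρ_p(ṽ)}, where for nonzero v ∈ ℚ_p^d with ‖v‖_p = p^{−m} we set ṽ = p^{−m}·v, the rescaling of v by a power of p with ‖ṽ‖_p = 1. For a tuple T = (T_p)_{p∈S} with T_∞ ∈ ℝ_{>0} and T_p = p^{z_p} ∈ {p^z : z ∈ ℤ}, define the dilate T·A = T_∞·A_∞ × ∏_{p∈S_f} p^{−z_p}·A_p. Then for every left Haar measure ν on G_d, for ν-almost every g ∈ G_d there exist C > 0 and T⁰ such that for all T with T ⪰ T⁰ (i.e. T_p ≥ T⁰_p for all p ∈ S):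 | #( g·P(ℤ_S^d) ∩ T·A ) − vol_S(T·A)/ζ_S(d) | ≤ C·vol_S(T·A)^δ. -/

import Mathlib

open MeasureTheory Matrix ENNReal Pointwise

noncomputable section

noncomputable instance Padic.instMeasurableSpace' {p : ℕ} [Fact p.Prime] :
    MeasurableSpace ℚ_[p] := borel _

instance Padic.instBorelSpace' {p : ℕ} [Fact p.Prime] : BorelSpace ℚ_[p] := ⟨rfl⟩

instance Matrix.SpecialLinearGroup.instTopologicalSpace'
    {n : Type*} [DecidableEq n] [Fintype n] {R : Type*} [CommRing R] [TopologicalSpace R] :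
    TopologicalSpace (SpecialLinearGroup n R) :=
  show TopologicalSpace {A : Matrix n n R // A.det = 1} from inferInstance

noncomputable instance Matrix.SpecialLinearGroup.instMeasurableSpace'
    {n : Type*} [DecidableEq n] [Fintype n] {R : Type*} [CommRing R] [TopologicalSpace R] :
    MeasurableSpace (SpecialLinearGroup n R) := borel _

/-- A finite set of distinct primes `p 0, …, p (s-1)`. -/
structure PrimeTup where
  s : ℕ
  p : Fin s → ℕ
  hp : ∀ i, (p i).Prime
  inj : Function.Injective p

namespace PrimeTup

instance (S : PrimeTup) (i : Fin S.s) : Fact (S.p i).Prime := ⟨S.hp i⟩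

/-- The `p i`-adic field. -/
abbrev Qp (S : PrimeTup) (i : Fin S.s) : Type := ℚ_[S.p i]

/-- The space `ℚ_S^d = ℝ^d × ∏ᵢ ℚ_{pᵢ}^d`. -/
abbrev QS (S : PrimeTup) (d : ℕ) : Type :=
  (Fin d → ℝ) × ((i : Fin S.s) → Fin d → S.Qp i)

/-- The ring `ℤ_S = ℤ[1/p₁, …, 1/p_s] ⊆ ℚ`. -/
def Zs (S : PrimeTup) : Subring ℚ :=
  Subring.closure (Set.range fun i : Fin S.s => ((S.p i : ℚ))⁻¹)

/-- The group `G_d = SL_d(ℝ) × ∏ᵢ SL_d(ℚ_{pᵢ})`. -/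
abbrev G (S : PrimeTup) (d : ℕ) : Type :=
  SpecialLinearGroup (Fin d) ℝ × ((i : Fin S.s) → SpecialLinearGroup (Fin d) (S.Qp i))

/-- Diagonal embedding of `SL_d(ℤ_S)` into `G_d`. -/
def toG (S : PrimeTup) (d : ℕ) : SpecialLinearGroup (Fin d) S.Zs →* S.G d :=
  MonoidHom.prod
    (SpecialLinearGroup.map ((Rat.castHom ℝ).comp S.Zs.subtype))
    (Pi.monoidHom fun i => SpecialLinearGroup.map ((Rat.castHom (S.Qp i)).comp S.Zs.subtype))

/-- The lattice `Γ_d`, the diagonally embedded copy of `SL_d(ℤ_S)` in `G_d`. -/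
def Gamma (S : PrimeTup) (d : ℕ) : Subgroup (S.G d) := (S.toG d).range

/-- The componentwise linear action of `G_d` on `ℚ_S^d`. -/
def act (S : PrimeTup) {d : ℕ} (g : S.G d) (x : S.QS d) : S.QS d :=
  ((g.1 : Matrix (Fin d) (Fin d) ℝ).mulVec x.1,
   fun i => ((g.2 i : Matrix (Fin d) (Fin d) (S.Qp i))).mulVec (x.2 i))

/-- Diagonal embedding of rational vectors into `ℚ_S^d`. -/
def diag (S : PrimeTup) {d : ℕ} (v : Fin d → ℚ) : S.QS d :=
  (fun j => (v j : ℝ), fun i j => (v j : S.Qp i))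

/-- The first standard basis vector of `ℤ_S^d`. -/
def e1 (S : PrimeTup) (d : ℕ) : Fin d → S.Zs := fun j => if j.1 = 0 then 1 else 0

/-- The set of `S`-primitive vectors `P(ℤ_S^d) = SL_d(ℤ_S)·e₁` inside `(ℤ_S)^d`. -/
def primZs (S : PrimeTup) (d : ℕ) : Set (Fin d → S.Zs) :=
  {w | ∃ γ : SpecialLinearGroup (Fin d) S.Zs,
    w = (γ : Matrix (Fin d) (Fin d) S.Zs).mulVec (S.e1 d)}

/-- The set of `S`-primitive vectors regarded inside `ℚ_S^d` via the diagonal embedding. -/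
def prim (S : PrimeTup) (d : ℕ) : Set (S.QS d) :=
  (fun w : Fin d → S.Zs => S.diag fun j => ((w j : ℚ))) '' S.primZs d

/-- Multiplication of a vector of `ℚ_S^d` by a (diagonally embedded) rational scalar. -/
def ratSMul (S : PrimeTup) {d : ℕ} (q : ℚ) (x : S.QS d) : S.QS d :=
  (fun j => (q : ℝ) * x.1 j, fun i j => (q : S.Qp i) * x.2 i j)

/-- `ℕ_S`: positive integers coprime to all the primes of `S`. -/
def NS (S : PrimeTup) : Set ℕ := {m | 0 < m ∧ ∀ i, ¬ (S.p i ∣ m)}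

/-- The `S`-arithmetic zeta value `ζ_S(d)`. -/
def zetaS (S : PrimeTup) (d : ℕ) : ℝ := ∑' m : S.NS, (1 : ℝ) / ((m : ℕ) : ℝ) ^ d

/-- The "unit box" `[0,1]^d × ∏ᵢ ℤ_{pᵢ}^d` used to normalize the volume on `ℚ_S^d`. -/
def unitBox (S : PrimeTup) (d : ℕ) : Set (S.QS d) :=
  {x | (∀ j, x.1 j ∈ Set.Icc (0:ℝ) 1) ∧ ∀ i j, ‖x.2 i j‖ ≤ 1}

/-- `v` is the measure `vol_S` on `ℚ_S^d`: the (unique) translation-invariant regular Borel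
measure giving the unit box `[0,1]^d × ∏ᵢ ℤ_{pᵢ}^d` measure one; equivalently, the product of
Lebesgue measure on `ℝ^d` and the normalized Haar measures on the `ℚ_{pᵢ}^d`. -/
def IsVolS (S : PrimeTup) (d : ℕ) (v : Measure (S.QS d)) : Prop :=
  v.IsAddHaarMeasure ∧ v.Regular ∧ v (S.unitBox d) = 1

/-- `μ` is an admissible measure on `G_d/Γ_d`: a regular Borel probability measure invariant
under the left `G_d`-action. -/
def Admissible (S : PrimeTup) (d : ℕ) (μ : Measure (S.G d ⧸ S.Gamma d)) : Prop :=
  IsProbabilityMeasure μ ∧ μ.Regular ∧ SMulInvariantMeasure (S.G d) (S.G d ⧸ S.Gamma d) μ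

end PrimeTup

end

set_option linter.unusedSectionVars false

section MatrixMeasure

instance Matrix.instMeasurableSpaceAux {m n R : Type} [MeasurableSpace R] :
    MeasurableSpace (Matrix m n R) := inferInstanceAs (MeasurableSpace (m → n → R))

noncomputable instance Matrix.instMeasureSpaceAux {m n R : Type} [Fintype m] [Fintype n]
    [MeasureSpace R] : MeasureSpace (Matrix m n R) :=
  inferInstanceAs (MeasureSpace (m → n → R))

instance Matrix.instBorelSpaceAux {m n R : Type} [Fintype m] [Fintype n]
    [TopologicalSpace R] [SecondCountableTopology R] [MeasurableSpace R] [BorelSpace R] :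
    BorelSpace (Matrix m n R) := inferInstanceAs (BorelSpace (m → n → R))

instance Matrix.instSecondCountableAux {m n R : Type} [Fintype m] [Fintype n]
    [TopologicalSpace R] [SecondCountableTopology R] :
    SecondCountableTopology (Matrix m n R) :=
  inferInstanceAs (SecondCountableTopology (m → n → R))

instance Matrix.instSigmaFiniteAux {m n R : Type} [Fintype m] [Fintype n]
    [MeasureSpace R] [SigmaFinite (volume : Measure R)] :
    SigmaFinite (volume : Measure (Matrix m n R)) :=
  inferInstanceAs (SigmaFinite (volume : Measure (m → n → R)))

end MatrixMeasure

section Blocks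

variable {R : Type} [CommRing R]

/-- The matrix with first row `r` and remaining rows `M`. -/
def consRow {R : Type} {k n : ℕ} (r : Fin n → R) (M : Matrix (Fin k) (Fin n) R) :
    Matrix (Fin (k + 1)) (Fin n) R := Matrix.of (Fin.cons r M)

/-- The matrix with first column `t` and remaining columns `M`. -/
def consCol {R : Type} {k n : ℕ} (t : Fin k → R) (M : Matrix (Fin k) (Fin n) R) :
    Matrix (Fin k) (Fin (n + 1)) R := Matrix.of fun i => Fin.cons (t i) (M i)

/-- The block matrix with first row `e₁`, first column `(1, t)` and lower right block `M`. -/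
def lowerBlk {k : ℕ} (t : Fin k → R) (M : Matrix (Fin k) (Fin k) R) :
    Matrix (Fin (k + 1)) (Fin (k + 1)) R := consRow (Fin.cons 1 0) (consCol t M)

omit [CommRing R] in
@[simp] lemma consRow_zero {k n : ℕ} (r : Fin n → R) (M : Matrix (Fin k) (Fin n) R) :
    consRow r M 0 = r := rfl
omit [CommRing R] in
@[simp] lemma consRow_succ {k n : ℕ} (r : Fin n → R) (M : Matrix (Fin k) (Fin n) R) (i : Fin k) :
    consRow r M i.succ = M i := rfl
omit [CommRing R] in
@[simp] lemma consCol_zero {k n : ℕ} (t : Fin k → R) (M : Matrix (Fin k) (Fin n) R) (i : Fin k) :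
    consCol t M i 0 = t i := rfl
omit [CommRing R] in
@[simp] lemma consCol_succ {k n : ℕ} (t : Fin k → R) (M : Matrix (Fin k) (Fin n) R) (i : Fin k)
    (j : Fin n) : consCol t M i j.succ = M i j := rfl
@[simp] lemma lowerBlk_zero_zero {k : ℕ} (t : Fin k → R) (M : Matrix (Fin k) (Fin k) R) :
    lowerBlk t M 0 0 = 1 := rfl
@[simp] lemma lowerBlk_zero_succ {k : ℕ} (t : Fin k → R) (M : Matrix (Fin k) (Fin k) R)
    (j : Fin k) : lowerBlk t M 0 j.succ = 0 := rfl
@[simp] lemma lowerBlk_succ_zero {k : ℕ} (t : Fin k → R) (M : Matrix (Fin k) (Fin k) R)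
    (i : Fin k) : lowerBlk t M i.succ 0 = t i := rfl
@[simp] lemma lowerBlk_succ_succ {k : ℕ} (t : Fin k → R) (M : Matrix (Fin k) (Fin k) R)
    (i j : Fin k) : lowerBlk t M i.succ j.succ = M i j := rfl

lemma consRow_mul {k n l : ℕ} (r : Fin n → R) (M : Matrix (Fin k) (Fin n) R)
    (N : Matrix (Fin n) (Fin l) R) : consRow r M * N = consRow (r ᵥ* N) (M * N) := by
  ext i j
  refine Fin.cases ?_ (fun i => ?_) i <;> simp [Matrix.mul_apply, Matrix.vecMul, dotProduct]

lemma mul_consCol {k n l : ℕ} (t : Fin k → R) (M : Matrix (Fin k) (Fin n) R)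
    (N : Matrix (Fin l) (Fin k) R) : N * consCol t M = consCol (N *ᵥ t) (N * M) := by
  ext i j
  refine Fin.cases ?_ (fun i => ?_) j <;> simp [Matrix.mul_apply, Matrix.mulVec, dotProduct]

lemma cons_vecMul_lowerBlk {k : ℕ} (a : R) (v : Fin k → R) (t : Fin k → R)
    (M : Matrix (Fin k) (Fin k) R) :
    (Fin.cons a v : Fin (k + 1) → R) ᵥ* lowerBlk t M = Fin.cons (a + v ⬝ᵥ t) (v ᵥ* M) := by
  ext j
  refine Fin.cases ?_ (fun j => ?_) j <;>
    simp [Matrix.vecMul, dotProduct, Fin.sum_univ_succ]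

lemma lowerBlk_mul {k : ℕ} (x t : Fin k → R) (g M : Matrix (Fin k) (Fin k) R) :
    lowerBlk x g * lowerBlk t M = lowerBlk (x + g *ᵥ t) (g * M) := by
  ext i j
  refine Fin.cases ?_ (fun i => ?_) i <;> refine Fin.cases ?_ (fun j => ?_) j <;>
    simp [Matrix.mul_apply, Matrix.mulVec, dotProduct, Fin.sum_univ_succ]

lemma lowerBlk_mul_zero {k : ℕ} (t : Fin k → R) (M : Matrix (Fin k) (Fin k) R)
    (N : Matrix (Fin (k + 1)) (Fin (k + 1)) R) : (lowerBlk t M * N) 0 = N 0 := by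
  ext j
  simp [Matrix.mul_apply, Fin.sum_univ_succ]

@[simp] lemma det_lowerBlk {k : ℕ} (t : Fin k → R) (M : Matrix (Fin k) (Fin k) R) :
    (lowerBlk t M).det = M.det := by
  rw [Matrix.det_succ_row_zero, Fin.sum_univ_succ]
  simp only [lowerBlk_zero_succ, lowerBlk_zero_zero, mul_zero, zero_mul, Finset.sum_const_zero,
    add_zero, Fin.val_zero, pow_zero, one_mul]
  congr 1

lemma lowerBlk_inj {k : ℕ} {t t' : Fin k → R} {M M' : Matrix (Fin k) (Fin k) R}
    (h : lowerBlk t M = lowerBlk t' M') : t = t' ∧ M = M' :=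
  ⟨funext fun i => congr_fun (congr_fun h i.succ) 0,
    Matrix.ext fun i j => congr_fun (congr_fun h i.succ) j.succ⟩

lemma lowerBlk_map {k : ℕ} {R' : Type} [CommRing R'] (f : R →+* R') (t : Fin k → R)
    (M : Matrix (Fin k) (Fin k) R) :
    (lowerBlk t M).map f = lowerBlk (f ∘ t) (M.map f) := by
  ext i j
  refine Fin.cases ?_ (fun i => ?_) i <;> refine Fin.cases ?_ (fun j => ?_) j <;> simp

lemma eq_lowerBlk_of_row_zero {k : ℕ} {T : Matrix (Fin (k + 1)) (Fin (k + 1)) R}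
    (h : T 0 = Fin.cons 1 0) :
    T = lowerBlk (fun i => T i.succ 0) (Matrix.of fun i j => T i.succ j.succ) := by
  ext i j
  refine Fin.cases ?_ (fun i => ?_) i
  · rw [h]; rfl
  · refine Fin.cases ?_ (fun j => ?_) j <;> simp

/-- A matrix of determinant one with prescribed first row `r`, when `r 0` is a unit. -/
noncomputable def hmat {n : ℕ} (r : Fin (n + 2) → R) : Matrix (Fin (n + 2)) (Fin (n + 2)) R :=
  consRow r (consCol 0 (Matrix.diagonal (Fin.cons (Ring.inverse (r 0)) 1)))

@[simp] lemma hmat_zero {n : ℕ} (r : Fin (n + 2) → R) : hmat r 0 = r := rfl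

lemma det_hmat {n : ℕ} {r : Fin (n + 2) → R} (h : IsUnit (r 0)) : (hmat r).det = 1 := by
  rw [Matrix.det_succ_column_zero, Fin.sum_univ_succ]
  have h1 : (hmat r).submatrix (Fin.succAbove 0) Fin.succ =
      Matrix.diagonal (Fin.cons (Ring.inverse (r 0)) 1) := by
    ext i j; simp [hmat]
  have h2 : ∀ i : Fin (n + 1), hmat r i.succ 0 = 0 := fun i => by simp [hmat]
  rw [h1]
  simp [h2, Matrix.det_diagonal, Fin.prod_univ_succ, Ring.mul_inverse_cancel _ h]

lemma eq_lowerBlk_mul_hmat {n : ℕ} {M : Matrix (Fin (n + 2)) (Fin (n + 2)) R}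
    (h : IsUnit (M 0 0)) : ∃ t M', M = lowerBlk t M' * hmat (M 0) := by
  have hd := det_hmat h
  have h1 : (M * (hmat (M 0)).adjugate) * hmat (M 0) = M := by
    rw [Matrix.mul_assoc, Matrix.adjugate_mul, hd, one_smul, Matrix.mul_one]
  have h0 : (M * (hmat (M 0)).adjugate) 0 = Fin.cons 1 0 := by
    have : (hmat (M 0) * (hmat (M 0)).adjugate) 0 = Fin.cons 1 0 := by
      rw [Matrix.mul_adjugate, hd, one_smul]
      ext j
      refine Fin.cases ?_ (fun j => ?_) j
      · simp
      · simp [Matrix.one_apply_ne (Fin.succ_ne_zero j).symm]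
    rw [← this]
    ext j
    simp [Matrix.mul_apply]
  exact ⟨_, _, by rw [← eq_lowerBlk_of_row_zero h0, h1]⟩

/-- The first column of `M * (hmat (M 0))⁻¹` without its top entry. -/
noncomputable def tpart {n : ℕ} (M : Matrix (Fin (n + 2)) (Fin (n + 2)) R) : Fin (n + 1) → R :=
  fun i => (M * (hmat (M 0)).adjugate) i.succ 0

/-- The lower right block of `M * (hmat (M 0))⁻¹`. -/
noncomputable def mpart {n : ℕ} (M : Matrix (Fin (n + 2)) (Fin (n + 2)) R) :
    Matrix (Fin (n + 1)) (Fin (n + 1)) R :=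
  Matrix.of fun i j => (M * (hmat (M 0)).adjugate) i.succ j.succ

lemma tpart_mpart_lowerBlk_mul_hmat {n : ℕ} {r : Fin (n + 2) → R} (h : IsUnit (r 0))
    (t : Fin (n + 1) → R) (M : Matrix (Fin (n + 1)) (Fin (n + 1)) R) :
    tpart (lowerBlk t M * hmat r) = t ∧ mpart (lowerBlk t M * hmat r) = M := by
  have h0 : (lowerBlk t M * hmat r) 0 = r := by rw [lowerBlk_mul_zero, hmat_zero]
  have h1 : lowerBlk t M * hmat r * (hmat ((lowerBlk t M * hmat r) 0)).adjugate = lowerBlk t M := by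
    rw [h0, Matrix.mul_assoc, Matrix.mul_adjugate, det_hmat h, one_smul, Matrix.mul_one]
  unfold tpart mpart
  rw [h1]
  exact ⟨rfl, rfl⟩

end Blocks

section Slices

variable {A : Type} [MeasureSpace A]
  [SigmaFinite (volume : Measure A)]

lemma lintegral_fin_cons {k : ℕ} {F : (Fin (k + 1) → A) → ℝ≥0∞} (hF : Measurable F) :
    ∫⁻ x, F x = ∫⁻ a : A, ∫⁻ y : Fin k → A, F (Fin.cons a y) := by
  have h := (volume_preserving_piFinSuccAbove (fun _ : Fin (k + 1) => A) 0).symm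
  rw [← h.lintegral_comp hF, MeasureTheory.Measure.volume_eq_prod, lintegral_prod]
  · simp [MeasurableEquiv.piFinSuccAbove, Fin.insertNthEquiv]
  · exact (hF.comp (MeasurableEquiv.measurable _)).aemeasurable

lemma measurePreserving_fin_cons {k : ℕ} : MeasurePreserving
    (fun p : A × (Fin k → A) => (Fin.cons p.1 p.2 : Fin (k + 1) → A)) := by
  have h := (volume_preserving_piFinSuccAbove (fun _ : Fin (k + 1) => A) 0).symm
  convert h using 2 with p
  simp [MeasurableEquiv.piFinSuccAbove, Fin.insertNthEquiv]

lemma measurePreserving_consRow {k n : ℕ} : MeasurePreserving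
    (fun p : (Fin n → A) × Matrix (Fin k) (Fin n) A => consRow p.1 p.2) :=
  measurePreserving_fin_cons (A := Fin n → A) (k := k)

lemma measurePreserving_consCol {k n : ℕ} : MeasurePreserving
    (fun p : (Fin k → A) × Matrix (Fin k) (Fin n) A => consCol p.1 p.2) := by
  have h1 := (volume_measurePreserving_arrowProdEquivProdArrow A (Fin n → A) (Fin k)).symm
  have h2 := volume_preserving_pi (fun _ : Fin k => measurePreserving_fin_cons (A := A) (k := n))
  exact h2.comp h1

end Slices

/-- The set of first rows of matrices in `SL_{n+1}(O)`. -/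
def primRows (O : Type) [CommRing O] (n : ℕ) : Set (Fin (n + 1) → O) :=
  Set.range fun γ : SpecialLinearGroup (Fin (n + 1)) O => (γ : Matrix (Fin (n + 1)) (Fin (n + 1)) O) 0

/-- A locally compact ring `A` containing an arithmetic ring `O` as a lattice, with the structure
needed for the mean value theorems of the geometry of numbers. -/
structure ArithRing (A O : Type) [NormedCommRing A] [MeasureSpace A] [CommRing O] where
  /-- the embedding of the lattice -/
  ι : O →+* A
  isUnit_ι : ∀ o, o ≠ 0 → IsUnit (ι o)
  /-- a fundamental domain for the lattice -/
  box : Set A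
  measurableSet_box : MeasurableSet box
  isBounded_box : Bornology.IsBounded box
  box_tile : ∀ a, ∃! o, ι o + a ∈ box
  volume_box : volume box = 1
  ae_isUnit : ∀ᵐ a : A, IsUnit a
  /-- the module function of `A` -/
  md : A → ℝ≥0∞
  measurable_md : Measurable md
  md_ne_zero : ∀ a, IsUnit a → md a ≠ 0
  md_ne_top : ∀ a, IsUnit a → md a ≠ ∞
  lintegral_mul : ∀ u, IsUnit u → ∀ f : A → ℝ≥0∞, Measurable f →
    md u * ∫⁻ x, f (u * x) = ∫⁻ x, f x
  measurePreserving_vecMul : ∀ n (g : Matrix (Fin n) (Fin n) A), g.det = 1 →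
    MeasurePreserving (fun x : Fin n → A => x ᵥ* g)
  sep : ∃ ε > (0 : ℝ), ∀ o, ‖ι o‖ < ε → o = 0
  /-- the set of possible contents of lattice vectors -/
  N : Set ℕ
  N_pos : ∀ m ∈ N, 0 < m
  N_one : 1 ∈ N
  N_mul : ∀ m ∈ N, ∀ m' ∈ N, m * m' ∈ N
  N_dvd : ∀ m ∈ N, ∀ m', m' ∣ m → m' ∈ N
  md_natCast : ∀ m ∈ N, md (m : A) = m
  natCast_ne_zero : ∀ m ∈ N, (m : O) ≠ 0
  content : ∀ n (v : Fin (n + 2) → O), v ≠ 0 → ∃ m ∈ N, ∃ p ∈ primRows O (n + 1), v = (m : O) • p ∧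
    ∀ m' ∈ N, ∀ p' ∈ primRows O (n + 1), v = (m' : O) • p' → m' = m ∧ p' = p
  /-- an exhaustion of `A` by boxes -/
  C : ℕ → ℕ → Set A
  measurableSet_C : ∀ x k, MeasurableSet (C x k)
  /-- the volume factor of the exhaustion -/
  cvol : ℕ → ℝ≥0∞
  one_le_cvol : ∀ k, 1 ≤ cvol k
  cvol_ne_top : ∀ k, cvol k ≠ ∞
  volume_C : ∀ x k, volume (C x k) = x * cvol k
  C_add : ∀ R : ℕ, ∃ k₀, ∀ k ≥ k₀, ∀ x, ∀ a ∈ C x k, ∀ b, ‖b‖ ≤ R → a + b ∈ C (x + R) k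

namespace ArithRing

variable {A O : Type} [NormedCommRing A] [ProperSpace A] [MeasureSpace A]
  [BorelSpace A] [(volume : Measure A).IsAddHaarMeasure] [CommRing O] (D : ArithRing A O)

include D in
lemma measurePreserving_mul_right {k n : ℕ} {g : Matrix (Fin n) (Fin n) A} (hg : g.det = 1) :
    MeasurePreserving (fun M : Matrix (Fin k) (Fin n) A => M * g) :=
  volume_preserving_pi (fun _ : Fin k => D.measurePreserving_vecMul n g hg)

include D in
lemma measurePreserving_mulVec {n : ℕ} {g : Matrix (Fin n) (Fin n) A} (hg : g.det = 1) :
    MeasurePreserving (fun x : Fin n → A => g *ᵥ x) := by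
  have := D.measurePreserving_vecMul n gᵀ (by rw [det_transpose, hg])
  simpa only [vecMul_transpose] using this

lemma measurable_mul_left {m k n : ℕ} (g : Matrix (Fin m) (Fin k) A) :
    Measurable (fun M : Matrix (Fin k) (Fin n) A => g * M) :=
  (continuous_const.matrix_mul continuous_id).measurable

lemma measurable_mul_right {m k n : ℕ} (g : Matrix (Fin k) (Fin n) A) :
    Measurable (fun M : Matrix (Fin m) (Fin k) A => M * g) :=
  (continuous_id.matrix_mul continuous_const).measurable

include D in
lemma measurePreserving_mul_left {k n : ℕ} {g : Matrix (Fin k) (Fin k) A} (hg : g.det = 1) :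
    MeasurePreserving (fun M : Matrix (Fin k) (Fin n) A => g * M) := by
  induction n with
  | zero =>
    convert MeasurePreserving.id _ using 1
    funext M
    exact Subsingleton.elim _ _
  | succ n ih =>
    have h1 := measurePreserving_consCol (A := A) (k := k) (n := n)
    have h2 := (D.measurePreserving_mulVec hg).prod ih
    have h3 := h1.comp h2
    refine ⟨measurable_mul_left g, ?_⟩
    conv_lhs => rw [← h1.map_eq]
    rw [Measure.map_map (measurable_mul_left g) h1.measurable]
    have h4 : (fun M : Matrix (Fin k) (Fin (n + 1)) A => g * M) ∘
        (fun p : (Fin k → A) × Matrix (Fin k) (Fin n) A => consCol p.1 p.2) =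
        (fun p => consCol p.1 p.2) ∘ Prod.map (fun x => g *ᵥ x) fun M => g * M :=
      funext fun p => mul_consCol _ _ _
    rw [h4]
    exact h3.map_eq

lemma measurable_lowerBlk {k : ℕ} : Measurable
    (fun p : (Fin k → A) × Matrix (Fin k) (Fin k) A => lowerBlk p.1 p.2) := by
  have h1 := measurePreserving_consRow (A := A) (k := k) (n := k + 1)
  have h2 := measurePreserving_consCol (A := A) (k := k) (n := k)
  exact h1.measurable.comp (measurable_const.prodMk h2.measurable)

include D in
/-- Almost every vector has a unit in each coordinate. -/
lemma ae_isUnit_apply {n : ℕ} (i : Fin n) : ∀ᵐ r : Fin n → A, IsUnit (r i) :=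
  (Measure.quasiMeasurePreserving_eval (fun _ : Fin n => (volume : Measure A)) i).ae D.ae_isUnit

lemma lintegral_consRow {k n : ℕ} {Ψ : Matrix (Fin (k + 1)) (Fin n) A → ℝ≥0∞}
    (hΨ : Measurable Ψ) :
    ∫⁻ M, Ψ M = ∫⁻ r, ∫⁻ R, Ψ (consRow r R) := by
  have h := measurePreserving_consRow (A := A) (k := k) (n := n)
  rw [← h.lintegral_comp hΨ, MeasureTheory.Measure.volume_eq_prod, lintegral_prod]
  exact (hΨ.comp h.measurable).aemeasurable

lemma lintegral_consCol {k n : ℕ} {Ψ : Matrix (Fin k) (Fin (n + 1)) A → ℝ≥0∞}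
    (hΨ : Measurable Ψ) :
    ∫⁻ M, Ψ M = ∫⁻ t, ∫⁻ R, Ψ (consCol t R) := by
  have h := measurePreserving_consCol (A := A) (k := k) (n := n)
  rw [← h.lintegral_comp hΨ, MeasureTheory.Measure.volume_eq_prod, lintegral_prod]
  exact (hΨ.comp h.measurable).aemeasurable

lemma consRow_mul_hmat {n : ℕ} (r : Fin (n + 2) → A) (t : Fin (n + 1) → A)
    (M : Matrix (Fin (n + 1)) (Fin (n + 1)) A) :
    consRow r (consCol t M * hmat r) = lowerBlk t M * hmat r := by
  unfold lowerBlk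
  rw [consRow_mul]
  congr 1
  ext j
  simp [Matrix.vecMul, dotProduct, Fin.sum_univ_succ]

include D in
/-- Disintegration of the volume on square matrices along the first row. -/
lemma lintegral_matrix_succ {n : ℕ} {Ψ : Matrix (Fin (n + 2)) (Fin (n + 2)) A → ℝ≥0∞}
    (hΨ : Measurable Ψ) :
    ∫⁻ M, Ψ M = ∫⁻ r, ∫⁻ t, ∫⁻ M', Ψ (lowerBlk t M' * hmat r) := by
  rw [lintegral_consRow hΨ]
  refine lintegral_congr_ae ?_
  filter_upwards [D.ae_isUnit_apply (n := n + 2) 0] with r hr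
  have hm : Measurable fun R : Matrix (Fin (n + 1)) (Fin (n + 2)) A => Ψ (consRow r R) :=
    hΨ.comp ((measurePreserving_consRow (A := A)).measurable.comp measurable_prodMk_left)
  have h := D.measurePreserving_mul_right (k := n + 1) (det_hmat hr)
  rw [← h.lintegral_comp hm]
  refine (lintegral_consCol (hm.comp h.measurable)).trans ?_
  simp only [Function.comp_apply, consRow_mul_hmat]

lemma measurable_det {n : ℕ} : Measurable (fun M : Matrix (Fin n) (Fin n) A => M.det) :=
  (continuous_id.matrix_det).measurable

variable [CompleteSpace A]

lemma isOpen_isUnit_det {n : ℕ} : IsOpen {M : Matrix (Fin n) (Fin n) A | IsUnit M.det} :=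
  Units.isOpen.preimage (continuous_id.matrix_det)

include D in
lemma ae_isUnit_det {n : ℕ} : ∀ᵐ M : Matrix (Fin (n + 1)) (Fin (n + 1)) A, IsUnit M.det := by
  induction n with
  | zero =>
    have h := (Measure.quasiMeasurePreserving_eval
      (fun _ : Fin 1 => (volume : Measure (Fin 1 → A))) 0).ae (D.ae_isUnit_apply 0)
    filter_upwards [h] with M hM
    rw [Matrix.det_fin_one]
    exact hM
  | succ n ih =>
    have hS : MeasurableSet {M : Matrix (Fin (n + 2)) (Fin (n + 2)) A | IsUnit M.det} :=
      isOpen_isUnit_det.measurableSet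
    rw [ae_iff]
    change volume {M : Matrix (Fin (n + 2)) (Fin (n + 2)) A | IsUnit M.det}ᶜ = 0
    rw [← lintegral_indicator_one hS.compl,
      D.lintegral_matrix_succ (measurable_one.indicator hS.compl), lintegral_eq_zero_of_ae_eq_zero]
    filter_upwards [D.ae_isUnit_apply 0] with r hr
    refine lintegral_eq_zero_of_ae_eq_zero (Filter.Eventually.of_forall fun t => ?_)
    refine lintegral_eq_zero_of_ae_eq_zero ?_
    filter_upwards [ih] with M hM
    simp [Set.indicator, det_hmat hr, hM]

end ArithRing

namespace ArithRing

variable {A O : Type} [NormedCommRing A] [ProperSpace A] [MeasureSpace A]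
  [BorelSpace A] [(volume : Measure A).IsAddHaarMeasure] [CommRing O] (D : ArithRing A O)
  [CompleteSpace A] [Countable O]

instance instCountableSL {n : ℕ} {O : Type} [CommRing O] [Countable O] :
    Countable (SpecialLinearGroup (Fin n) O) :=
  Function.Injective.countable (f := fun (γ : SpecialLinearGroup (Fin n) O) (i j : Fin n) =>
    (γ : Matrix (Fin n) (Fin n) O) i j)
    fun _ _ h => Subtype.ext h

/-- The image of a lattice matrix in the matrices over `A`. -/
def mat {n : ℕ} (γ : SpecialLinearGroup (Fin n) O) : Matrix (Fin n) (Fin n) A :=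
  (γ : Matrix (Fin n) (Fin n) O).map D.ι

@[simp] lemma det_mat {n : ℕ} (γ : SpecialLinearGroup (Fin n) O) : (D.mat γ).det = 1 := by
  unfold mat
  rw [← RingHom.mapMatrix_apply, ← RingHom.map_det, γ.2, map_one]

lemma mat_mul {n : ℕ} (γ γ' : SpecialLinearGroup (Fin n) O) :
    D.mat (γ * γ') = D.mat γ * D.mat γ' := by
  change ((γ : Matrix (Fin n) (Fin n) O) * (γ' : Matrix (Fin n) (Fin n) O)).map D.ι = _
  rw [Matrix.map_mul]
  rfl

@[simp] lemma mat_one {n : ℕ} : D.mat (1 : SpecialLinearGroup (Fin n) O) = 1 := by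
  exact Matrix.map_one _ (map_zero _) (map_one _)

lemma exists_nhds_separated {n : ℕ} {M₀ : Matrix (Fin n) (Fin n) A} (h : IsUnit M₀.det) :
    ∃ U ∈ nhds M₀, ∀ (γ : SpecialLinearGroup (Fin n) O), ∀ M ∈ U, D.mat γ * M ∈ U → γ = 1 := by
  obtain ⟨ε, hε, hsep⟩ := D.sep
  let F : Matrix (Fin n) (Fin n) A × Matrix (Fin n) (Fin n) A → Matrix (Fin n) (Fin n) A :=
    fun p => p.2 * (Ring.inverse p.1.det • p.1.adjugate)
  have hF : ContinuousAt F (M₀, M₀) := by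
    have h1 : ContinuousAt (fun p : Matrix (Fin n) (Fin n) A × Matrix (Fin n) (Fin n) A =>
        Ring.inverse p.1.det) (M₀, M₀) := by
      have h2 : ContinuousAt Ring.inverse M₀.det := by
        obtain ⟨u, hu⟩ := h
        rw [← hu]
        exact NormedRing.inverse_continuousAt u
      exact ContinuousAt.comp (f := fun p : Matrix (Fin n) (Fin n) A × Matrix (Fin n) (Fin n) A =>
        p.1.det) (x := (M₀, M₀)) h2 (continuous_fst.matrix_det.continuousAt)
    have h3 : ContinuousAt (fun p : Matrix (Fin n) (Fin n) A × Matrix (Fin n) (Fin n) A =>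
        Ring.inverse p.1.det • p.1.adjugate) (M₀, M₀) :=
      h1.smul continuous_fst.matrix_adjugate.continuousAt
    have h4 : Continuous (fun q : Matrix (Fin n) (Fin n) A × Matrix (Fin n) (Fin n) A =>
      q.1 * q.2) := continuous_fst.matrix_mul continuous_snd
    exact h4.continuousAt.comp (continuous_snd.continuousAt.prodMk h3)
  have hF0 : ∀ (M : Matrix (Fin n) (Fin n) A), IsUnit M.det →
      ∀ γ : SpecialLinearGroup (Fin n) O, F (M, D.mat γ * M) = D.mat γ := by
    intro M hM γ
    simp only [F]
    rw [Matrix.mul_smul, Matrix.mul_assoc, Matrix.mul_adjugate, Matrix.mul_smul, smul_smul,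
      Ring.inverse_mul_cancel _ hM, one_smul, Matrix.mul_one]
  have hF1 : F (M₀, M₀) = 1 := by
    have := hF0 M₀ h 1
    rwa [mat_one, Matrix.one_mul] at this
  have hV : {X : Matrix (Fin n) (Fin n) A | ∀ i j, ‖X i j - (1 : Matrix _ _ A) i j‖ < ε} ∈
      nhds (F (M₀, M₀)) := by
    refine IsOpen.mem_nhds ?_ ?_
    · simp only [Set.ofPred_forall]
      refine isOpen_iInter_of_finite fun i => isOpen_iInter_of_finite fun j => ?_
      exact isOpen_lt ((continuous_id.matrix_elem i j).sub continuous_const).norm continuous_const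
    · rw [hF1]; intro i j; simpa using hε
  have h5 := hF.preimage_mem_nhds hV
  rw [nhds_prod_eq, Filter.mem_prod_same_iff] at h5
  obtain ⟨U, hU, hUF⟩ := h5
  refine ⟨U ∩ {M | IsUnit M.det}, Filter.inter_mem hU (isOpen_isUnit_det.mem_nhds h), ?_⟩
  intro γ M hM hγM
  have h6 := hUF (Set.mk_mem_prod hM.1 hγM.1)
  simp only [Set.mem_preimage, Set.mem_ofPred_eq, hF0 M hM.2] at h6
  ext i j
  have h7 := hsep ((γ : Matrix (Fin n) (Fin n) O) i j - (1 : Matrix (Fin n) (Fin n) O) i j) (by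
    convert h6 i j using 2
    rw [map_sub]
    congr 1
    rw [← mat_one D]
    rfl)
  exact sub_eq_zero.mp h7

/-- There is a measurable weight whose sum over each orbit of the lattice group is one. -/
lemma exists_weight (n : ℕ) : ∃ w : Matrix (Fin n) (Fin n) A → ℝ≥0∞, Measurable w ∧
    ∀ M, IsUnit M.det → ∑' γ : SpecialLinearGroup (Fin n) O, w (D.mat γ * M) = 1 := by
  classical
  let small : Set (Set (Matrix (Fin n) (Fin n) A)) :=
    {b | b ∈ TopologicalSpace.countableBasis (Matrix (Fin n) (Fin n) A) ∧
      ∀ (γ : SpecialLinearGroup (Fin n) O), ∀ M ∈ b, D.mat γ * M ∈ b → γ = 1}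
  have hsc : small.Countable := (TopologicalSpace.countable_countableBasis _).mono fun b hb => hb.1
  have := hsc.to_subtype
  obtain ⟨ε, hε, hεs⟩ := ENNReal.exists_pos_sum_of_countable (ε := 1) one_ne_zero small
  let h : Matrix (Fin n) (Fin n) A → ℝ≥0∞ := fun M => ∑' b : small, b.1.indicator (fun _ => (ε b : ℝ≥0∞)) M
  have hh : Measurable h := by
    refine Measurable.tsum fun b => measurable_const.indicator ?_
    exact ((TopologicalSpace.isBasis_countableBasis _).isOpen b.2.1).measurableSet
  let H : Matrix (Fin n) (Fin n) A → ℝ≥0∞ := fun M =>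
    ∑' γ : SpecialLinearGroup (Fin n) O, h (D.mat γ * M)
  have hH : Measurable H := Measurable.tsum fun γ => hh.comp (measurable_mul_left _)
  have hHinv : ∀ γ M, H (D.mat γ * M) = H M := by
    intro γ M
    simp only [H]
    rw [← (Equiv.mulRight γ).tsum_eq fun γ' => h (D.mat γ' * M)]
    simp [mat_mul, Matrix.mul_assoc]
  have hHtop : ∀ M, H M ≠ ∞ := by
    intro M
    refine ne_top_of_le_ne_top one_ne_top (le_trans ?_ hεs.le)
    simp only [H, h]
    rw [ENNReal.tsum_comm]
    refine ENNReal.tsum_le_tsum fun b => ?_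
    by_cases hb : ∃ γ, D.mat γ * M ∈ b.1
    · obtain ⟨γ, hγ⟩ := hb
      rw [tsum_eq_single γ, Set.indicator_of_mem hγ]
      intro γ' hγ'
      refine Set.indicator_of_notMem (fun hmem => hγ' ?_) _
      have := b.2.2 (γ' * γ⁻¹) _ hγ (by
        rw [← Matrix.mul_assoc, ← mat_mul, inv_mul_cancel_right]; exact hmem)
      exact mul_inv_eq_one.mp this
    · push Not at hb
      simp [Set.indicator_of_notMem (hb _)]
  have hHpos : ∀ M, IsUnit M.det → H M ≠ 0 := by
    intro M hM
    obtain ⟨U, hU, hUs⟩ := D.exists_nhds_separated hM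
    obtain ⟨b, hb, hMb, hbU⟩ := (TopologicalSpace.isBasis_countableBasis _).mem_nhds_iff.mp hU
    have hbs : b ∈ small := ⟨hb, fun γ M h1 h2 => hUs γ M (hbU h1) (hbU h2)⟩
    have h1 : h M ≠ 0 := by
      intro h0
      have h2 := ENNReal.tsum_eq_zero.mp h0 ⟨b, hbs⟩
      rw [Set.indicator_of_mem hMb, ENNReal.coe_eq_zero] at h2
      exact (hε ⟨b, hbs⟩).ne' h2
    intro h0
    have h2 := ENNReal.tsum_eq_zero.mp h0 1
    rw [mat_one, Matrix.one_mul] at h2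
    exact h1 h2
  refine ⟨fun M => h M / H M, hh.div hH, fun M hM => ?_⟩
  simp_rw [hHinv, div_eq_mul_inv]
  rw [ENNReal.tsum_mul_right]
  exact ENNReal.mul_inv_cancel (hHpos M hM) (hHtop M)

/-- A chosen weight function. -/
noncomputable def weight (n : ℕ) : Matrix (Fin n) (Fin n) A → ℝ≥0∞ :=
  (D.exists_weight n).choose

@[fun_prop] lemma measurable_weight (n : ℕ) : Measurable (D.weight n) :=
  (D.exists_weight n).choose_spec.1

lemma tsum_weight {n : ℕ} {M : Matrix (Fin n) (Fin n) A} (hM : IsUnit M.det) :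
    ∑' γ : SpecialLinearGroup (Fin n) O, D.weight n (D.mat γ * M) = 1 :=
  (D.exists_weight n).choose_spec.2 M hM

end ArithRing

section Cosets

variable {O : Type} [CommRing O]

/-- The lower block triangular element of `SL_{k+1}(O)`. -/
def lowerSL {k : ℕ} (x : Fin k → O) (γ : SpecialLinearGroup (Fin k) O) :
    SpecialLinearGroup (Fin (k + 1)) O :=
  ⟨lowerBlk x (γ : Matrix (Fin k) (Fin k) O), by rw [det_lowerBlk]; exact γ.2⟩

/-- A chosen completion of a primitive row. -/
noncomputable def completion {k : ℕ} (p : primRows O k) : SpecialLinearGroup (Fin (k + 1)) O :=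
  p.2.choose

lemma completion_zero {k : ℕ} (p : primRows O k) :
    (completion p : Matrix (Fin (k + 1)) (Fin (k + 1)) O) 0 = p.1 :=
  p.2.choose_spec

lemma row_zero_mul {R : Type} [CommRing R] {k n : ℕ} (M : Matrix (Fin (k + 1)) (Fin (k + 1)) R)
    (N : Matrix (Fin (k + 1)) (Fin n) R) : (M * N) 0 = M 0 ᵥ* N := by
  ext j; simp [Matrix.mul_apply, Matrix.vecMul, dotProduct]

lemma bijective_lowerSL_mul_completion (k : ℕ) : Function.Bijective
    (fun q : primRows O k × (Fin k → O) × SpecialLinearGroup (Fin k) O =>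
      lowerSL q.2.1 q.2.2 * completion q.1) := by
  constructor
  · rintro ⟨p, x, γ⟩ ⟨p', x', γ'⟩ h
    have h0 : ∀ (p : primRows O k) x (γ : SpecialLinearGroup (Fin k) O),
        ((lowerSL x γ * completion p : SpecialLinearGroup (Fin (k + 1)) O) :
          Matrix (Fin (k + 1)) (Fin (k + 1)) O) 0 = p.1 := by
      intro p x γ
      change (lowerBlk x (γ : Matrix (Fin k) (Fin k) O) * (completion p : Matrix (Fin (k + 1)) (Fin (k + 1)) O)) 0 = _
      rw [lowerBlk_mul_zero, completion_zero]
    have hp : p = p' := by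
      apply Subtype.ext
      rw [← h0 p x γ, ← h0 p' x' γ']
      exact congr_arg (fun g : SpecialLinearGroup (Fin (k + 1)) O =>
        (g : Matrix (Fin (k + 1)) (Fin (k + 1)) O) 0) h
    subst hp
    have h1 := mul_right_cancel h
    have h2 := lowerBlk_inj (congr_arg Subtype.val h1)
    simp only [Prod.mk.injEq, true_and]
    exact ⟨h2.1, Subtype.ext h2.2⟩
  · intro γ
    let p : primRows O k := ⟨_, γ, rfl⟩
    have h1 : ((γ * (completion p)⁻¹ : SpecialLinearGroup (Fin (k + 1)) O) :
        Matrix (Fin (k + 1)) (Fin (k + 1)) O) 0 = Fin.cons 1 0 := by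
      have h2 : ((completion p * (completion p)⁻¹ : SpecialLinearGroup (Fin (k + 1)) O) :
        Matrix (Fin (k + 1)) (Fin (k + 1)) O) 0 = Fin.cons 1 0 := by
        rw [mul_inv_cancel]
        ext j
        change (1 : Matrix (Fin (k + 1)) (Fin (k + 1)) O) 0 j = _
        refine Fin.cases ?_ (fun j => ?_) j
        · simp
        · simp [Matrix.one_apply_ne (Fin.succ_ne_zero j).symm]
      rw [← h2]
      refine (row_zero_mul _ _).trans (Eq.trans ?_ (row_zero_mul _ _).symm)
      rw [completion_zero]
    have h3 := eq_lowerBlk_of_row_zero h1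
    have h4 := (γ * (completion p)⁻¹).2
    obtain ⟨γ', hγ'⟩ : ∃ γ', γ' = γ * (completion p)⁻¹ := ⟨_, rfl⟩
    rw [← hγ'] at h3 h4
    rw [h3, det_lowerBlk] at h4
    refine ⟨⟨p, (fun i => (γ' : Matrix (Fin (k + 1)) (Fin (k + 1)) O) i.succ 0), ⟨_, h4⟩⟩, ?_⟩
    have h5 : lowerSL _ ⟨_, h4⟩ = γ' := Subtype.ext h3.symm
    refine (congr_arg (· * completion p) h5).trans ?_
    rw [hγ', inv_mul_cancel_right]

lemma tsum_specialLinearGroup_succ {k : ℕ} (F : SpecialLinearGroup (Fin (k + 1)) O → ℝ≥0∞) :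
    ∑' γ, F γ = ∑' p : primRows O k, ∑' (x : Fin k → O), ∑' γ' : SpecialLinearGroup (Fin k) O,
      F (lowerSL x γ' * completion p) := by
  rw [← (Equiv.ofBijective _ (bijective_lowerSL_mul_completion (O := O) k)).tsum_eq F,
    ENNReal.tsum_prod']
  refine tsum_congr fun p => ?_
  rw [ENNReal.tsum_prod']
  rfl

end Cosets

namespace ArithRing

variable {A O : Type} [NormedCommRing A] [ProperSpace A] [MeasureSpace A]
  [BorelSpace A] [(volume : Measure A).IsAddHaarMeasure] [CommRing O] (D : ArithRing A O)
  [CompleteSpace A] [Countable O]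

/-- The image of a lattice vector. -/
def vec {n : ℕ} (v : Fin n → O) : Fin n → A := fun i => D.ι (v i)

/-- The fundamental box in `A^k`. -/
def boxPi (k : ℕ) : Set (Fin k → A) := Set.univ.pi fun _ => D.box

lemma measurableSet_boxPi (k : ℕ) : MeasurableSet (D.boxPi k) :=
  MeasurableSet.univ_pi fun _ => D.measurableSet_box

lemma volume_boxPi (k : ℕ) : volume (D.boxPi k) = 1 := by
  unfold boxPi
  rw [volume_pi_pi]
  simp [D.volume_box]

lemma tsum_boxPi {k : ℕ} (y : Fin k → A) :
    ∑' x : Fin k → O, (D.boxPi k).indicator 1 (D.vec x + y) = (1 : ℝ≥0∞) := by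
  choose x hx hu using fun i => D.box_tile (y i)
  rw [tsum_eq_single x]
  · rw [Set.indicator_of_mem]
    · rfl
    · intro i _
      exact hx i
  · intro x' hx'
    refine Set.indicator_of_notMem (fun h => hx' ?_) _
    funext i
    exact hu i _ (h i trivial)

lemma mat_lowerSL {k : ℕ} (x : Fin k → O) (γ : SpecialLinearGroup (Fin k) O) :
    D.mat (lowerSL x γ) = lowerBlk (D.vec x) (D.mat γ) :=
  lowerBlk_map _ _ _

lemma vec_vecMul_mat {k : ℕ} (v : Fin k → O) (γ : SpecialLinearGroup (Fin k) O) :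
    D.vec v ᵥ* D.mat γ = D.vec (v ᵥ* (γ : Matrix (Fin k) (Fin k) O)) := by
  ext j
  simp [vec, mat, Matrix.vecMul, dotProduct]

lemma mat_completion_mul_zero {k : ℕ} (p : primRows O k) (M : Matrix (Fin (k + 1)) (Fin (k + 1)) A) :
    (D.mat (completion p) * M) 0 = D.vec p.1 ᵥ* M := by
  rw [row_zero_mul]
  congr 1
  rw [← completion_zero p]
  rfl

/-- Unfolding over the full lattice group. -/
lemma lintegral_weight_tsum {n : ℕ} {Ψ : Matrix (Fin (n + 1)) (Fin (n + 1)) A → ℝ≥0∞}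
    (hΨ : Measurable Ψ) :
    ∫⁻ M, D.weight (n + 1) M * ∑' γ, Ψ (D.mat γ * M) = ∫⁻ M, Ψ M := by
  have hw := D.measurable_weight (n + 1)
  have hm1 : ∀ γ : SpecialLinearGroup (Fin (n + 1)) O,
      Measurable fun M => D.weight (n + 1) M * Ψ (D.mat γ * M) :=
    fun γ => hw.mul (hΨ.comp (measurable_mul_left _))
  have hm2 : ∀ γ : SpecialLinearGroup (Fin (n + 1)) O,
      Measurable fun M => D.weight (n + 1) (D.mat γ * M) * Ψ M :=
    fun γ => (hw.comp (measurable_mul_left _)).mul hΨ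
  simp_rw [← ENNReal.tsum_mul_left]
  rw [lintegral_tsum fun γ => (hm1 γ).aemeasurable]
  have h1 : ∀ γ : SpecialLinearGroup (Fin (n + 1)) O,
      ∫⁻ M, D.weight (n + 1) M * Ψ (D.mat γ * M) =
      ∫⁻ M, D.weight (n + 1) (D.mat γ⁻¹ * M) * Ψ M := by
    intro γ
    rw [← (D.measurePreserving_mul_left (D.det_mat γ)).lintegral_comp (hm2 γ⁻¹)]
    simp_rw [← Matrix.mul_assoc, ← mat_mul, inv_mul_cancel, mat_one, Matrix.one_mul]
  simp_rw [h1]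
  rw [← lintegral_tsum fun γ => (hm2 γ⁻¹).aemeasurable]
  refine lintegral_congr_ae ?_
  filter_upwards [D.ae_isUnit_det] with M hM
  have h2 := (Equiv.inv _).tsum_eq fun γ : SpecialLinearGroup (Fin (n + 1)) O =>
    D.weight (n + 1) (D.mat γ * M)
  simp only [Equiv.inv_apply] at h2
  rw [ENNReal.tsum_mul_right, h2, D.tsum_weight hM, one_mul]

lemma measurable_ringInverse : Measurable (Ring.inverse : A → A) := by
  classical
  have h : (Ring.inverse : A → A) = {a : A | IsUnit a}.piecewise Ring.inverse (fun _ => 0) := by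
    funext a
    by_cases ha : IsUnit a
    · exact (Set.piecewise_eq_of_mem {a : A | IsUnit a} _ _ ha).symm
    · rw [Ring.inverse_non_unit _ ha]
      exact (Set.piecewise_eq_of_notMem {a : A | IsUnit a} Ring.inverse (fun _ => 0) ha).symm
  rw [h]
  refine ContinuousOn.measurable_piecewise (fun a ha => ?_) continuousOn_const
    Units.isOpen.measurableSet
  obtain ⟨u, hu⟩ := ha
  rw [← hu]
  exact (NormedRing.inverse_continuousAt u).continuousWithinAt

lemma measurable_hmat {n : ℕ} : Measurable (hmat : (Fin (n + 2) → A) → _) := by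
  refine measurable_pi_lambda _ fun i => measurable_pi_lambda _ fun j => ?_
  refine Fin.cases (measurable_pi_apply j) (fun i => ?_) i
  refine Fin.cases (by simp [hmat]) (fun j => ?_) j
  simp only [hmat, consRow_succ, consCol_succ, diagonal_apply]
  split_ifs with h
  · refine Fin.cases ?_ (fun i => by simp) i
    simp only [Fin.cons_zero]
    exact measurable_ringInverse.comp (measurable_pi_apply _)
  · exact measurable_const

lemma measurable_mul {m k n : ℕ} : Measurable
    (fun p : Matrix (Fin m) (Fin k) A × Matrix (Fin k) (Fin n) A => p.1 * p.2) :=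
  (continuous_fst.matrix_mul continuous_snd).measurable

lemma measurable_mul_adjugate_hmat {n : ℕ} : Measurable
    (fun M : Matrix (Fin (n + 2)) (Fin (n + 2)) A => M * (hmat (M 0)).adjugate) := by
  have h1 : Measurable fun M : Matrix (Fin (n + 2)) (Fin (n + 2)) A => (hmat (M 0)).adjugate :=
    (continuous_id.matrix_adjugate).measurable.comp
      (measurable_hmat.comp (measurable_pi_apply 0))
  exact measurable_mul.comp (measurable_id.prodMk h1)

lemma measurable_tpart {n : ℕ} :
    Measurable (tpart : Matrix (Fin (n + 2)) (Fin (n + 2)) A → _) :=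
  measurable_pi_lambda _ fun i => (measurable_pi_apply 0).comp
    ((measurable_pi_apply i.succ).comp measurable_mul_adjugate_hmat)

lemma measurable_mpart {n : ℕ} :
    Measurable (mpart : Matrix (Fin (n + 2)) (Fin (n + 2)) A → _) :=
  measurable_pi_lambda _ fun i => measurable_pi_lambda _ fun j => (measurable_pi_apply j.succ).comp
    ((measurable_pi_apply i.succ).comp measurable_mul_adjugate_hmat)

/-- The weight for the stabilizer of the first row. -/
noncomputable def stabWeight (n : ℕ) (M : Matrix (Fin (n + 2)) (Fin (n + 2)) A) : ℝ≥0∞ :=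
  (D.boxPi (n + 1)).indicator 1 (tpart M) * D.weight (n + 1) (mpart M)

lemma measurable_stabWeight (n : ℕ) : Measurable (D.stabWeight n) :=
  ((measurable_one.indicator (D.measurableSet_boxPi _)).comp measurable_tpart).mul
    ((D.measurable_weight _).comp measurable_mpart)

lemma stabWeight_lowerBlk_mul_hmat {n : ℕ} {r : Fin (n + 2) → A} (h : IsUnit (r 0))
    (t : Fin (n + 1) → A) (M : Matrix (Fin (n + 1)) (Fin (n + 1)) A) :
    D.stabWeight n (lowerBlk t M * hmat r) =
      (D.boxPi (n + 1)).indicator 1 t * D.weight (n + 1) M := by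
  unfold stabWeight
  obtain ⟨h1, h2⟩ := tpart_mpart_lowerBlk_mul_hmat h t M
  rw [h1, h2]

lemma tsum_stabWeight {n : ℕ} {M : Matrix (Fin (n + 2)) (Fin (n + 2)) A} (h : IsUnit (M 0 0))
    (hd : IsUnit M.det) :
    ∑' (x : Fin (n + 1) → O), ∑' γ, D.stabWeight n (D.mat (lowerSL x γ) * M) = 1 := by
  obtain ⟨t, M', hM⟩ := eq_lowerBlk_mul_hmat h
  have hd' : IsUnit M'.det := by
    rwa [hM, det_mul, det_hmat h, mul_one, det_lowerBlk] at hd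
  have h1 : ∀ (x : Fin (n + 1) → O) γ, D.stabWeight n (D.mat (lowerSL x γ) * M) =
      (D.boxPi (n + 1)).indicator 1 (D.vec x + D.mat γ *ᵥ t) *
        D.weight (n + 1) (D.mat γ * M') := by
    intro x γ
    conv_lhs => rw [hM]
    rw [← Matrix.mul_assoc, mat_lowerSL, lowerBlk_mul, D.stabWeight_lowerBlk_mul_hmat h]
  simp_rw [h1]
  rw [ENNReal.tsum_comm]
  simp_rw [ENNReal.tsum_mul_right, tsum_boxPi, one_mul]
  exact D.tsum_weight hd'

lemma ae_isUnit_mat_mul {n : ℕ} : ∀ᵐ M : Matrix (Fin (n + 2)) (Fin (n + 2)) A,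
    ∀ γ : SpecialLinearGroup (Fin (n + 2)) O, IsUnit ((D.mat γ * M) 0 0) := by
  rw [ae_all_iff]
  intro γ
  refine (D.measurePreserving_mul_left (D.det_mat γ)).quasiMeasurePreserving.ae
    (p := fun M => IsUnit (M 0 0)) ?_
  exact (Measure.quasiMeasurePreserving_eval
      (fun _ : Fin (n + 2) => (volume : Measure (Fin (n + 2) → A))) 0).ae (D.ae_isUnit_apply 0)

/-- Unfolding a sum over primitive rows. -/
lemma lintegral_weight_primRows {n : ℕ} {Φ : Matrix (Fin (n + 2)) (Fin (n + 2)) A → ℝ≥0∞}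
    (hΦ : Measurable Φ)
    (hinv : ∀ (x : Fin (n + 1) → O) γ M, Φ (D.mat (lowerSL x γ) * M) = Φ M) :
    ∫⁻ M, D.weight (n + 2) M * ∑' p : primRows O (n + 1), Φ (D.mat (completion p) * M) =
    ∫⁻ r, ∫⁻ t in D.boxPi (n + 1), ∫⁻ M', D.weight (n + 1) M' * Φ (lowerBlk t M' * hmat r) := by
  have h1 : ∫⁻ M, D.weight (n + 2) M * ∑' p : primRows O (n + 1), Φ (D.mat (completion p) * M) =
      ∫⁻ M, D.weight (n + 2) M * ∑' γ, (Φ (D.mat γ * M) * D.stabWeight n (D.mat γ * M)) := by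
    refine lintegral_congr_ae ?_
    filter_upwards [D.ae_isUnit_mat_mul, D.ae_isUnit_det] with M hM hd
    rw [tsum_specialLinearGroup_succ]
    congr 1
    refine tsum_congr fun p => ?_
    simp_rw [mat_mul, Matrix.mul_assoc, hinv, ENNReal.tsum_mul_left]
    rw [D.tsum_stabWeight (hM _) (by rw [det_mul, det_mat, one_mul]; exact hd), mul_one]
  have hm := hΦ.mul (D.measurable_stabWeight n)
  rw [h1]
  refine (D.lintegral_weight_tsum hm).trans ?_
  rw [D.lintegral_matrix_succ hm]
  refine lintegral_congr_ae ?_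
  filter_upwards [D.ae_isUnit_apply 0] with r hr
  rw [← lintegral_indicator (D.measurableSet_boxPi _)]
  refine lintegral_congr fun t => ?_
  simp only [Pi.mul_apply, D.stabWeight_lowerBlk_mul_hmat hr]
  by_cases ht : t ∈ D.boxPi (n + 1)
  · simp [ht, mul_comm]
  · simp [ht]

/-- The distribution of the determinant with respect to the weight. -/
noncomputable def detMeasure (n : ℕ) : Measure A :=
  ((volume : Measure (Matrix (Fin n) (Fin n) A)).withDensity (D.weight n)).map
    (fun M : Matrix (Fin n) (Fin n) A => M.det)

instance (n : ℕ) : SFinite (D.detMeasure n) := by unfold detMeasure; infer_instance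

lemma lintegral_detMeasure {n : ℕ} {f : A → ℝ≥0∞} (hf : Measurable f) :
    ∫⁻ a, f a ∂(D.detMeasure n) = ∫⁻ M, D.weight n M * f M.det := by
  unfold detMeasure
  rw [lintegral_map hf measurable_det]
  exact lintegral_withDensity_eq_lintegral_mul _ (D.measurable_weight n)
    (hf.comp measurable_det)

lemma det_mat_mul {n : ℕ} (γ : SpecialLinearGroup (Fin n) O) (M : Matrix (Fin n) (Fin n) A) :
    (D.mat γ * M).det = M.det := by rw [det_mul, det_mat, one_mul]

/-- Siegel's mean value formula for primitive vectors. -/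
lemma lintegral_weight_prim {n : ℕ} {f : A → (Fin (n + 2) → A) → ℝ≥0∞}
    (hf : Measurable (Function.uncurry f)) :
    ∫⁻ M, D.weight (n + 2) M * ∑' p : primRows O (n + 1), f M.det (D.vec p.1 ᵥ* M) =
    ∫⁻ a, (∫⁻ r, f a r) ∂(D.detMeasure (n + 1)) := by
  have hΦ : Measurable fun M : Matrix (Fin (n + 2)) (Fin (n + 2)) A => f M.det (M 0) :=
    hf.comp (measurable_det.prodMk (measurable_pi_apply 0))
  have h1 := D.lintegral_weight_primRows hΦ (fun x γ M => by
    simp only [det_mat_mul]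
    rw [mat_lowerSL, lowerBlk_mul_zero])
  simp only [det_mat_mul, mat_completion_mul_zero] at h1
  have h0 : Measurable fun a => ∫⁻ r, f a r := hf.lintegral_prod_right'
  rw [h1, D.lintegral_detMeasure h0]
  have h2 : ∀ᵐ r : Fin (n + 2) → A, ∫⁻ t in D.boxPi (n + 1), ∫⁻ M' : Matrix (Fin (n + 1)) (Fin (n + 1)) A, D.weight (n + 1) M' *
      f (lowerBlk t M' * hmat r).det ((lowerBlk t M' * hmat r) 0) =
      ∫⁻ M', D.weight (n + 1) M' * f M'.det r := by
    filter_upwards [D.ae_isUnit_apply 0] with r hr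
    simp only [lowerBlk_mul_zero, det_mul, det_hmat hr, mul_one, det_lowerBlk, hmat_zero]
    rw [setLIntegral_const, volume_boxPi, mul_one]
  rw [lintegral_congr_ae h2, lintegral_lintegral_swap]
  · refine lintegral_congr fun M => lintegral_const_mul _ (Measurable.comp (f := fun r => (M.det, r)) hf ?_)
    exact measurable_prodMk_left
  · refine Measurable.aemeasurable ?_
    exact ((D.measurable_weight _).comp measurable_snd).mul
      (hf.comp ((measurable_det.comp measurable_snd).prodMk measurable_fst))

end ArithRing

/-- The diagonal matrix with entries `u, 1, …, 1`. -/
def diagCons {R : Type} [CommRing R] {n : ℕ} (u : R) : Matrix (Fin (n + 1)) (Fin (n + 1)) R :=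
  diagonal (Fin.cons u 1)

lemma det_diagCons {R : Type} [CommRing R] {n : ℕ} (u : R) :
    (diagCons u : Matrix (Fin (n + 1)) (Fin (n + 1)) R).det = u := by
  simp [diagCons, det_diagonal, Fin.prod_univ_succ]

lemma diagCons_mul {R : Type} [CommRing R] {n : ℕ} (u v : R) :
    (diagCons u : Matrix (Fin (n + 1)) (Fin (n + 1)) R) * diagCons v = diagCons (u * v) := by
  unfold diagCons
  rw [diagonal_mul_diagonal]
  congr 1
  funext i
  refine Fin.cases ?_ (fun i => ?_) i <;> simp

lemma diagCons_one {R : Type} [CommRing R] {n : ℕ} :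
    (diagCons 1 : Matrix (Fin (n + 1)) (Fin (n + 1)) R) = 1 := by
  unfold diagCons
  rw [← diagonal_one]
  congr 1
  funext i
  refine Fin.cases ?_ (fun i => ?_) i <;> simp

lemma vecMul_diagCons {R : Type} [CommRing R] {n : ℕ} (u a : R) (y : Fin n → R) :
    (Fin.cons a y : Fin (n + 1) → R) ᵥ* diagCons u = Fin.cons (a * u) y := by
  ext i
  unfold diagCons
  rw [vecMul_diagonal]
  refine Fin.cases ?_ (fun i => ?_) i <;> simp

namespace ArithRing

variable {A O : Type} [NormedCommRing A] [ProperSpace A] [MeasureSpace A]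
  [BorelSpace A] [(volume : Measure A).IsAddHaarMeasure] [CommRing O] (D : ArithRing A O)
  [CompleteSpace A] [Countable O]

lemma measurable_vecMul {m n : ℕ} (g : Matrix (Fin m) (Fin n) A) :
    Measurable fun x : Fin m → A => x ᵥ* g :=
  (continuous_id.matrix_vecMul continuous_const).measurable

lemma lintegral_smul_pi {u : A} (hu : IsUnit u) {k : ℕ} {g : (Fin k → A) → ℝ≥0∞}
    (hg : Measurable g) : D.md u ^ k * ∫⁻ r, g (u • r) = ∫⁻ r, g r := by
  induction k with
  | zero =>
    rw [pow_zero, one_mul]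
    exact lintegral_congr fun r => congr_arg g (Subsingleton.elim _ _)
  | succ k ih =>
    have hm : Measurable fun p : A × (Fin k → A) => g (Fin.cons p.1 p.2) :=
      hg.comp measurePreserving_fin_cons.measurable
    have hs : Measurable fun y : Fin k → A => u • y := (continuous_const_smul u).measurable
    have hs' : Measurable fun y : Fin (k + 1) → A => u • y := (continuous_const_smul u).measurable
    have hm2 : Measurable fun p : A × (Fin k → A) => g (Fin.cons p.1 (u • p.2)) :=
      hm.comp (measurable_fst.prodMk (hs.comp measurable_snd))
    rw [lintegral_fin_cons hg, lintegral_fin_cons (F := fun r => g (u • r)) (hg.comp hs')]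
    have h1 : ∀ a, ∫⁻ y : Fin k → A, g (Fin.cons a y) =
        D.md u ^ k * ∫⁻ y : Fin k → A, g (Fin.cons a (u • y)) := fun a =>
      (ih (hm.comp measurable_prodMk_left)).symm
    have h2 : Measurable fun a => ∫⁻ y : Fin k → A, g (Fin.cons a (u • y)) :=
      hm2.lintegral_prod_right'
    simp_rw [h1]
    rw [lintegral_const_mul _ h2, ← D.lintegral_mul u hu _ h2, pow_succ, mul_assoc]
    congr 3
    refine funext fun a => lintegral_congr fun y => congr_arg g ?_
    ext i
    refine Fin.cases ?_ (fun i => ?_) i <;> simp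

lemma lintegral_vecMul_diagCons {u : A} (hu : IsUnit u) {k : ℕ} {g : (Fin (k + 1) → A) → ℝ≥0∞}
    (hg : Measurable g) : D.md u * ∫⁻ x, g (x ᵥ* diagCons u) = ∫⁻ x, g x := by
  have hm : Measurable fun p : A × (Fin k → A) => g (Fin.cons p.1 p.2) :=
    hg.comp measurePreserving_fin_cons.measurable
  have h2 : Measurable fun a => ∫⁻ y : Fin k → A, g (Fin.cons a y) := hm.lintegral_prod_right'
  rw [lintegral_fin_cons hg, lintegral_fin_cons (F := fun x => g (x ᵥ* diagCons u)) (hg.comp (measurable_vecMul _)),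
    ← D.lintegral_mul u hu _ h2]
  congr 2
  funext a
  simp [vecMul_diagCons, mul_comm]

lemma lintegral_vecMul {k : ℕ} {M : Matrix (Fin (k + 1)) (Fin (k + 1)) A} (hM : IsUnit M.det)
    {g : (Fin (k + 1) → A) → ℝ≥0∞} (hg : Measurable g) :
    D.md M.det * ∫⁻ x, g (x ᵥ* M) = ∫⁻ x, g x := by
  have h1 : (M * diagCons (Ring.inverse M.det)).det = 1 := by
    rw [det_mul, det_diagCons, Ring.mul_inverse_cancel _ hM]
  have h2 := (D.measurePreserving_vecMul _ _ h1).lintegral_comp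
    (hg.comp (measurable_vecMul (diagCons M.det)))
  rw [← D.lintegral_vecMul_diagCons hM hg]
  congr 1
  refine Eq.trans ?_ h2
  refine lintegral_congr fun x => ?_
  simp only [Function.comp_apply]
  rw [vecMul_vecMul, Matrix.mul_assoc, diagCons_mul, Ring.inverse_mul_cancel _ hM, diagCons_one,
    Matrix.mul_one]

include D in
lemma ι_injective : Function.Injective D.ι := by
  obtain ⟨ε, hε, h⟩ := D.sep
  rw [injective_iff_map_eq_zero]
  intro a ha
  exact h a (by rw [ha, norm_zero]; exact hε)

include D in
lemma mul_eq_zero_iff {a b : O} : a * b = 0 ↔ a = 0 ∨ b = 0 := by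
  constructor
  · intro h
    by_contra! h2
    have h3 := congr_arg D.ι h
    rw [map_mul, map_zero, (D.isUnit_ι a h2.1).mul_right_eq_zero] at h3
    exact h2.2 (D.ι_injective (h3.trans (map_zero _).symm))
  · rintro (h | h) <;> simp [h]

include D in
lemma one_ne_zero' : (1 : O) ≠ 0 := by
  have := D.natCast_ne_zero 1 D.N_one
  simpa using this

include D in
lemma primRows_ne_zero {n : ℕ} {p : Fin (n + 1) → O} (hp : p ∈ primRows O n) : p ≠ 0 := by
  obtain ⟨γ, rfl⟩ := hp
  intro h
  have := γ.2
  rw [det_eq_zero_of_row_eq_zero 0 (fun j => congr_fun h j)] at this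
  exact D.one_ne_zero' this.symm

include D in
lemma smul_ne_zero' {n : ℕ} {a : O} (ha : a ≠ 0) {v : Fin n → O} (hv : v ≠ 0) : a • v ≠ 0 := by
  intro h
  refine hv (funext fun i => ?_)
  have := congr_fun h i
  exact (D.mul_eq_zero_iff.mp this).resolve_left ha

/-- Nonzero lattice vectors as multiples of primitive ones. -/
noncomputable def contentEquiv (n : ℕ) :
    D.N × primRows O (n + 1) ≃ {v : Fin (n + 2) → O // v ≠ 0} :=
  Equiv.ofBijective (fun q => ⟨((q.1 : ℕ) : O) • (q.2 : Fin (n + 2) → O),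
    D.smul_ne_zero' (D.natCast_ne_zero _ q.1.2) (D.primRows_ne_zero q.2.2)⟩) <| by
  constructor
  · rintro ⟨m, p⟩ ⟨m', p'⟩ h
    have h1 := congr_arg Subtype.val h
    obtain ⟨m₀, -, p₀, -, -, hu⟩ := D.content n _
      (D.smul_ne_zero' (D.natCast_ne_zero _ m.2) (D.primRows_ne_zero p.2))
    have h2 := hu _ m.2 _ p.2 rfl
    have h3 := hu _ m'.2 _ p'.2 h1
    ext1
    · exact Subtype.ext (h2.1.trans h3.1.symm)
    · exact Subtype.ext (h2.2.trans h3.2.symm)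
  · rintro ⟨v, hv⟩
    obtain ⟨m, hm, p, hp, h, -⟩ := D.content n v hv
    exact ⟨⟨⟨m, hm⟩, ⟨p, hp⟩⟩, Subtype.ext h.symm⟩

lemma tsum_ne_zero {n : ℕ} (g : (Fin (n + 2) → O) → ℝ≥0∞) :
    ∑' v : {v : Fin (n + 2) → O // v ≠ 0}, g v =
      ∑' m : D.N, ∑' p : primRows O (n + 1), g (((m : ℕ) : O) • (p : Fin (n + 2) → O)) := by
  rw [← (D.contentEquiv n).tsum_eq, ENNReal.tsum_prod']
  rfl

/-- The zeta value attached to the set of contents. -/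
noncomputable def zeta (d : ℕ) : ℝ≥0∞ := ∑' m : D.N, ((((m : ℕ) : ℝ≥0∞)) ^ d)⁻¹

lemma natCast_inv_mul {m : ℕ} (hm : m ∈ D.N) (d : ℕ) : (((m : ℝ≥0∞)) ^ d)⁻¹ * (m : ℝ≥0∞) ^ d = 1 :=
  ENNReal.inv_mul_cancel (pow_ne_zero _ (Nat.cast_ne_zero.mpr (D.N_pos m hm).ne'))
    (ENNReal.pow_ne_top (ENNReal.natCast_ne_top m))

lemma isUnit_natCast {m : ℕ} (hm : m ∈ D.N) : IsUnit (m : A) := by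
  have := D.isUnit_ι _ (D.natCast_ne_zero m hm)
  rwa [map_natCast] at this

lemma lintegral_natCast_smul {m : ℕ} (hm : m ∈ D.N) {k : ℕ} {g : (Fin k → A) → ℝ≥0∞}
    (hg : Measurable g) : ∫⁻ r, g ((m : A) • r) = ((m : ℝ≥0∞) ^ k)⁻¹ * ∫⁻ r, g r := by
  rw [← D.lintegral_smul_pi (D.isUnit_natCast hm) hg, D.md_natCast m hm, ← mul_assoc,
    D.natCast_inv_mul hm, one_mul]

lemma vec_smul {n : ℕ} (a : O) (v : Fin n → O) : D.vec (a • v) = D.ι a • D.vec v := by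
  funext i; simp [vec]

lemma vec_natCast_smul {n : ℕ} (m : ℕ) (v : Fin n → O) :
    D.vec ((m : O) • v) = (m : A) • D.vec v := by
  rw [vec_smul, map_natCast]

/-- Siegel's mean value formula. -/
lemma lintegral_weight_ne_zero {n : ℕ} {f : A → (Fin (n + 2) → A) → ℝ≥0∞}
    (hf : Measurable (Function.uncurry f)) :
    ∫⁻ M, D.weight (n + 2) M * ∑' v : {v : Fin (n + 2) → O // v ≠ 0}, f M.det (D.vec v.1 ᵥ* M) =
    D.zeta (n + 2) * ∫⁻ a, (∫⁻ r, f a r) ∂(D.detMeasure (n + 1)) := by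
  have hm : ∀ m : ℕ, Measurable (Function.uncurry fun a r => f a ((m : A) • r)) := fun m =>
    Measurable.comp (f := fun p : A × (Fin (n + 2) → A) => (p.1, (m : A) • p.2)) hf
      (measurable_fst.prodMk ((continuous_const_smul (m : A)).measurable.comp measurable_snd))
  have h0 : Measurable fun a => ∫⁻ r, f a r := hf.lintegral_prod_right'
  have hp : ∀ (p : Fin (n + 2) → O), Measurable fun M : Matrix (Fin (n + 2)) (Fin (n + 2)) A =>
      f M.det (D.vec p ᵥ* M) := fun p =>
    Measurable.comp (f := fun M : Matrix (Fin (n + 2)) (Fin (n + 2)) A => (M.det, D.vec p ᵥ* M)) hf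
      (measurable_det.prodMk (continuous_const.matrix_vecMul continuous_id).measurable)
  have h1 : ∀ M : Matrix (Fin (n + 2)) (Fin (n + 2)) A,
      ∑' v : {v : Fin (n + 2) → O // v ≠ 0}, f M.det (D.vec v.1 ᵥ* M) =
      ∑' m : D.N, ∑' p : primRows O (n + 1),
        f M.det (((m : ℕ) : A) • (D.vec (p : Fin (n + 2) → O) ᵥ* M)) := by
    intro M
    rw [D.tsum_ne_zero fun v => f M.det (D.vec v ᵥ* M)]
    simp_rw [vec_natCast_smul, smul_vecMul]
  simp_rw [h1, ← ENNReal.tsum_mul_left]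
  rw [lintegral_tsum, zeta, ← ENNReal.tsum_mul_right]
  · refine tsum_congr fun m => ?_
    simp_rw [ENNReal.tsum_mul_left]
    rw [D.lintegral_weight_prim (hm m), ← lintegral_const_mul _ h0]
    refine lintegral_congr fun a => D.lintegral_natCast_smul m.2 ?_
    exact hf.comp measurable_prodMk_left
  · intro m
    refine (Measurable.tsum fun p => (D.measurable_weight _).mul ?_).aemeasurable
    have := hp (((m : ℕ) : O) • (p : Fin (n + 2) → O))
    simpa only [vec_natCast_smul, smul_vecMul] using this

end ArithRing

namespace ArithRing

variable {A O : Type} [NormedCommRing A] [ProperSpace A] [MeasureSpace A]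
  [BorelSpace A] [(volume : Measure A).IsAddHaarMeasure] [CommRing O] (D : ArithRing A O)
  [CompleteSpace A] [Countable O]

/-- The number of nonzero lattice vectors `v` with `v M ∈ B`. -/
noncomputable def latCount {k n : ℕ} (B : Set (Fin n → A)) (M : Matrix (Fin k) (Fin n) A) : ℝ≥0∞ :=
  ∑' v : {v : Fin k → O // v ≠ 0}, B.indicator 1 (D.vec v.1 ᵥ* M)

/-- The number of lattice vectors `v` with `v M ∈ B`. -/
noncomputable def latCountAll {k n : ℕ} (B : Set (Fin n → A)) (M : Matrix (Fin k) (Fin n) A) :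
    ℝ≥0∞ := ∑' v : Fin k → O, B.indicator 1 (D.vec v ᵥ* M)

lemma vec_zero {k : ℕ} : D.vec (0 : Fin k → O) = 0 := by funext i; simp [vec]

lemma vec_sub {k : ℕ} (v w : Fin k → O) : D.vec (v - w) = D.vec v - D.vec w := by
  funext i; simp [vec]

lemma vec_neg {k : ℕ} (v : Fin k → O) : D.vec (-v) = -D.vec v := by
  funext i; simp [vec]

lemma latCountAll_eq {k n : ℕ} (B : Set (Fin n → A)) (M : Matrix (Fin k) (Fin n) A) :
    D.latCountAll B M = B.indicator 1 0 + D.latCount B M := by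
  classical
  have h1 := ENNReal.tsum_eq_add_tsum_ite (f := fun v : Fin k → O =>
    B.indicator (1 : (Fin n → A) → ℝ≥0∞) (D.vec v ᵥ* M)) 0
  have h := Function.Injective.tsum_eq (f := fun v : Fin k → O =>
      if v = 0 then 0 else B.indicator (1 : (Fin n → A) → ℝ≥0∞) (D.vec v ᵥ* M))
    (Subtype.val_injective (p := fun v : Fin k → O => v ≠ 0)) (fun v hv => by
      refine ⟨⟨v, fun h0 => hv ?_⟩, rfl⟩
      rw [h0]
      exact if_pos rfl)
  have h2 : ∀ v : {v : Fin k → O // v ≠ 0}, (if v.1 = 0 then 0 else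
      B.indicator (1 : (Fin n → A) → ℝ≥0∞) (D.vec v.1 ᵥ* M)) = B.indicator 1 (D.vec v.1 ᵥ* M) :=
    fun v => if_neg v.2
  rw [tsum_congr h2] at h
  rw [latCountAll, h1, vec_zero, zero_vecMul, latCount, h]
  refine congr_arg _ (tsum_congr fun v => ?_)
  by_cases hv : v = 0 <;> simp [hv]

lemma measurable_latCount {k n : ℕ} {B : Set (Fin n → A)} (hB : MeasurableSet B) :
    Measurable (D.latCount (k := k) B) :=
  Measurable.tsum fun _ => (measurable_one.indicator hB).comp
    (continuous_const.matrix_vecMul continuous_id).measurable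

lemma latCountAll_mul_lintegral {k n : ℕ} (B : Set (Fin n → A)) (M : Matrix (Fin k) (Fin n) A)
    {ψ : (Fin n → A) → ℝ≥0∞} (hψ : Measurable ψ) :
    D.latCountAll B M * ∫⁻ x, ψ x =
      ∫⁻ x, ∑' v : Fin k → O, B.indicator 1 (D.vec v ᵥ* M) * ψ (x - D.vec v ᵥ* M) := by
  have hm : ∀ y, Measurable fun x => ψ (x - y) := fun y => hψ.comp (measurable_sub_const y)
  unfold latCountAll
  rw [lintegral_tsum fun v => ((hm _).const_mul _).aemeasurable, ← ENNReal.tsum_mul_right]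
  refine tsum_congr fun v => ?_
  rw [lintegral_const_mul _ (hm _), lintegral_sub_right_eq_self ψ]

lemma latCountAll_mul_le {k n : ℕ} {B B' : Set (Fin n → A)} (hB' : MeasurableSet B')
    {M : Matrix (Fin k) (Fin n) A}
    {ψ : (Fin n → A) → ℝ≥0∞} (hψ : Measurable ψ) {R : ℝ} (hR : ∀ x, ψ x ≠ 0 → ‖x‖ ≤ R)
    (hBB' : ∀ b ∈ B, ∀ y, ‖y‖ ≤ R → b + y ∈ B') {c : ℝ≥0∞}
    (hc : ∀ x, ∑' v : Fin k → O, ψ (x - D.vec v ᵥ* M) ≤ c) :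
    D.latCountAll B M * ∫⁻ x, ψ x ≤ c * volume B' := by
  rw [D.latCountAll_mul_lintegral B M hψ, ← lintegral_indicator_const hB']
  refine lintegral_mono fun x => ?_
  by_cases hx : x ∈ B'
  · rw [Set.indicator_of_mem hx]
    refine le_trans (ENNReal.tsum_le_tsum fun v => ?_) (hc x)
    refine mul_le_of_le_one_left' ?_
    exact Set.indicator_le_self' (fun _ _ => zero_le) _
  · rw [Set.indicator_of_notMem hx, nonpos_iff_eq_zero, ENNReal.tsum_eq_zero]
    intro v
    by_contra h
    rw [mul_eq_zero, not_or] at h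
    refine hx ?_
    have := hBB' _ (Set.mem_of_indicator_ne_zero h.1) _ (hR _ h.2)
    rwa [add_sub_cancel] at this

lemma le_latCountAll_mul {k n : ℕ} {B B' : Set (Fin n → A)} (hB' : MeasurableSet B')
    {M : Matrix (Fin k) (Fin n) A}
    {ψ : (Fin n → A) → ℝ≥0∞} (hψ : Measurable ψ) {R : ℝ} (hR : ∀ x, ψ x ≠ 0 → ‖x‖ ≤ R)
    (hBB' : ∀ b ∈ B', ∀ y, ‖y‖ ≤ R → b + y ∈ B) {c : ℝ≥0∞}
    (hc : ∀ x, c ≤ ∑' v : Fin k → O, ψ (x - D.vec v ᵥ* M)) :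
    c * volume B' ≤ D.latCountAll B M * ∫⁻ x, ψ x := by
  rw [D.latCountAll_mul_lintegral B M hψ, ← lintegral_indicator_const hB']
  refine lintegral_mono fun x => ?_
  by_cases hx : x ∈ B'
  · rw [Set.indicator_of_mem hx]
    refine le_trans (hc x) (ENNReal.tsum_le_tsum fun v => ?_)
    by_cases h : ψ (x - D.vec v ᵥ* M) = 0
    · rw [h]; exact zero_le
    · have := hBB' _ hx (-(x - D.vec v ᵥ* M)) (by rw [norm_neg]; exact hR _ h)
      rw [neg_sub, add_sub_cancel] at this
      simp [this]
  · rw [Set.indicator_of_notMem hx]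
    exact zero_le

/-- The cubes exhausting `A^n`. -/
def cube (n x k : ℕ) : Set (Fin n → A) := Set.univ.pi fun _ => D.C x k

lemma measurableSet_cube (n x k : ℕ) : MeasurableSet (D.cube n x k) :=
  MeasurableSet.univ_pi fun _ => D.measurableSet_C x k

lemma volume_cube (n x k : ℕ) : volume (D.cube n x k) = (x : ℝ≥0∞) ^ n * D.cvol k ^ n := by
  unfold cube
  rw [volume_pi_pi]
  simp [D.volume_C, mul_pow]

lemma cube_add (n R : ℕ) : ∃ k₀, ∀ k ≥ k₀, ∀ x, ∀ a ∈ D.cube n x k, ∀ b, ‖b‖ ≤ (R : ℝ) →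
    a + b ∈ D.cube n (x + R) k := by
  obtain ⟨k₀, hk⟩ := D.C_add R
  exact ⟨k₀, fun k hk' x a ha b hb i _ => hk k hk' x _ (ha i trivial) _ ((norm_le_pi_norm b i).trans hb)⟩

lemma cvol_pow_ne_zero (k n : ℕ) : D.cvol k ^ n ≠ 0 :=
  pow_ne_zero _ (one_pos.trans_le (D.one_le_cvol k)).ne'

lemma cvol_pow_ne_top (k n : ℕ) : D.cvol k ^ n ≠ ∞ := ENNReal.pow_ne_top (D.cvol_ne_top k)

lemma isBounded_boxPi (k : ℕ) : Bornology.IsBounded (D.boxPi k) := by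
  unfold boxPi
  exact Bornology.IsBounded.pi fun _ => D.isBounded_box

/-- Lattice points are equidistributed in large cubes, quantitatively. -/
lemma exists_latCountAll_bounds {k : ℕ} {M : Matrix (Fin (k + 1)) (Fin (k + 1)) A}
    (hM : IsUnit M.det) : ∃ R : ℕ, ∀ᶠ j : ℕ in Filter.atTop,
      D.latCountAll (D.cube (k + 1) j j) M * D.md M.det ≤
        ((j + R : ℕ) : ℝ≥0∞) ^ (k + 1) * D.cvol j ^ (k + 1) ∧
      ((j - R : ℕ) : ℝ≥0∞) ^ (k + 1) * D.cvol j ^ (k + 1) ≤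
        D.latCountAll (D.cube (k + 1) j j) M * D.md M.det := by
  let ψ : (Fin (k + 1) → A) → ℝ≥0∞ := fun x => (D.boxPi (k + 1)).indicator 1 (x ᵥ* M⁻¹)
  have hψ : Measurable ψ :=
    (measurable_one.indicator (D.measurableSet_boxPi _)).comp (measurable_vecMul _)
  have hψi : ∫⁻ x, ψ x = D.md M.det := by
    rw [← D.lintegral_vecMul hM hψ]
    have : ∀ x, ψ (x ᵥ* M) = (D.boxPi (k + 1)).indicator 1 x := fun x => by
      simp only [ψ]
      rw [vecMul_vecMul, mul_nonsing_inv _ hM, vecMul_one]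
    simp_rw [this]
    rw [lintegral_indicator_one (D.measurableSet_boxPi _), volume_boxPi, mul_one]
  have hψs : ∀ x, ∑' v : Fin (k + 1) → O, ψ (x - D.vec v ᵥ* M) = 1 := by
    intro x
    rw [← D.tsum_boxPi (x ᵥ* M⁻¹), ← (Equiv.neg _).tsum_eq]
    refine tsum_congr fun v => ?_
    simp only [ψ, Equiv.neg_apply]
    rw [sub_vecMul, vecMul_vecMul, mul_nonsing_inv _ hM, vecMul_one, vec_neg, sub_neg_eq_add,
      add_comm (x ᵥ* M⁻¹)]
  obtain ⟨R, hR⟩ : ∃ R : ℕ, ∀ x, ψ x ≠ 0 → ‖x‖ ≤ (R : ℝ) := by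
    have h1 : IsCompact ((fun x : Fin (k + 1) → A => x ᵥ* M) '' closure (D.boxPi (k + 1))) :=
      (D.isBounded_boxPi _).isCompact_closure.image
        (continuous_id.matrix_vecMul continuous_const)
    obtain ⟨r, hr⟩ := h1.isBounded.exists_norm_le
    obtain ⟨R, hR⟩ := exists_nat_ge r
    refine ⟨R, fun x hx => (hr x ⟨x ᵥ* M⁻¹, ?_, ?_⟩).trans hR⟩
    · exact subset_closure (Set.mem_of_indicator_ne_zero hx)
    · simp only
      rw [vecMul_vecMul, nonsing_inv_mul _ hM, vecMul_one]
  obtain ⟨k₀, hk₀⟩ := D.cube_add (k + 1) R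
  refine ⟨R, ?_⟩
  filter_upwards [Filter.eventually_ge_atTop k₀, Filter.eventually_ge_atTop R] with j hj hjR
  rw [← volume_cube, ← volume_cube, ← hψi]
  constructor
  · have := D.latCountAll_mul_le (M := M) (D.measurableSet_cube (k + 1) (j + R) j) hψ hR
      (fun b hb y hy => hk₀ j hj j b hb y hy) (fun x => (hψs x).le)
    rwa [one_mul] at this
  · have := D.le_latCountAll_mul (M := M) (B := D.cube (k + 1) j j)
      (D.measurableSet_cube (k + 1) (j - R) j) hψ hR
      (fun b hb y hy => by
        have := hk₀ j hj (j - R) b hb y hy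
        rwa [Nat.sub_add_cancel hjR] at this) (fun x => (hψs x).ge)
    rwa [one_mul] at this

lemma tendsto_latCountAll {k : ℕ} {M : Matrix (Fin (k + 1)) (Fin (k + 1)) A}
    (hM : IsUnit M.det) : Filter.Tendsto (fun j : ℕ => D.latCountAll (D.cube (k + 1) j j) M /
      volume (D.cube (k + 1) j j)) Filter.atTop (nhds (D.md M.det)⁻¹) := by
  obtain ⟨R, hR⟩ := D.exists_latCountAll_bounds hM
  have h0 := D.md_ne_zero _ hM
  have h1 := D.md_ne_top _ hM
  have hz : Filter.Tendsto (fun j : ℕ => (R : ℝ≥0∞) / j) Filter.atTop (nhds 0) := by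
    have := ENNReal.Tendsto.const_div (a := (R : ℝ≥0∞)) ENNReal.tendsto_nat_nhds_top
      (Or.inr (ENNReal.natCast_ne_top R))
    rwa [ENNReal.div_top] at this
  have hj1 : ∀ᶠ j : ℕ in Filter.atTop, (j : ℝ≥0∞) / j = 1 := by
    filter_upwards [Filter.eventually_ge_atTop 1] with j hj
    exact ENNReal.div_self (by exact_mod_cast (by omega : j ≠ 0)) (ENNReal.natCast_ne_top j)
  have hup : Filter.Tendsto (fun j : ℕ => (((j + R : ℕ) : ℝ≥0∞) / j) ^ (k + 1)) Filter.atTop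
      (nhds 1) := by
    have h2 := (ENNReal.continuous_pow (k + 1)).continuousAt.tendsto.comp
      (tendsto_const_nhds (x := (1 : ℝ≥0∞)).add hz)
    rw [add_zero, one_pow] at h2
    refine h2.congr' ?_
    filter_upwards [hj1] with j hj
    simp only [Function.comp_apply]
    rw [Nat.cast_add, ENNReal.add_div, hj]
  have hlo : Filter.Tendsto (fun j : ℕ => (((j - R : ℕ) : ℝ≥0∞) / j) ^ (k + 1)) Filter.atTop
      (nhds 1) := by
    have h2 := (ENNReal.continuous_pow (k + 1)).continuousAt.tendsto.comp
      (ENNReal.Tendsto.sub (tendsto_const_nhds (x := (1 : ℝ≥0∞))) hz (Or.inr zero_ne_top))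
    rw [tsub_zero, one_pow] at h2
    refine h2.congr' ?_
    filter_upwards [hj1, Filter.eventually_ge_atTop 1] with j hj hj'
    simp only [Function.comp_apply]
    rw [ENNReal.natCast_sub, ENNReal.sub_div (fun _ _ => by exact_mod_cast (by omega : j ≠ 0)), hj]
  have hq : Filter.Tendsto (fun j : ℕ => D.latCountAll (D.cube (k + 1) j j) M * D.md M.det /
      volume (D.cube (k + 1) j j)) Filter.atTop (nhds 1) := by
    have hc : ∀ (x j : ℕ), ((x : ℝ≥0∞) ^ (k + 1) * D.cvol j ^ (k + 1)) /
        volume (D.cube (k + 1) j j) = ((x : ℝ≥0∞) / j) ^ (k + 1) := by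
      intro x j
      rw [volume_cube, ENNReal.mul_div_mul_right _ _ (D.cvol_pow_ne_zero _ _)
        (D.cvol_pow_ne_top _ _), div_eq_mul_inv, div_eq_mul_inv, mul_pow,
        ENNReal.inv_pow]
    refine tendsto_of_tendsto_of_tendsto_of_le_of_le' hlo hup ?_ ?_
    · filter_upwards [hR] with j hj
      rw [← hc]
      exact ENNReal.div_le_div_right hj.2 _
    · filter_upwards [hR] with j hj
      rw [← hc]
      exact ENNReal.div_le_div_right hj.1 _
  have h2 := ENNReal.Tendsto.div_const hq (b := D.md M.det) (Or.inr h0)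
  rw [one_div] at h2
  refine h2.congr fun j => ?_
  rw [div_eq_mul_inv, div_eq_mul_inv, div_eq_mul_inv, mul_assoc, mul_assoc,
    mul_comm (volume _)⁻¹, ← mul_assoc (D.md _), ENNReal.mul_inv_cancel h0 h1, one_mul]

lemma tendsto_volume_cube (k : ℕ) : Filter.Tendsto
    (fun j : ℕ => volume (D.cube (k + 1) j j)) Filter.atTop (nhds ∞) := by
  have h : Filter.Tendsto (fun j : ℕ => (j : ℝ≥0∞)) Filter.atTop (nhds ∞) :=
    ENNReal.tendsto_nat_nhds_top
  refine tendsto_of_tendsto_of_tendsto_of_le_of_le' h tendsto_const_nhds ?_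
    (Filter.Eventually.of_forall fun _ => le_top)
  filter_upwards [Filter.eventually_ge_atTop 1] with j hj
  rw [volume_cube]
  refine le_trans ?_ (le_mul_of_one_le_right' (one_le_pow₀ (D.one_le_cvol j)))
  exact le_self_pow₀ (by exact_mod_cast hj) (Nat.succ_ne_zero k)

lemma tendsto_latCount {k : ℕ} {M : Matrix (Fin (k + 1)) (Fin (k + 1)) A}
    (hM : IsUnit M.det) : Filter.Tendsto (fun j : ℕ => D.latCount (D.cube (k + 1) j j) M /
      volume (D.cube (k + 1) j j)) Filter.atTop (nhds (D.md M.det)⁻¹) := by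
  have h1 := D.tendsto_latCountAll hM
  have h2 : Filter.Tendsto (fun j : ℕ => (D.cube (k + 1) j j).indicator (1 : (Fin (k + 1) → A) → ℝ≥0∞) 0 /
      volume (D.cube (k + 1) j j)) Filter.atTop (nhds 0) := by
    have h3 := (tendsto_inv_iff.mpr (D.tendsto_volume_cube k))
    rw [ENNReal.inv_top] at h3
    refine tendsto_of_tendsto_of_tendsto_of_le_of_le tendsto_const_nhds h3 (fun _ => zero_le)
      fun j => ?_
    simp only [div_eq_mul_inv]
    refine mul_le_of_le_one_left' ?_
    exact Set.indicator_le_self' (fun _ _ => zero_le) _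
  have h4 := ENNReal.Tendsto.sub h1 h2 (Or.inr zero_ne_top)
  rw [tsub_zero] at h4
  refine h4.congr' ?_
  filter_upwards [Filter.eventually_ge_atTop 1] with j hj
  rw [latCountAll_eq, ENNReal.add_div]
  refine ENNReal.add_sub_cancel_left ?_
  refine ENNReal.div_ne_top ?_ ?_
  · refine (lt_of_le_of_lt (b := (1 : ℝ≥0∞)) ?_ one_lt_top).ne
    exact Set.indicator_le_self' (fun _ _ => zero_le) _
  · rw [volume_cube]
    refine mul_ne_zero (pow_ne_zero _ ?_) (D.cvol_pow_ne_zero _ _)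
    exact_mod_cast (by omega : j ≠ 0)

end ArithRing

lemma indicator_one_ne_top {α : Type*} (E : Set α) (a : α) :
    E.indicator (1 : α → ℝ≥0∞) a ≠ ∞ := by
  by_cases h : a ∈ E <;> simp [h]

namespace ArithRing

variable {A O : Type} [NormedCommRing A] [ProperSpace A] [MeasureSpace A]
  [BorelSpace A] [(volume : Measure A).IsAddHaarMeasure] [CommRing O] (D : ArithRing A O)
  [CompleteSpace A] [Countable O]

/-- A set of determinants over which averages are taken. -/
structure IsBase (E : Set A) : Prop where
  measurableSet : MeasurableSet E
  isUnit : ∀ a ∈ E, IsUnit a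
  volume_ne_top : volume E ≠ ∞
  md_le : ∃ c : ℝ≥0∞, c ≠ ∞ ∧ ∀ a ∈ E, D.md a ≤ c

lemma zeta_ne_top (n : ℕ) : D.zeta (n + 2) ≠ ∞ := by
  have h1 := (Real.summable_one_div_nat_pow (p := n + 2)).mpr (by omega)
  have h2 := (h1.comp_injective (Subtype.val_injective (p := fun m => m ∈ D.N))).tsum_ofReal_ne_top
  unfold zeta
  convert h2 using 4 with m
  have hm := D.N_pos m m.2
  simp only [Function.comp_apply]
  rw [one_div, ENNReal.ofReal_inv_of_pos (by positivity), ENNReal.ofReal_pow (by positivity),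
    ENNReal.ofReal_natCast]

lemma zeta_ne_zero (n : ℕ) : D.zeta n ≠ 0 := by
  intro h
  have := ENNReal.tsum_eq_zero.mp h ⟨1, D.N_one⟩
  simp at this

lemma weight_le_one {n : ℕ} {M : Matrix (Fin n) (Fin n) A} (hM : IsUnit M.det) :
    D.weight n M ≤ 1 := by
  rw [← D.tsum_weight hM]
  have := ENNReal.le_tsum (f := fun γ => D.weight n (D.mat γ * M)) 1
  simpa only [mat_one, Matrix.one_mul] using this

lemma detMeasure_apply {n : ℕ} {E : Set A} (hE : MeasurableSet E) :
    D.detMeasure n E = ∫⁻ M, D.weight n M * E.indicator 1 M.det := by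
  rw [← lintegral_indicator_one hE, D.lintegral_detMeasure (measurable_one.indicator hE)]

lemma detMeasure_one_le {E : Set A} (hE : MeasurableSet E) : D.detMeasure 1 E ≤ volume E := by
  have h1 := volume_preserving_funUnique (Fin 1) (Fin 1 → A)
  have h2 := volume_preserving_funUnique (Fin 1) A
  have h3 : MeasurePreserving (fun M : Matrix (Fin 1) (Fin 1) A => M.det) := by
    have h4 : (fun M : Matrix (Fin 1) (Fin 1) A => M.det) =
        (MeasurableEquiv.funUnique (Fin 1) A) ∘ (MeasurableEquiv.funUnique (Fin 1) (Fin 1 → A)) := by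
      funext M
      rw [det_fin_one]
      rfl
    rw [h4]
    exact h2.comp h1
  rw [D.detMeasure_apply hE, ← lintegral_indicator_one hE,
    ← h3.lintegral_comp (measurable_one.indicator hE)]
  refine lintegral_mono_ae ?_
  filter_upwards [D.ae_isUnit_det] with M hM
  exact mul_le_of_le_one_left' (D.weight_le_one hM)

lemma lintegral_weight_latCount {n : ℕ} {E : Set A} (hE : MeasurableSet E)
    {B : Set (Fin (n + 2) → A)} (hB : MeasurableSet B) :
    ∫⁻ M, D.weight (n + 2) M * (E.indicator 1 M.det * D.latCount B M) =
      D.zeta (n + 2) * (D.detMeasure (n + 1) E * volume B) := by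
  have h := D.lintegral_weight_ne_zero
    (f := fun a (r : Fin (n + 2) → A) => E.indicator 1 a * B.indicator 1 r)
    (((measurable_one.indicator hE).comp measurable_fst).mul
      ((measurable_one.indicator hB).comp measurable_snd))
  simp only [ENNReal.tsum_mul_left] at h
  refine Eq.trans h ?_
  congr 1
  simp_rw [lintegral_const_mul _ (measurable_one.indicator hB), lintegral_indicator_one hB]
  rw [lintegral_mul_const _ (measurable_one.indicator hE), lintegral_indicator_one hE]

lemma measurable_weight_indicator {n : ℕ} {E : Set A} (hE : MeasurableSet E)
    {F : Matrix (Fin n) (Fin n) A → ℝ≥0∞} (hF : Measurable F) :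
    Measurable fun M : Matrix (Fin n) (Fin n) A => D.weight n M * (E.indicator 1 M.det * F M) :=
  (D.measurable_weight n).mul (((measurable_one.indicator hE).comp measurable_det).mul hF)

lemma lintegral_weight_latCount_div {n : ℕ} {E : Set A} (hE : MeasurableSet E) {j : ℕ}
    (hj : j ≠ 0) :
    ∫⁻ M, D.weight (n + 2) M * (E.indicator 1 M.det * (D.latCount (D.cube (n + 2) j j) M /
      volume (D.cube (n + 2) j j))) = D.zeta (n + 2) * D.detMeasure (n + 1) E := by
  have hB := D.measurableSet_cube (n + 2) j j
  have h1 := D.lintegral_weight_latCount hE hB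
  simp_rw [div_eq_mul_inv, ← mul_assoc] at h1 ⊢
  rw [lintegral_mul_const, h1, mul_assoc, ENNReal.mul_inv_cancel, mul_one]
  · rw [volume_cube]
    exact mul_ne_zero (pow_ne_zero _ (by exact_mod_cast hj)) (D.cvol_pow_ne_zero _ _)
  · rw [volume_cube]
    exact ENNReal.mul_ne_top (ENNReal.pow_ne_top (ENNReal.natCast_ne_top j))
      (D.cvol_pow_ne_top _ _)
  · have := D.measurable_weight_indicator hE (D.measurable_latCount (k := n + 2) hB)
    simpa only [mul_assoc] using this

lemma setLIntegral_inv_md {n : ℕ} {E : Set A} (hE : MeasurableSet E) :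
    ∫⁻ a in E, (D.md a)⁻¹ ∂(D.detMeasure n) =
      ∫⁻ M, D.weight n M * (E.indicator 1 M.det * (D.md M.det)⁻¹) := by
  have hm : Measurable fun a => E.indicator 1 a * (D.md a)⁻¹ :=
    (measurable_one.indicator hE).mul D.measurable_md.inv
  rw [← lintegral_indicator hE]
  refine Eq.trans (lintegral_congr fun a => ?_) (D.lintegral_detMeasure hm)
  by_cases ha : a ∈ E <;> simp [ha]

lemma setLIntegral_inv_md_le {n : ℕ} {E : Set A} (hE : MeasurableSet E) :
    ∫⁻ a in E, (D.md a)⁻¹ ∂(D.detMeasure (n + 2)) ≤ D.zeta (n + 2) * D.detMeasure (n + 1) E := by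
  rw [D.setLIntegral_inv_md hE]
  have h1 : ∀ᵐ M : Matrix (Fin (n + 2)) (Fin (n + 2)) A,
      D.weight (n + 2) M * (E.indicator 1 M.det * (D.md M.det)⁻¹) =
      Filter.liminf (fun j : ℕ => D.weight (n + 2) M * (E.indicator 1 M.det *
        (D.latCount (D.cube (n + 2) j j) M / volume (D.cube (n + 2) j j)))) Filter.atTop := by
    filter_upwards [D.ae_isUnit_det] with M hM
    refine (Filter.Tendsto.liminf_eq ?_).symm
    refine ENNReal.Tendsto.const_mul (ENNReal.Tendsto.const_mul (D.tendsto_latCount hM) ?_) ?_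
    · exact Or.inr (indicator_one_ne_top _ _)
    · exact Or.inr ((D.weight_le_one hM).trans_lt one_lt_top).ne
  rw [lintegral_congr_ae h1]
  refine (lintegral_liminf_le fun j => D.measurable_weight_indicator hE
    ((D.measurable_latCount (D.measurableSet_cube _ _ _)).div_const _)).trans ?_
  refine (Filter.liminf_congr ?_).le.trans (Filter.Tendsto.liminf_eq tendsto_const_nhds).le
  filter_upwards [Filter.eventually_ge_atTop 1] with j hj
  exact D.lintegral_weight_latCount_div hE (by omega)

lemma detMeasure_ne_top {n : ℕ} {E : Set A} (hE : D.IsBase E) : D.detMeasure (n + 1) E ≠ ∞ := by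
  induction n with
  | zero => exact ((D.detMeasure_one_le hE.measurableSet).trans_lt hE.volume_ne_top.lt_top).ne
  | succ n ih =>
    obtain ⟨c, hc, hcE⟩ := hE.md_le
    have h1 := D.setLIntegral_inv_md_le (n := n) hE.measurableSet
    have h2 : c⁻¹ * D.detMeasure (n + 2) E ≤ ∫⁻ a in E, (D.md a)⁻¹ ∂(D.detMeasure (n + 2)) := by
      rw [← setLIntegral_const]
      exact setLIntegral_mono D.measurable_md.inv fun a ha => ENNReal.inv_le_inv.mpr (hcE a ha)
    intro h
    have h3 := h2.trans h1
    have h4 : c⁻¹ ≠ 0 := ENNReal.inv_ne_zero.mpr hc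
    rw [h, ENNReal.mul_top h4, top_le_iff] at h3
    exact ENNReal.mul_ne_top (D.zeta_ne_top n) ih h3

/-- A packing bound for the number of lattice points in a large cube. -/
lemma exists_latCount_cube_le (k n : ℕ) : ∃ K : ℝ≥0∞, K ≠ ∞ ∧ ∀ᶠ j : ℕ in Filter.atTop,
    ∀ M : Matrix (Fin k) (Fin n) A, D.latCount (D.cube n j j) M / volume (D.cube n j j) ≤
      K * (1 + D.latCount (Metric.closedBall 0 2) M) := by
  let Q : Set (Fin n → A) := Metric.closedBall 0 1
  have hQ : MeasurableSet Q := Metric.isClosed_closedBall.measurableSet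
  have hQ0 : volume Q ≠ 0 :=
    (Metric.measure_closedBall_pos volume (0 : Fin n → A) one_pos).ne'
  have hQt : volume Q ≠ ∞ := measure_closedBall_lt_top.ne
  refine ⟨2 ^ n * (volume Q)⁻¹, ENNReal.mul_ne_top (by simp) (ENNReal.inv_ne_top.mpr hQ0), ?_⟩
  obtain ⟨k₀, hk₀⟩ := D.cube_add n 1
  filter_upwards [Filter.eventually_ge_atTop k₀, Filter.eventually_ge_atTop 1] with j hj hj1 M
  have hc : ∀ x, ∑' v : Fin k → O, Q.indicator (1 : (Fin n → A) → ℝ≥0∞) (x - D.vec v ᵥ* M) ≤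
      1 + D.latCount (Metric.closedBall 0 2) M := by
    intro x
    have hle : 1 + D.latCount (Metric.closedBall 0 2) M =
        D.latCountAll (Metric.closedBall 0 2) M := by
      rw [latCountAll_eq, Set.indicator_of_mem]
      · rfl
      · simp
    rw [hle]
    by_cases hx : ∃ v₀ : Fin k → O, x - D.vec v₀ ᵥ* M ∈ Q
    · obtain ⟨v₀, hv₀⟩ := hx
      unfold latCountAll
      rw [← (Equiv.subRight v₀).tsum_eq fun v =>
        (Metric.closedBall 0 2).indicator (1 : (Fin n → A) → ℝ≥0∞) (D.vec v ᵥ* M)]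
      refine ENNReal.tsum_le_tsum fun v => ?_
      by_cases hv : x - D.vec v ᵥ* M ∈ Q
      · refine le_of_eq_of_le (Set.indicator_of_mem hv _) (le_of_eq ?_)
        refine Eq.symm (Set.indicator_of_mem (f := (1 : (Fin n → A) → ℝ≥0∞)) ?_)
        simp only [Q, mem_closedBall_zero_iff, Equiv.subRight_apply, vec_sub] at hv hv₀ ⊢
        rw [sub_vecMul, show D.vec v ᵥ* M - D.vec v₀ ᵥ* M =
          (x - D.vec v₀ ᵥ* M) - (x - D.vec v ᵥ* M) by abel]
        exact (norm_sub_le _ _).trans (by linarith)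
      · rw [Set.indicator_of_notMem hv]
        exact zero_le
    · push Not at hx
      simp [Set.indicator_of_notMem (hx _)]
  have h1 := D.latCountAll_mul_le (M := M) (B := D.cube n j j) (D.measurableSet_cube n (j + 1) j)
    (measurable_one.indicator hQ) (R := 1) (fun x hx => by
      have := Set.mem_of_indicator_ne_zero hx
      simpa [Q] using this) (fun b hb y hy => hk₀ j hj j b hb y (by simpa using hy)) hc
  rw [lintegral_indicator_one hQ] at h1
  have h2 : volume (D.cube n (j + 1) j) ≤ 2 ^ n * volume (D.cube n j j) := by
    rw [volume_cube, volume_cube, ← mul_pow, ← mul_pow, ← mul_pow, ← mul_assoc]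
    refine pow_le_pow_left' (mul_le_mul_left ?_ _) n
    exact_mod_cast (by omega : j + 1 ≤ 2 * j)
  have h3 : D.latCount (D.cube n j j) M ≤ D.latCountAll (D.cube n j j) M := by
    rw [latCountAll_eq]; exact le_add_self
  have hv0 : volume (D.cube n j j) ≠ 0 := by
    rw [volume_cube]
    exact mul_ne_zero (pow_ne_zero _ (by exact_mod_cast (by omega : j ≠ 0)))
      (D.cvol_pow_ne_zero _ _)
  have hvt : volume (D.cube n j j) ≠ ∞ := by
    rw [volume_cube]
    exact ENNReal.mul_ne_top (ENNReal.pow_ne_top (ENNReal.natCast_ne_top j))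
      (D.cvol_pow_ne_top _ _)
  rw [ENNReal.div_le_iff hv0 hvt]
  refine h3.trans ?_
  rw [← ENNReal.mul_le_mul_iff_left hQ0 hQt]
  refine h1.trans ((mul_le_mul_right h2 _).trans (le_of_eq ?_))
  calc _ = (2 ^ n * (1 + D.latCount (Metric.closedBall 0 2) M) * volume (D.cube n j j)) * 1 := by ring
    _ = (2 ^ n * (1 + D.latCount (Metric.closedBall 0 2) M) * volume (D.cube n j j)) *
        ((volume Q)⁻¹ * volume Q) := by rw [ENNReal.inv_mul_cancel hQ0 hQt]
    _ = _ := by ring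

lemma setLIntegral_inv_md_eq {n : ℕ} {E : Set A} (hE : D.IsBase E) :
    ∫⁻ a in E, (D.md a)⁻¹ ∂(D.detMeasure (n + 2)) = D.zeta (n + 2) * D.detMeasure (n + 1) E := by
  rw [D.setLIntegral_inv_md hE.measurableSet]
  obtain ⟨K, hK, hj⟩ := D.exists_latCount_cube_le (n + 2) (n + 2)
  obtain ⟨j₀, hj₀⟩ := Filter.eventually_atTop.mp hj
  have hball : MeasurableSet (Metric.closedBall (0 : Fin (n + 2) → A) 2) :=
    Metric.isClosed_closedBall.measurableSet
  have h1 := tendsto_lintegral_of_dominated_convergence (μ := (volume : Measure (Matrix (Fin (n + 2)) (Fin (n + 2)) A)))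
    (F := fun j : ℕ => fun M => D.weight (n + 2) M * (E.indicator 1 M.det *
        (D.latCount (D.cube (n + 2) (j + j₀) (j + j₀)) M / volume (D.cube (n + 2) (j + j₀) (j + j₀)))))
    (f := fun M => D.weight (n + 2) M * (E.indicator 1 M.det * (D.md M.det)⁻¹))
    (fun M => D.weight (n + 2) M * (E.indicator 1 M.det *
      (K * (1 + D.latCount (Metric.closedBall 0 2) M))))
    (fun j => D.measurable_weight_indicator hE.measurableSet
      ((D.measurable_latCount (D.measurableSet_cube _ _ _)).div_const _))
    (fun j => Filter.Eventually.of_forall fun M => by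
      dsimp only
      gcongr
      exact hj₀ _ (by omega) M) ?_ ?_
  · have h2 : Filter.Tendsto (fun _ : ℕ => D.zeta (n + 2) * D.detMeasure (n + 1) E) Filter.atTop
        (nhds (D.zeta (n + 2) * D.detMeasure (n + 1) E)) := tendsto_const_nhds
    refine tendsto_nhds_unique (h1.congr' ?_) h2
    filter_upwards [Filter.eventually_ge_atTop 1] with j hj
    exact D.lintegral_weight_latCount_div hE.measurableSet (by omega)
  · have h3 : ∀ M : Matrix (Fin (n + 2)) (Fin (n + 2)) A, D.weight (n + 2) M *
        (E.indicator 1 M.det * (K * (1 + D.latCount (Metric.closedBall 0 2) M))) =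
        K * (D.weight (n + 2) M * E.indicator 1 M.det + D.weight (n + 2) M *
          (E.indicator 1 M.det * D.latCount (Metric.closedBall 0 2) M)) := fun M => by ring
    have hm1 : Measurable fun M : Matrix (Fin (n + 2)) (Fin (n + 2)) A =>
        D.weight (n + 2) M * E.indicator 1 M.det :=
      (D.measurable_weight _).mul ((measurable_one.indicator hE.measurableSet).comp measurable_det)
    have hm2 : Measurable fun M : Matrix (Fin (n + 2)) (Fin (n + 2)) A =>
        D.weight (n + 2) M * E.indicator 1 M.det + D.weight (n + 2) M *
          (E.indicator 1 M.det * D.latCount (Metric.closedBall 0 2) M) :=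
      hm1.add (D.measurable_weight_indicator hE.measurableSet (D.measurable_latCount hball))
    simp_rw [h3]
    rw [lintegral_const_mul _ hm2, lintegral_add_left hm1, ← D.detMeasure_apply hE.measurableSet,
      D.lintegral_weight_latCount hE.measurableSet hball]
    refine ENNReal.mul_ne_top hK (ENNReal.add_ne_top.mpr ⟨D.detMeasure_ne_top hE, ?_⟩)
    exact ENNReal.mul_ne_top (D.zeta_ne_top n) (ENNReal.mul_ne_top (D.detMeasure_ne_top hE)
      measure_closedBall_lt_top.ne)
  · filter_upwards [D.ae_isUnit_det] with M hM
    refine ENNReal.Tendsto.const_mul (ENNReal.Tendsto.const_mul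
      ((D.tendsto_latCount hM).comp (Filter.tendsto_add_atTop_nat j₀)) ?_) ?_
    · exact Or.inr (indicator_one_ne_top _ _)
    · exact Or.inr ((D.weight_le_one hM).trans_lt one_lt_top).ne

/-- Siegel's recursion for the distribution of the determinant. -/
lemma setLIntegral_md {n : ℕ} {E : Set A} (hE : D.IsBase E) {h : A → ℝ≥0∞} (hh : Measurable h) :
    D.zeta (n + 2) * ∫⁻ a in E, D.md a * h a ∂(D.detMeasure (n + 1)) =
      ∫⁻ a in E, h a ∂(D.detMeasure (n + 2)) := by
  have h1 : D.zeta (n + 2) • (D.detMeasure (n + 1)).restrict E =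
      ((D.detMeasure (n + 2)).restrict E).withDensity fun a => (D.md a)⁻¹ := by
    ext F hF
    rw [withDensity_apply _ hF, Measure.restrict_restrict hF, Measure.smul_apply,
      Measure.restrict_apply hF, smul_eq_mul]
    refine (D.setLIntegral_inv_md_eq ⟨hF.inter hE.measurableSet, fun a ha => hE.isUnit a ha.2, ?_,
      ?_⟩).symm
    · exact measure_ne_top_of_subset Set.inter_subset_right hE.volume_ne_top
    · obtain ⟨c, hc, h⟩ := hE.md_le
      exact ⟨c, hc, fun a ha => h a ha.2⟩
  have hm : Measurable fun a => D.md a * h a := D.measurable_md.mul hh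
  rw [← smul_eq_mul, ← lintegral_smul_measure, h1,
    show (fun a => (D.md a)⁻¹) = (D.md)⁻¹ from rfl,
    lintegral_withDensity_eq_lintegral_mul _ D.measurable_md.inv hm]
  refine setLIntegral_congr_fun hE.measurableSet fun a ha => ?_
  have hu := hE.isUnit a ha
  simp only [Pi.mul_apply, Pi.inv_apply]
  rw [← mul_assoc, ENNReal.inv_mul_cancel (D.md_ne_zero a hu) (D.md_ne_top a hu), one_mul]

end ArithRing

namespace ArithRing

variable {A O : Type} [NormedCommRing A] [ProperSpace A] [MeasureSpace A]
  [BorelSpace A] [(volume : Measure A).IsAddHaarMeasure] [CommRing O] (D : ArithRing A O)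
  [CompleteSpace A] [Countable O]

lemma vec_dotProduct {n : ℕ} (v w : Fin n → O) : D.vec v ⬝ᵥ D.vec w = D.ι (v ⬝ᵥ w) := by
  simp [vec, dotProduct]

lemma vec_cons {n : ℕ} (a : O) (v : Fin n → O) :
    D.vec (Fin.cons a v : Fin (n + 1) → O) = Fin.cons (D.ι a) (D.vec v) := by
  funext i
  refine Fin.cases ?_ (fun i => ?_) i <;> simp [vec]

lemma tsum_box (a : A) : ∑' o, D.box.indicator 1 (D.ι o + a) = (1 : ℝ≥0∞) := by
  obtain ⟨o, ho, hu⟩ := D.box_tile a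
  rw [tsum_eq_single o]
  · exact Set.indicator_of_mem (f := (1 : A → ℝ≥0∞)) ho
  · intro o' ho'
    exact Set.indicator_of_notMem (fun h => ho' (hu o' h)) _

/-- Integrals of periodic functions over the fundamental box are shift invariant. -/
lemma lintegral_boxPi_add {k : ℕ} {H : (Fin k → A) → ℝ≥0∞} (hH : Measurable H)
    (hper : ∀ x t, H (D.vec x + t) = H t) (u : Fin k → A) :
    ∫⁻ t, (D.boxPi k).indicator 1 t * H (t + u) = ∫⁻ t, (D.boxPi k).indicator 1 t * H t := by
  have hb : Measurable ((D.boxPi k).indicator (1 : (Fin k → A) → ℝ≥0∞)) :=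
    measurable_one.indicator (D.measurableSet_boxPi k)
  have hm : ∀ x : Fin k → O, Measurable fun t => (D.boxPi k).indicator (1 : (Fin k → A) → ℝ≥0∞)
      (D.vec x + t) * ((D.boxPi k).indicator 1 (t - u) * H t) := fun x =>
    (hb.comp (measurable_const_add _)).mul ((hb.comp (measurable_sub_const u)).mul hH)
  calc ∫⁻ t, (D.boxPi k).indicator 1 t * H (t + u)
      = ∫⁻ t, (D.boxPi k).indicator 1 (t - u) * H t := by
        rw [← lintegral_add_right_eq_self
          (fun t => (D.boxPi k).indicator (1 : (Fin k → A) → ℝ≥0∞) (t - u) * H t) u]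
        simp only [add_sub_cancel_right]
    _ = ∫⁻ t, ∑' x : Fin k → O, (D.boxPi k).indicator 1 (D.vec x + t) *
          ((D.boxPi k).indicator 1 (t - u) * H t) := by
        refine lintegral_congr fun t => ?_
        rw [ENNReal.tsum_mul_right, tsum_boxPi, one_mul]
    _ = ∑' x : Fin k → O, ∫⁻ t, (D.boxPi k).indicator 1 (D.vec x + t) *
          ((D.boxPi k).indicator 1 (t - u) * H t) := lintegral_tsum fun x => (hm x).aemeasurable
    _ = ∑' x : Fin k → O, ∫⁻ t, (D.boxPi k).indicator 1 t *
          ((D.boxPi k).indicator 1 (D.vec (-x) + (t - u)) * H t) := by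
        refine tsum_congr fun x => ?_
        rw [← lintegral_add_left_eq_self _ (D.vec (-x))]
        refine lintegral_congr fun t => ?_
        rw [hper, vec_neg, add_neg_cancel_left, add_sub_assoc]
    _ = ∫⁻ t, ∑' x : Fin k → O, (D.boxPi k).indicator 1 t *
          ((D.boxPi k).indicator 1 (D.vec (-x) + (t - u)) * H t) := by
        refine (lintegral_tsum fun x => Measurable.aemeasurable ?_).symm
        exact hb.mul ((hb.comp ((measurable_const_add _).comp (measurable_sub_const u))).mul hH)
    _ = _ := by
        refine lintegral_congr fun t => ?_
        have h := (Equiv.neg (Fin k → O)).tsum_eq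
          fun x => (D.boxPi k).indicator (1 : (Fin k → A) → ℝ≥0∞) (D.vec x + (t - u))
        simp only [Equiv.neg_apply, tsum_boxPi] at h
        rw [ENNReal.tsum_mul_left, ENNReal.tsum_mul_right, h, one_mul]

lemma lintegral_box_tsum {F : A → ℝ≥0∞} (hF : Measurable F) (y : A) :
    ∫⁻ s, D.box.indicator 1 s * ∑' o, F (D.ι o + (y + s)) = ∫⁻ s, F s := by
  have hb : Measurable (D.box.indicator (1 : A → ℝ≥0∞)) :=
    measurable_one.indicator D.measurableSet_box
  simp_rw [← ENNReal.tsum_mul_left]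
  have hm : ∀ o, Measurable fun s => D.box.indicator (1 : A → ℝ≥0∞) s * F (D.ι o + (y + s)) :=
    fun o => hb.mul (hF.comp ((measurable_const_add _).comp (measurable_const_add y)))
  have hm' : ∀ o, Measurable fun s => D.box.indicator (1 : A → ℝ≥0∞) (D.ι (-o) + (s - y)) * F s :=
    fun o => (hb.comp ((measurable_const_add _).comp (measurable_sub_const y))).mul hF
  rw [lintegral_tsum fun o => (hm o).aemeasurable]
  have h1 : ∀ o, ∫⁻ s, D.box.indicator 1 s * F (D.ι o + (y + s)) =
      ∫⁻ s, D.box.indicator 1 (D.ι (-o) + (s - y)) * F s := by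
    intro o
    rw [← lintegral_add_left_eq_self
      (fun s => D.box.indicator (1 : A → ℝ≥0∞) (D.ι (-o) + (s - y)) * F s) (D.ι o + y)]
    refine lintegral_congr fun s => ?_
    rw [map_neg, add_assoc]
    congr 2
    abel
  simp_rw [h1]
  rw [← lintegral_tsum fun o => (hm' o).aemeasurable]
  refine lintegral_congr fun s => ?_
  have h := (Equiv.neg O).tsum_eq
    fun o => D.box.indicator (1 : A → ℝ≥0∞) (D.ι o + (s - y))
  simp only [Equiv.neg_apply, tsum_box] at h
  rw [ENNReal.tsum_mul_right, h, one_mul]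

/-- Equidistribution of `w ⬝ᵥ t` modulo the lattice. -/
lemma lintegral_boxPi_dotProduct {k : ℕ} {w : Fin k → O} (hw : w ≠ 0) {F : A → ℝ≥0∞}
    (hF : Measurable F) :
    ∫⁻ t in D.boxPi k, ∑' o, F (D.ι o + D.vec w ⬝ᵥ t) = ∫⁻ s, F s := by
  obtain ⟨j, hj⟩ := Function.ne_iff.mp hw
  have hju := D.isUnit_ι _ hj
  have hb : Measurable ((D.boxPi k).indicator (1 : (Fin k → A) → ℝ≥0∞)) :=
    measurable_one.indicator (D.measurableSet_boxPi k)
  have hb1 : Measurable (D.box.indicator (1 : A → ℝ≥0∞)) :=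
    measurable_one.indicator D.measurableSet_box
  have hdot : Measurable fun t : Fin k → A => D.vec w ⬝ᵥ t :=
    (continuous_const.dotProduct continuous_id).measurable
  have hG : Measurable fun y => ∑' o, F (D.ι o + y) :=
    Measurable.tsum fun o => hF.comp (measurable_const_add _)
  have hper : ∀ o y, ∑' o', F (D.ι o' + (D.ι o + y)) = ∑' o', F (D.ι o' + y) := by
    intro o y
    rw [← (Equiv.addRight o).tsum_eq fun o' => F (D.ι o' + y)]
    simp [add_assoc]
  have h1 : ∀ s, ∫⁻ t, (D.boxPi k).indicator 1 t * ∑' o, F (D.ι o + (D.vec w ⬝ᵥ t + s)) =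
      ∫⁻ t, (D.boxPi k).indicator 1 t * ∑' o, F (D.ι o + D.vec w ⬝ᵥ t) := by
    intro s
    have h2 := D.lintegral_boxPi_add (H := fun t => ∑' o, F (D.ι o + D.vec w ⬝ᵥ t))
      (hG.comp hdot) (fun x t => by
        rw [dotProduct_add, vec_dotProduct, hper]) (Pi.single j (Ring.inverse (D.ι (w j)) * s))
    rw [← h2]
    refine lintegral_congr fun t => ?_
    rw [dotProduct_add, dotProduct_single]
    rw [show D.vec w j = D.ι (w j) from rfl, ← mul_assoc, Ring.mul_inverse_cancel _ hju, one_mul]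
  rw [← lintegral_indicator (D.measurableSet_boxPi k)]
  have h3 : ∫⁻ t, (D.boxPi k).indicator (fun t => ∑' o, F (D.ι o + D.vec w ⬝ᵥ t)) t =
      ∫⁻ t, (D.boxPi k).indicator 1 t * ∑' o, F (D.ι o + D.vec w ⬝ᵥ t) := by
    refine lintegral_congr fun t => ?_
    by_cases ht : t ∈ D.boxPi k <;> simp [ht]
  rw [h3]
  have h4 : ∫⁻ s : A, D.box.indicator 1 s * ∫⁻ t, (D.boxPi k).indicator 1 t *
      ∑' o, F (D.ι o + (D.vec w ⬝ᵥ t + s)) = ∫⁻ t, (D.boxPi k).indicator 1 t *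
      ∑' o, F (D.ι o + D.vec w ⬝ᵥ t) := by
    simp_rw [h1]
    rw [lintegral_mul_const _ hb1, lintegral_indicator_one D.measurableSet_box, D.volume_box,
      one_mul]
  rw [← h4]
  have hm : Measurable fun p : A × (Fin k → A) => D.box.indicator (1 : A → ℝ≥0∞) p.1 *
      ((D.boxPi k).indicator (1 : (Fin k → A) → ℝ≥0∞) p.2 *
        ∑' o, F (D.ι o + (D.vec w ⬝ᵥ p.2 + p.1))) :=
    (hb1.comp measurable_fst).mul ((hb.comp measurable_snd).mul
      (hG.comp ((hdot.comp measurable_snd).add measurable_fst)))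
  have hm1 : ∀ s, Measurable fun t : Fin k → A => (D.boxPi k).indicator (1 : (Fin k → A) → ℝ≥0∞) t *
        ∑' o, F (D.ι o + (D.vec w ⬝ᵥ t + s)) := fun s =>
    hb.mul (hG.comp (hdot.add_const s))
  simp_rw [← lintegral_const_mul _ (hm1 _)]
  rw [lintegral_lintegral_swap hm.aemeasurable]
  have h5 : ∀ t : Fin k → A, ∫⁻ s : A, D.box.indicator 1 s * ((D.boxPi k).indicator 1 t *
      ∑' o, F (D.ι o + (D.vec w ⬝ᵥ t + s))) = (D.boxPi k).indicator 1 t * ∫⁻ s, F s := by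
    intro t
    rw [← D.lintegral_box_tsum hF (D.vec w ⬝ᵥ t), ← lintegral_const_mul]
    · exact lintegral_congr fun s => by ring
    · exact hb1.mul (hG.comp (measurable_const_add _))
  simp_rw [h5]
  rw [lintegral_mul_const _ hb, lintegral_indicator_one (D.measurableSet_boxPi k), volume_boxPi,
    one_mul]

end ArithRing

namespace ArithRing

variable {A O : Type} [NormedCommRing A] [ProperSpace A] [MeasureSpace A]
  [BorelSpace A] [(volume : Measure A).IsAddHaarMeasure] [CommRing O] (D : ArithRing A O)
  [CompleteSpace A] [Countable O]

lemma vecMul_vecMul_cancel {n : ℕ} {γ γ' : SpecialLinearGroup (Fin n) O} (h : γ * γ' = 1)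
    (v : Fin n → O) : (v ᵥ* γ.1) ᵥ* γ'.1 = v := by
  have h1 : γ.1 * γ'.1 = 1 := congr_arg Subtype.val h
  rw [vecMul_vecMul, h1, vecMul_one]

/-- The action of `SL_n(O)` on nonzero row vectors. -/
def vecMulEquiv {n : ℕ} (γ : SpecialLinearGroup (Fin n) O) :
    {v : Fin n → O // v ≠ 0} ≃ {v : Fin n → O // v ≠ 0} where
  toFun v := ⟨v.1 ᵥ* γ.1, fun h => v.2 (by
    rw [← vecMul_vecMul_cancel (mul_inv_cancel γ) v.1, h, zero_vecMul])⟩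
  invFun v := ⟨v.1 ᵥ* (γ⁻¹).1, fun h => v.2 (by
    rw [← vecMul_vecMul_cancel (inv_mul_cancel γ) v.1, h, zero_vecMul])⟩
  left_inv v := Subtype.ext (vecMul_vecMul_cancel (mul_inv_cancel γ) v.1)
  right_inv v := Subtype.ext (vecMul_vecMul_cancel (inv_mul_cancel γ) v.1)

/-- The sum over lattice vectors not proportional to the first basis vector. -/
noncomputable def tailSum {n : ℕ} (g : (Fin (n + 1) → A) → ℝ≥0∞)
    (M : Matrix (Fin (n + 1)) (Fin (n + 1)) A) : ℝ≥0∞ :=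
  ∑' w : {v : Fin n → O // v ≠ 0}, ∑' o : O, g (D.vec (Fin.cons o w.1 : Fin (n + 1) → O) ᵥ* M)

lemma tailSum_lowerSL_mul {n : ℕ} (g : (Fin (n + 1) → A) → ℝ≥0∞) (x : Fin n → O)
    (γ : SpecialLinearGroup (Fin n) O) (M : Matrix (Fin (n + 1)) (Fin (n + 1)) A) :
    D.tailSum g (D.mat (lowerSL x γ) * M) = D.tailSum g M := by
  refine Eq.trans (tsum_congr fun w => ?_) ((vecMulEquiv γ).tsum_eq fun w =>
    ∑' o : O, g (D.vec (Fin.cons o w.1 : Fin (n + 1) → O) ᵥ* M))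
  refine Eq.trans (tsum_congr fun o => ?_) ((Equiv.addRight (w.1 ⬝ᵥ x)).tsum_eq fun o =>
    g (D.vec (Fin.cons o ((vecMulEquiv γ) w).1 : Fin (n + 1) → O) ᵥ* M))
  congr 1
  rw [mat_lowerSL, ← vecMul_vecMul, vec_cons, cons_vecMul_lowerBlk, vec_dotProduct,
    vec_vecMul_mat, ← map_add, ← vec_cons]
  rfl

lemma measurable_tailSum {n : ℕ} {f : A → (Fin (n + 1) → A) → ℝ≥0∞}
    (hf : Measurable (Function.uncurry f)) : Measurable fun
      M : Matrix (Fin (n + 1)) (Fin (n + 1)) A => D.tailSum (f M.det) M := by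
  refine Measurable.tsum fun w => Measurable.tsum fun o => ?_
  refine Measurable.comp (f := fun M : Matrix (Fin (n + 1)) (Fin (n + 1)) A =>
    (M.det, D.vec (Fin.cons o w.1 : Fin (n + 1) → O) ᵥ* M)) hf ?_
  exact measurable_det.prodMk (continuous_const.matrix_vecMul continuous_id).measurable

lemma lintegral_boxPi_tailSum {n : ℕ} {g : (Fin (n + 2) → A) → ℝ≥0∞} (hg : Measurable g)
    (M : Matrix (Fin (n + 1)) (Fin (n + 1)) A) (r : Fin (n + 2) → A) :
    ∫⁻ t in D.boxPi (n + 1), D.tailSum g (lowerBlk t M * hmat r) =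
      ∑' w : {v : Fin (n + 1) → O // v ≠ 0},
        ∫⁻ s, g ((Fin.cons s (D.vec w.1 ᵥ* M) : Fin (n + 2) → A) ᵥ* hmat r) := by
  have hF : ∀ y : Fin (n + 1) → A, Measurable fun s : A =>
      g ((Fin.cons s y : Fin (n + 2) → A) ᵥ* hmat r) := fun y =>
    hg.comp ((measurable_vecMul _).comp
      (measurePreserving_fin_cons.measurable.comp measurable_prodMk_right))
  unfold tailSum
  rw [lintegral_tsum]
  · refine tsum_congr fun w => ?_
    rw [← D.lintegral_boxPi_dotProduct w.2 (hF (D.vec w.1 ᵥ* M))]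
    refine lintegral_congr fun t => tsum_congr fun o => ?_
    rw [← vecMul_vecMul, vec_cons, cons_vecMul_lowerBlk]
  · intro w
    refine Measurable.aemeasurable (Measurable.tsum fun o => ?_)
    simp_rw [← vecMul_vecMul, vec_cons, cons_vecMul_lowerBlk]
    refine (hF (D.vec w.1 ᵥ* M)).comp (f := fun t => D.ι o + D.vec w.1 ⬝ᵥ t) ?_
    exact (measurable_const_add _).comp (continuous_const.dotProduct continuous_id).measurable

/-- Second moment formula for pairs of non-proportional lattice vectors. -/
lemma lintegral_weight_prim_tailSum {n : ℕ} {f f2 : A → (Fin (n + 3) → A) → ℝ≥0∞}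
    (hf : Measurable (Function.uncurry f)) (hf2 : Measurable (Function.uncurry f2)) :
    ∫⁻ M, D.weight (n + 3) M * ∑' p : primRows O (n + 2), f M.det (D.vec p.1 ᵥ* M) *
      D.tailSum (f2 M.det) (D.mat (completion p) * M) =
    D.zeta (n + 2) * ∫⁻ a, (∫⁻ r, f a r) * (∫⁻ r, f2 a r) ∂(D.detMeasure (n + 1)) := by
  have hΦ : Measurable fun M : Matrix (Fin (n + 3)) (Fin (n + 3)) A =>
      f M.det (M 0) * D.tailSum (f2 M.det) M :=
    (hf.comp (measurable_det.prodMk (measurable_pi_apply 0))).mul (D.measurable_tailSum hf2)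
  have h1 := D.lintegral_weight_primRows hΦ (fun x γ M => by
    simp only [det_mat_mul, tailSum_lowerSL_mul]
    rw [mat_lowerSL, lowerBlk_mul_zero])
  simp only [det_mat_mul, mat_completion_mul_zero] at h1
  rw [h1]
  have hI : Measurable fun a => ∫⁻ r, f a r := hf.lintegral_prod_right'
  have hI2 : Measurable fun a => ∫⁻ r, f2 a r := hf2.lintegral_prod_right'
  have h2 : ∀ᵐ r : Fin (n + 3) → A, ∫⁻ t in D.boxPi (n + 2),
      ∫⁻ M' : Matrix (Fin (n + 2)) (Fin (n + 2)) A, D.weight (n + 2) M' *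
      (f (lowerBlk t M' * hmat r).det ((lowerBlk t M' * hmat r) 0) *
        D.tailSum (f2 (lowerBlk t M' * hmat r).det) (lowerBlk t M' * hmat r)) =
      D.zeta (n + 2) * ∫⁻ a, f a r * (∫⁻ r, f2 a r) ∂(D.detMeasure (n + 1)) := by
    filter_upwards [D.ae_isUnit_apply 0] with r hr
    have hfr : Measurable fun a => f a r :=
      Measurable.comp (f := fun a => (a, r)) hf measurable_prodMk_right
    have hf2a : ∀ a, Measurable (f2 a) := fun a =>
      Measurable.comp (f := fun r => (a, r)) hf2 measurable_prodMk_left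
    simp only [lowerBlk_mul_zero, det_mul, det_hmat hr, mul_one, det_lowerBlk, hmat_zero]
    have hblk : Measurable fun p : (Fin (n + 2) → A) × Matrix (Fin (n + 2)) (Fin (n + 2)) A =>
        lowerBlk p.1 p.2 * hmat r :=
      (measurable_mul_right _).comp (measurable_lowerBlk)
    have htail : Measurable fun p : (Fin (n + 2) → A) × Matrix (Fin (n + 2)) (Fin (n + 2)) A =>
        D.tailSum (f2 p.2.det) (lowerBlk p.1 p.2 * hmat r) := by
      have h3 := (D.measurable_tailSum hf2).comp hblk
      simpa only [det_mul, det_hmat hr, mul_one, det_lowerBlk, Function.comp_def] using h3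
    have hg : Measurable (Function.uncurry fun a (y : Fin (n + 2) → A) =>
        f a r * ∫⁻ s, f2 a ((Fin.cons s y : Fin (n + 3) → A) ᵥ* hmat r)) := by
      refine (hfr.comp measurable_fst).mul ?_
      refine Measurable.lintegral_prod_right' (f := fun p : (A × (Fin (n + 2) → A)) × A =>
        f2 p.1.1 ((Fin.cons p.2 p.1.2 : Fin (n + 3) → A) ᵥ* hmat r)) ?_
      refine Measurable.comp (f := fun p : (A × (Fin (n + 2) → A)) × A =>
        (p.1.1, (Fin.cons p.2 p.1.2 : Fin (n + 3) → A) ᵥ* hmat r)) hf2 ?_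
      refine (measurable_fst.comp measurable_fst).prodMk ((measurable_vecMul _).comp ?_)
      exact measurePreserving_fin_cons.measurable.comp
        (measurable_snd.prodMk (measurable_snd.comp measurable_fst))
    rw [lintegral_lintegral_swap]
    · have h4 := D.lintegral_weight_ne_zero hg
      have h5 : ∀ M' : Matrix (Fin (n + 2)) (Fin (n + 2)) A, ∫⁻ t in D.boxPi (n + 2),
          D.weight (n + 2) M' * (f M'.det r * D.tailSum (f2 M'.det) (lowerBlk t M' * hmat r)) =
          D.weight (n + 2) M' * ∑' v : {v : Fin (n + 2) → O // v ≠ 0}, f M'.det r *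
            ∫⁻ s, f2 M'.det ((Fin.cons s (D.vec v.1 ᵥ* M') : Fin (n + 3) → A) ᵥ* hmat r) := by
        intro M'
        have h6 : Measurable fun t => D.tailSum (f2 M'.det) (lowerBlk t M' * hmat r) :=
          htail.comp (f := fun t => (t, M')) measurable_prodMk_right
        rw [lintegral_const_mul _ (h6.const_mul _), lintegral_const_mul _ h6,
          D.lintegral_boxPi_tailSum (hf2a _), ENNReal.tsum_mul_left]
      simp_rw [h5]
      rw [h4]
      congr 1
      refine lintegral_congr fun a => ?_
      have h7 : Measurable fun p : A × (Fin (n + 2) → A) =>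
          f2 a ((Fin.cons p.1 p.2 : Fin (n + 3) → A) ᵥ* hmat r) :=
        (hf2a a).comp ((measurable_vecMul _).comp measurePreserving_fin_cons.measurable)
      have h8 : Measurable fun y : Fin (n + 2) → A =>
          ∫⁻ s, f2 a ((Fin.cons s y : Fin (n + 3) → A) ᵥ* hmat r) := h7.lintegral_prod_left'
      have h9 : Measurable (Function.uncurry fun (y : Fin (n + 2) → A) (s : A) =>
          f2 a ((Fin.cons s y : Fin (n + 3) → A) ᵥ* hmat r)) := h7.comp measurable_swap
      rw [lintegral_const_mul _ h8, lintegral_lintegral_swap h9.aemeasurable,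
        ← lintegral_fin_cons (F := fun x => f2 a (x ᵥ* hmat r)) ((hf2a a).comp (measurable_vecMul _)),
        (D.measurePreserving_vecMul _ _ (det_hmat hr)).lintegral_comp (hf2a a)]
    · refine Measurable.aemeasurable ?_
      exact ((D.measurable_weight _).comp measurable_snd).mul
        ((hfr.comp (measurable_det.comp measurable_snd)).mul htail)
  rw [lintegral_congr_ae h2, lintegral_const_mul, lintegral_lintegral_swap]
  · congr 1
    refine lintegral_congr fun a => lintegral_mul_const _ ?_
    exact Measurable.comp (f := fun r => (a, r)) hf measurable_prodMk_left
  · refine Measurable.aemeasurable ?_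
    exact (hf.comp (measurable_snd.prodMk measurable_fst)).mul (hI2.comp measurable_snd)
  · refine Measurable.lintegral_prod_right' (f := fun p : (Fin (n + 3) → A) × A =>
      f p.2 p.1 * (∫⁻ r, f2 p.2 r)) ?_
    exact (hf.comp (measurable_snd.prodMk measurable_fst)).mul (hI2.comp measurable_snd)

end ArithRing

lemma ENNReal.natCast_toNat_moebius_sum (j : ℕ) :
    (∑ k ∈ j.divisors, (((ArithmeticFunction.moebius k).toNat : ℕ) : ℝ≥0∞)) =
      (if j = 1 then 1 else 0) +
        ∑ k ∈ j.divisors, (((-ArithmeticFunction.moebius k).toNat : ℕ) : ℝ≥0∞) := by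
  have h1 : ∑ k ∈ j.divisors, ArithmeticFunction.moebius k = if j = 1 then 1 else 0 := by
    rw [← ArithmeticFunction.coe_mul_zeta_apply, ArithmeticFunction.moebius_mul_coe_zeta,
      ArithmeticFunction.one_apply]
  have h2 : ∑ k ∈ j.divisors, (((ArithmeticFunction.moebius k).toNat : ℕ) : ℤ) =
      (if j = 1 then 1 else 0) +
        ∑ k ∈ j.divisors, (((-ArithmeticFunction.moebius k).toNat : ℕ) : ℤ) := by
    rw [← h1, ← Finset.sum_add_distrib]
    refine Finset.sum_congr rfl fun k _ => ?_
    omega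
  have h3 : ∑ k ∈ j.divisors, (ArithmeticFunction.moebius k).toNat =
      (if j = 1 then 1 else 0) + ∑ k ∈ j.divisors, (-ArithmeticFunction.moebius k).toNat := by
    apply Int.ofNat_inj.mp
    push_cast
    exact h2
  have h4 := congr_arg (Nat.cast : ℕ → ℝ≥0∞) h3
  push_cast at h4
  exact h4

namespace ArithRing

variable {A O : Type} [NormedCommRing A] [ProperSpace A] [MeasureSpace A]
  [BorelSpace A] [(volume : Measure A).IsAddHaarMeasure] [CommRing O] (D : ArithRing A O)
  [CompleteSpace A] [Countable O]

lemma tsum_N_mul {k : ℕ} (hk : k ∈ D.N) (g : ℕ → ℝ≥0∞) :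
    ∑' m : D.N, g (k * m) = ∑' j : D.N, if k ∣ j then g j else 0 := by
  classical
  have hinj : Function.Injective fun m : D.N => (⟨k * m, D.N_mul k hk m m.2⟩ : D.N) := by
    intro m m' h
    exact Subtype.ext (Nat.eq_of_mul_eq_mul_left (D.N_pos k hk) (congr_arg Subtype.val h))
  rw [← hinj.tsum_eq (f := fun j : D.N => if k ∣ (j : ℕ) then g j else 0)]
  · simp
  · intro j hj
    have hkj : k ∣ j := by
      by_contra h
      simp [h] at hj
    obtain ⟨m, hm⟩ := hkj
    exact ⟨⟨m, D.N_dvd j j.2 m ⟨k, by rw [hm, mul_comm]⟩⟩, Subtype.ext hm.symm⟩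

lemma tsum_N_dvd {j : ℕ} (hj : j ∈ D.N) (c : ℕ → ℝ≥0∞) :
    ∑' k : D.N, (if (k : ℕ) ∣ j then c k else 0) = ∑ k ∈ j.divisors, c k := by
  classical
  rw [← Finset.tsum_subtype]
  have hinj : Function.Injective fun k : {k // k ∈ j.divisors} =>
      (⟨k, D.N_dvd j hj k (Nat.dvd_of_mem_divisors k.2)⟩ : D.N) := by
    intro m m' h
    exact Subtype.ext (congr_arg (fun x : D.N => (x : ℕ)) h)
  rw [← hinj.tsum_eq (f := fun k : D.N => if (k : ℕ) ∣ j then c k else 0)]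
  · refine tsum_congr fun k => ?_
    simp [Nat.dvd_of_mem_divisors k.2]
  · intro k hk
    have hkj : (k : ℕ) ∣ j := by
      by_contra h
      simp [h] at hk
    exact ⟨⟨k, Nat.mem_divisors.mpr ⟨hkj, (D.N_pos j hj).ne'⟩⟩, rfl⟩

lemma tsum_N_convolution (c g : ℕ → ℝ≥0∞) :
    ∑' k : D.N, c k * ∑' m : D.N, g (k * m) = ∑' j : D.N, g j * ∑ k ∈ (j : ℕ).divisors, c k := by
  have h1 : ∀ k : D.N, c k * ∑' m : D.N, g (k * m) =
      ∑' j : D.N, g j * if (k : ℕ) ∣ j then c k else 0 := by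
    intro k
    rw [D.tsum_N_mul k.2, ← ENNReal.tsum_mul_left]
    refine tsum_congr fun j => ?_
    split_ifs <;> ring
  simp_rw [h1]
  rw [ENNReal.tsum_comm]
  refine tsum_congr fun j => ?_
  rw [ENNReal.tsum_mul_left, D.tsum_N_dvd j.2]

/-- Möbius inversion for homogeneous families. -/
lemma zeta_mul_of_tsum_eq (n : ℕ) {g : ℕ → ℝ≥0∞} {G : ℝ≥0∞} (hG : G ≠ ∞)
    (h : ∀ k ∈ D.N, ∑' m : D.N, g (k * m) = ((k : ℝ≥0∞) ^ (n + 2))⁻¹ * G) :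
    D.zeta (n + 2) * g 1 = G := by
  classical
  let c₁ : ℕ → ℝ≥0∞ := fun k => (((ArithmeticFunction.moebius k).toNat : ℕ) : ℝ≥0∞)
  let c₂ : ℕ → ℝ≥0∞ := fun k => (((-ArithmeticFunction.moebius k).toNat : ℕ) : ℝ≥0∞)
  let a : (ℕ → ℝ≥0∞) → ℝ≥0∞ := fun c => ∑' k : D.N, c k * (((k : ℕ) : ℝ≥0∞) ^ (n + 2))⁻¹
  have key : ∀ (g : ℕ → ℝ≥0∞) (G : ℝ≥0∞), (∀ k ∈ D.N, ∑' m : D.N, g (k * m) =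
      ((k : ℝ≥0∞) ^ (n + 2))⁻¹ * G) → a c₁ * G = g 1 + a c₂ * G := by
    intro g G h
    have h1 : ∀ c : ℕ → ℝ≥0∞, a c * G = ∑' j : D.N, g j * ∑ k ∈ (j : ℕ).divisors, c k := by
      intro c
      rw [← D.tsum_N_convolution, ← ENNReal.tsum_mul_right]
      refine tsum_congr fun k => ?_
      rw [h k k.2, mul_assoc]
    have h2 : ∑' j : D.N, g j * (if (j : ℕ) = 1 then 1 else 0) = g 1 := by
      rw [tsum_eq_single ⟨1, D.N_one⟩]
      · simp
      · intro j hj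
        rw [if_neg fun h => hj (Subtype.ext h), mul_zero]
    rw [h1, h1, ← h2, ← ENNReal.tsum_add]
    refine tsum_congr fun j => ?_
    rw [ENNReal.natCast_toNat_moebius_sum, mul_add]
  have hz := key (fun m => ((m : ℝ≥0∞) ^ (n + 2))⁻¹) (D.zeta (n + 2)) fun k hk => by
    unfold zeta
    rw [← ENNReal.tsum_mul_left]
    refine tsum_congr fun m => ?_
    rw [Nat.cast_mul, mul_pow, ENNReal.mul_inv]
    · exact Or.inr (ENNReal.pow_ne_top (ENNReal.natCast_ne_top _))
    · exact Or.inl (ENNReal.pow_ne_top (ENNReal.natCast_ne_top _))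
  have hg := key g G h
  have hc₂ : a c₂ ≠ ∞ := by
    refine ne_top_of_le_ne_top (D.zeta_ne_top n) (ENNReal.tsum_le_tsum fun k => ?_)
    refine mul_le_of_le_one_left' ?_
    have h1 := ArithmeticFunction.abs_moebius_le_one (n := (k : ℕ))
    rw [abs_le] at h1
    have h2 : (-ArithmeticFunction.moebius (k : ℕ)).toNat ≤ 1 := by omega
    show (((-ArithmeticFunction.moebius (k : ℕ)).toNat : ℕ) : ℝ≥0∞) ≤ 1
    exact_mod_cast h2
  have hfin : a c₂ * G * D.zeta (n + 2) ≠ ∞ :=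
    ENNReal.mul_ne_top (ENNReal.mul_ne_top hc₂ hG) (D.zeta_ne_top n)
  refine (ENNReal.add_left_inj hfin).mp ?_
  calc D.zeta (n + 2) * g 1 + a c₂ * G * D.zeta (n + 2)
      = (g 1 + a c₂ * G) * D.zeta (n + 2) := by ring
    _ = (a c₁ * D.zeta (n + 2)) * G := by rw [← hg]; ring
    _ = _ := by
      rw [hz]
      simp only [Nat.cast_one, one_pow, inv_one]
      ring

end ArithRing

namespace ArithRing

variable {A O : Type} [NormedCommRing A] [ProperSpace A] [MeasureSpace A]
  [BorelSpace A] [(volume : Measure A).IsAddHaarMeasure] [CommRing O] (D : ArithRing A O)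
  [CompleteSpace A] [Countable O]

/-- The predicate that `v` is a multiple of the primitive row `p`. -/
def Par {n : ℕ} (p : primRows O n) (v : Fin (n + 1) → O) : Prop :=
  Fin.tail (v ᵥ* ((completion p)⁻¹).1) = 0

lemma par_natCast_smul {n : ℕ} (p : primRows O n) {m : ℕ} (hm : m ∈ D.N) (v : Fin (n + 1) → O) :
    Par p ((m : O) • v) ↔ Par p v := by
  unfold Par
  rw [smul_vecMul]
  generalize v ᵥ* ((completion p)⁻¹).1 = u
  have h1 : Fin.tail ((m : O) • u) = (m : O) • Fin.tail u := rfl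
  rw [h1]
  constructor
  · intro h
    by_contra h2
    exact D.smul_ne_zero' (D.natCast_ne_zero m hm) h2 h
  · intro h
    rw [h, smul_zero]

lemma Par.exists_smul {n : ℕ} {p : primRows O n} {v : Fin (n + 1) → O} (h : Par p v) :
    ∃ o : O, v = o • p.1 := by
  refine ⟨(v ᵥ* ((completion p)⁻¹).1) 0, ?_⟩
  have h1 : v ᵥ* ((completion p)⁻¹).1 =
      Fin.cons ((v ᵥ* ((completion p)⁻¹).1) 0) (0 : Fin n → O) := by
    rw [← (show Fin.tail (v ᵥ* ((completion p)⁻¹).1) = 0 from h), Fin.cons_self_tail]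
  have h2 := vecMul_vecMul_cancel (inv_mul_cancel (completion p)) v
  have h3 : (completion p).1 0 = p.1 := completion_zero p
  rw [h1] at h2
  rw [← h3]
  refine h2.symm.trans ?_
  generalize (v ᵥ* ((completion p)⁻¹).1) 0 = t
  generalize (completion p).1 = c
  ext j
  simp [vecMul, dotProduct, Fin.sum_univ_succ]

open Classical in
lemma tailSum_completion_mul {n : ℕ} (p : primRows O n) (g : (Fin (n + 1) → A) → ℝ≥0∞)
    (M : Matrix (Fin (n + 1)) (Fin (n + 1)) A) :
    D.tailSum g (D.mat (completion p) * M) =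
      ∑' v : {v : Fin (n + 1) → O // v ≠ 0}, if Par p v.1 then 0 else g (D.vec v.1 ᵥ* M) := by
  let h : (Fin (n + 1) → O) → ℝ≥0∞ := fun v =>
    if Fin.tail v = 0 then 0 else g (D.vec v ᵥ* (D.mat (completion p) * M))
  have h1 : (∑' v : {v : Fin (n + 1) → O // v ≠ 0}, if Par p v.1 then 0 else g (D.vec v.1 ᵥ* M)) =
      ∑' v : {v : Fin (n + 1) → O // v ≠ 0}, h v.1 := by
    rw [← (vecMulEquiv (completion p)).tsum_eq]
    refine tsum_congr fun v => ?_
    have h2 : Par p ((vecMulEquiv (completion p)) v).1 ↔ Fin.tail v.1 = 0 := by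
      unfold Par vecMulEquiv
      simp only [Equiv.coe_fn_mk]
      rw [vecMul_vecMul_cancel (mul_inv_cancel (completion p))]
    simp only [h2, h]
    split_ifs
    · rfl
    · rw [← vecMul_vecMul, vec_vecMul_mat]
      rfl
  have h2 : ∑' v : {v : Fin (n + 1) → O // v ≠ 0}, h v.1 = ∑' v, h v := by
    refine Subtype.val_injective.tsum_eq (f := h) fun v hv => ⟨⟨v, ?_⟩, rfl⟩
    rintro rfl
    exact hv (if_pos rfl)
  have h3 : ∑' v, h v = ∑' w : Fin n → O, ∑' o : O, h (Fin.cons o w) := by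
    rw [← (Fin.consEquiv fun _ : Fin (n + 1) => O).tsum_eq h, ENNReal.tsum_prod', ENNReal.tsum_comm]
    rfl
  have h4 : ∑' w : Fin n → O, ∑' o : O, h (Fin.cons o w) =
      ∑' w : {v : Fin n → O // v ≠ 0}, ∑' o : O, h (Fin.cons o w.1) := by
    refine (Subtype.val_injective.tsum_eq (f := fun w => ∑' o : O, h (Fin.cons o w))
      fun w hw => ⟨⟨w, ?_⟩, rfl⟩).symm
    rintro rfl
    refine hw (ENNReal.tsum_eq_zero.mpr fun o => ?_)
    simp [h]
  rw [h1, h2, h3, h4]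
  refine tsum_congr fun w => tsum_congr fun o => ?_
  simp only [h, Fin.tail_cons, if_neg w.2]

open Classical in
lemma measurable_primPairs {n : ℕ} {f f2 : A → (Fin (n + 1) → A) → ℝ≥0∞}
    (hf : Measurable (Function.uncurry f)) (hf2 : Measurable (Function.uncurry f2)) :
    Measurable fun M : Matrix (Fin (n + 1)) (Fin (n + 1)) A =>
      ∑' p : primRows O n, f M.det (D.vec p.1 ᵥ* M) *
        ∑' q : primRows O n, if Par p q.1 then 0 else f2 M.det (D.vec q.1 ᵥ* M) := by
  have key : ∀ (f : A → (Fin (n + 1) → A) → ℝ≥0∞), Measurable (Function.uncurry f) →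
      ∀ v : Fin (n + 1) → O, Measurable fun M : Matrix (Fin (n + 1)) (Fin (n + 1)) A =>
        f M.det (D.vec v ᵥ* M) := fun f hf v =>
    hf.comp (measurable_det.prodMk (continuous_const.matrix_vecMul continuous_id).measurable)
  refine Measurable.tsum fun p => (key f hf p.1).mul (Measurable.tsum fun q => ?_)
  split_ifs
  · exact measurable_const
  · exact key f2 hf2 q.1

open Classical in
/-- Second moment formula for pairs of non-proportional primitive vectors. -/
lemma lintegral_weight_primPairs {n : ℕ} {f f2 : A → (Fin (n + 3) → A) → ℝ≥0∞}
    (hf : Measurable (Function.uncurry f)) (hf2 : Measurable (Function.uncurry f2))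
    (hfin : ∫⁻ a, (∫⁻ r, f a r) * (∫⁻ r, f2 a r) ∂(D.detMeasure (n + 1)) ≠ ∞) :
    D.zeta (n + 3) * ∫⁻ M, D.weight (n + 3) M * ∑' p : primRows O (n + 2),
      f M.det (D.vec p.1 ᵥ* M) *
        ∑' q : primRows O (n + 2), (if Par p q.1 then 0 else f2 M.det (D.vec q.1 ᵥ* M)) =
    D.zeta (n + 2) * ∫⁻ a, (∫⁻ r, f a r) * (∫⁻ r, f2 a r) ∂(D.detMeasure (n + 1)) := by
  let fk : ℕ → A → (Fin (n + 3) → A) → ℝ≥0∞ := fun k a r => f2 a ((k : A) • r)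
  have hfk : ∀ k, Measurable (Function.uncurry (fk k)) := fun k =>
    Measurable.comp (f := fun p : A × (Fin (n + 3) → A) => (p.1, (k : A) • p.2)) hf2
      (measurable_fst.prodMk ((continuous_const_smul (k : A)).measurable.comp measurable_snd))
  let P : ℕ → ℝ≥0∞ := fun k => ∫⁻ M, D.weight (n + 3) M * ∑' p : primRows O (n + 2),
      f M.det (D.vec p.1 ᵥ* M) *
        ∑' q : primRows O (n + 2), (if Par p q.1 then 0 else fk k M.det (D.vec q.1 ᵥ* M))
  have h1 := D.zeta_mul_of_tsum_eq (n + 1) (g := P)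
    (ENNReal.mul_ne_top (D.zeta_ne_top n) hfin) (fun k hk => by
      simp only [P]
      have hm : ∀ m : D.N, AEMeasurable (fun M : Matrix (Fin (n + 3)) (Fin (n + 3)) A =>
          D.weight (n + 3) M * ∑' p : primRows O (n + 2), f M.det (D.vec p.1 ᵥ* M) *
            ∑' q : primRows O (n + 2), (if Par p q.1 then 0 else
              fk (k * m) M.det (D.vec q.1 ᵥ* M))) volume := fun m =>
        ((D.measurable_weight _).mul (D.measurable_primPairs hf (hfk _))).aemeasurable
      rw [← lintegral_tsum hm]
      have h2 := D.lintegral_weight_prim_tailSum hf (hfk k)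
      have h3 : ∀ a, ∫⁻ r, fk k a r = ((k : ℝ≥0∞) ^ (n + 3))⁻¹ * ∫⁻ r, f2 a r := fun a =>
        D.lintegral_natCast_smul hk
          (Measurable.comp (f := fun r => (a, r)) hf2 measurable_prodMk_left)
      have h4 : ∫⁻ a, (∫⁻ r, f a r) * (∫⁻ r, fk k a r) ∂(D.detMeasure (n + 1)) =
          ((k : ℝ≥0∞) ^ (n + 3))⁻¹ *
            ∫⁻ a, (∫⁻ r, f a r) * (∫⁻ r, f2 a r) ∂(D.detMeasure (n + 1)) := by
        have hm' : Measurable fun a => (∫⁻ r, f a r) * (∫⁻ r, f2 a r) :=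
          hf.lintegral_prod_right'.mul hf2.lintegral_prod_right'
        rw [← lintegral_const_mul _ hm']
        refine lintegral_congr fun a => ?_
        rw [h3]
        ring
      rw [h4, mul_left_comm] at h2
      rw [← h2]
      refine lintegral_congr fun M => ?_
      rw [ENNReal.tsum_mul_left, ENNReal.tsum_comm]
      congr 1
      refine tsum_congr fun p => ?_
      rw [ENNReal.tsum_mul_left, tailSum_completion_mul,
        D.tsum_ne_zero fun v => if Par p v then 0 else fk k M.det (D.vec v ᵥ* M)]
      congr 1
      refine tsum_congr fun m => tsum_congr fun q => ?_
      simp only [D.par_natCast_smul p m.2, fk, vec_natCast_smul, smul_vecMul, smul_smul,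
        Nat.cast_mul])
  rw [← h1]
  simp only [P, fk, Nat.cast_one, one_smul]

/-- The sum of `g` over the primitive vectors of the unimodular lattice attached to `M`. -/
noncomputable def primSum {n : ℕ} (g : (Fin (n + 1) → A) → ℝ≥0∞)
    (M : Matrix (Fin (n + 1)) (Fin (n + 1)) A) : ℝ≥0∞ :=
  ∑' p : primRows O n, g (D.vec p.1 ᵥ* (M * diagCons (Ring.inverse M.det)))

lemma measurable_vecMul_normalize {n : ℕ} (v : Fin (n + 1) → A) :
    Measurable fun M : Matrix (Fin (n + 1)) (Fin (n + 1)) A =>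
      v ᵥ* (M * diagCons (Ring.inverse M.det)) := by
  have h1 : Measurable fun M : Matrix (Fin (n + 1)) (Fin (n + 1)) A =>
      (diagCons (Ring.inverse M.det) : Matrix (Fin (n + 1)) (Fin (n + 1)) A) := by
    have h2 : Continuous fun a : A => (diagCons a : Matrix (Fin (n + 1)) (Fin (n + 1)) A) := by
      unfold diagCons
      refine Continuous.matrix_diagonal (continuous_pi fun i => ?_)
      refine Fin.cases ?_ (fun j => ?_) i
      · exact continuous_id
      · exact continuous_const
    exact h2.measurable.comp (measurable_ringInverse.comp measurable_det)
  exact (continuous_const.matrix_vecMul continuous_id).measurable.comp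
    (measurable_mul.comp (measurable_id.prodMk h1))

lemma measurable_primSum {n : ℕ} {g : (Fin (n + 1) → A) → ℝ≥0∞} (hg : Measurable g) :
    Measurable (D.primSum g) :=
  Measurable.tsum fun _ => hg.comp (measurable_vecMul_normalize _)

/-- The function `g` in coordinates normalized by the determinant. -/
noncomputable def normFun {n : ℕ} (E : Set A) (g : (Fin (n + 1) → A) → ℝ≥0∞) (a : A)
    (r : Fin (n + 1) → A) : ℝ≥0∞ :=
  E.indicator 1 a * g (r ᵥ* diagCons (Ring.inverse a))

lemma measurable_normFun {n : ℕ} {E : Set A} (hE : MeasurableSet E)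
    {g : (Fin (n + 1) → A) → ℝ≥0∞} (hg : Measurable g) :
    Measurable (Function.uncurry (normFun E g)) := by
  refine ((measurable_one.indicator hE).comp measurable_fst).mul (hg.comp ?_)
  have h2 : Continuous fun p : A × (Fin (n + 1) → A) => p.2 ᵥ* (diagCons p.1) := by
    refine continuous_snd.matrix_vecMul (Continuous.matrix_diagonal (continuous_pi fun i => ?_))
    refine Fin.cases ?_ (fun j => ?_) i
    · exact continuous_fst
    · exact continuous_const
  exact h2.measurable.comp (f := fun p : A × (Fin (n + 1) → A) => (Ring.inverse p.1, p.2))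
    ((measurable_ringInverse.comp measurable_fst).prodMk measurable_snd)

lemma lintegral_normFun {n : ℕ} {E : Set A} (hE : D.IsBase E)
    {g : (Fin (n + 1) → A) → ℝ≥0∞} (hg : Measurable g) (a : A) :
    ∫⁻ r, normFun E g a r = E.indicator (fun a => D.md a * ∫⁻ r, g r) a := by
  unfold normFun
  by_cases ha : a ∈ E
  · rw [Set.indicator_of_mem ha, Set.indicator_of_mem ha]
    simp only [Pi.one_apply, one_mul]
    rw [← D.lintegral_vecMul_diagCons (hE.isUnit a ha)
      (g := fun r => g (r ᵥ* diagCons (Ring.inverse a))) (hg.comp (measurable_vecMul _))]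
    congr 1
    refine lintegral_congr fun r => ?_
    rw [vecMul_vecMul, diagCons_mul, Ring.mul_inverse_cancel _ (hE.isUnit a ha), diagCons_one,
      vecMul_one]
  · simp [ha]

lemma normFun_det {n : ℕ} (E : Set A) (g : (Fin (n + 1) → A) → ℝ≥0∞) (v : Fin (n + 1) → A)
    (M : Matrix (Fin (n + 1)) (Fin (n + 1)) A) :
    normFun E g M.det (v ᵥ* M) =
      E.indicator 1 M.det * g (v ᵥ* (M * diagCons (Ring.inverse M.det))) := by
  unfold normFun
  rw [vecMul_vecMul]

/-- First moment of the sum over primitive vectors. -/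
lemma lintegral_weight_primSum {n : ℕ} {E : Set A} (hE : D.IsBase E)
    {g : (Fin (n + 2) → A) → ℝ≥0∞} (hg : Measurable g) :
    D.zeta (n + 2) * ∫⁻ M, D.weight (n + 2) M * (E.indicator 1 M.det * D.primSum g M) =
      D.detMeasure (n + 2) E * ∫⁻ r, g r := by
  have h1 := D.lintegral_weight_prim (measurable_normFun hE.measurableSet hg)
  simp only [normFun_det, D.lintegral_normFun hE hg, ENNReal.tsum_mul_left] at h1
  unfold primSum
  rw [h1, lintegral_indicator hE.measurableSet,
    D.setLIntegral_md hE (h := fun _ => ∫⁻ r, g r) measurable_const, setLIntegral_const, mul_comm]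

open Classical in
lemma lintegral_weight_primPairs_normalized {n : ℕ} {E : Set A} (hE : D.IsBase E)
    {g : (Fin (n + 3) → A) → ℝ≥0∞} (hg : Measurable g) (hfin : ∫⁻ r, g r ≠ ∞) :
    D.zeta (n + 3) ^ 2 * ∫⁻ M, D.weight (n + 3) M * (E.indicator 1 M.det *
      ∑' p : primRows O (n + 2), g (D.vec p.1 ᵥ* (M * diagCons (Ring.inverse M.det))) *
        ∑' q : primRows O (n + 2), (if Par p q.1 then 0 else
          g (D.vec q.1 ᵥ* (M * diagCons (Ring.inverse M.det))))) =
    D.detMeasure (n + 3) E * (∫⁻ r, g r) ^ 2 := by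
  have hf := measurable_normFun hE.measurableSet hg
  obtain ⟨c, hc, hcE⟩ := hE.md_le
  have h0 : ∀ a, (∫⁻ r, normFun E g a r) * (∫⁻ r, normFun E g a r) =
      E.indicator (fun a => D.md a * (D.md a * (∫⁻ r, g r) ^ 2)) a := by
    intro a
    rw [D.lintegral_normFun hE hg]
    by_cases ha : a ∈ E
    · rw [Set.indicator_of_mem ha, Set.indicator_of_mem ha]
      ring
    · simp [ha]
  have h1 := D.lintegral_weight_primPairs hf hf (by
    simp_rw [h0]
    rw [lintegral_indicator hE.measurableSet]
    refine ne_top_of_le_ne_top ?_ (setLIntegral_mono_ae (g := fun _ => c * (c * (∫⁻ r, g r) ^ 2))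
      measurable_const.aemeasurable (ae_of_all _ fun a ha => by
        gcongr <;> exact hcE a ha))
    rw [setLIntegral_const]
    exact ENNReal.mul_ne_top (ENNReal.mul_ne_top hc (ENNReal.mul_ne_top hc
      (ENNReal.pow_ne_top hfin))) (D.detMeasure_ne_top hE))
  simp_rw [h0] at h1
  rw [lintegral_indicator hE.measurableSet, D.setLIntegral_md hE
    (h := fun a => D.md a * (∫⁻ r, g r) ^ 2) (D.measurable_md.mul_const _)] at h1
  have h2 := D.setLIntegral_md (n := n + 1) hE (h := fun _ => (∫⁻ r, g r) ^ 2) measurable_const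
  rw [← h1, setLIntegral_const] at h2
  rw [mul_comm (D.detMeasure _ _), ← h2, sq, mul_assoc]
  congr 2
  refine lintegral_congr fun M => ?_
  congr 1
  rw [← ENNReal.tsum_mul_left]
  refine tsum_congr fun p => ?_
  simp only [normFun_det]
  by_cases ha : M.det ∈ E
  · simp [ha]
  · simp [ha]

/-- The sum of the overlaps of `B` with its multiples. -/
noncomputable def parSum {n : ℕ} (B : Set (Fin n → A)) : ℝ≥0∞ :=
  ∑' o : {o : O // o ≠ 0}, volume (B ∩ (fun x => D.ι o.1 • x) ⁻¹' B)

/-- The sum over `o` of the overlaps of a function with its multiples. -/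
noncomputable def overlap {n : ℕ} (g : (Fin n → A) → ℝ≥0∞) (x : Fin n → A) : ℝ≥0∞ :=
  ∑' o : {o : O // o ≠ 0}, g x * g (D.ι o.1 • x)

lemma measurable_overlap {n : ℕ} {g : (Fin n → A) → ℝ≥0∞} (hg : Measurable g) :
    Measurable (D.overlap g) :=
  Measurable.tsum fun _ => hg.mul (hg.comp (continuous_const_smul _).measurable)

lemma lintegral_overlap {n : ℕ} {B : Set (Fin n → A)} (hB : MeasurableSet B) :
    ∫⁻ x, D.overlap (B.indicator 1) x = D.parSum B := by
  have hg : Measurable (B.indicator (1 : (Fin n → A) → ℝ≥0∞)) := measurable_one.indicator hB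
  have hs : ∀ o : {o : O // o ≠ 0}, Measurable fun x : Fin n → A => D.ι o.1 • x := fun o =>
    (continuous_const_smul _).measurable
  have hm : ∀ o : {o : O // o ≠ 0}, AEMeasurable (fun x : Fin n → A =>
      B.indicator (1 : (Fin n → A) → ℝ≥0∞) x * B.indicator 1 (D.ι o.1 • x)) volume := fun o =>
    (hg.mul (hg.comp (hs o))).aemeasurable
  unfold overlap parSum
  rw [lintegral_tsum hm]
  refine tsum_congr fun o => ?_
  rw [← lintegral_indicator_one (hB.inter (hs o hB))]
  refine lintegral_congr fun x => ?_
  by_cases h1 : x ∈ B <;> by_cases h2 : D.ι o.1 • x ∈ B <;> simp [h1, h2]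

open Classical in
lemma primSum_sq_le {n : ℕ} (g : (Fin (n + 1) → A) → ℝ≥0∞)
    (M : Matrix (Fin (n + 1)) (Fin (n + 1)) A) :
    D.primSum g M ^ 2 ≤ (∑' p : primRows O n,
        g (D.vec p.1 ᵥ* (M * diagCons (Ring.inverse M.det))) *
          ∑' q : primRows O n, (if Par p q.1 then 0 else
            g (D.vec q.1 ᵥ* (M * diagCons (Ring.inverse M.det))))) +
      D.primSum (D.overlap g) M := by
  unfold primSum
  generalize M * diagCons (Ring.inverse M.det) = M'
  rw [sq, ← ENNReal.tsum_mul_right, ← ENNReal.tsum_add]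
  refine ENNReal.tsum_le_tsum fun p => ?_
  unfold overlap
  rw [ENNReal.tsum_mul_left, ← mul_add]
  gcongr
  have h1 : ∑' q : primRows O n, g (D.vec q.1 ᵥ* M') =
      (∑' q : primRows O n, if Par p q.1 then 0 else g (D.vec q.1 ᵥ* M')) +
        ∑' q : primRows O n, if Par p q.1 then g (D.vec q.1 ᵥ* M') else 0 := by
    rw [← ENNReal.tsum_add]
    refine tsum_congr fun q => ?_
    split_ifs <;> simp
  rw [h1]
  gcongr
  have h2 : (∑' q : primRows O n, if Par p q.1 then g (D.vec q.1 ᵥ* M') else 0) =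
      ∑' q : {q : primRows O n // Par p q.1}, g (D.vec q.1.1 ᵥ* M') := by
    rw [← Subtype.val_injective.tsum_eq
      (f := fun q : primRows O n => if Par p q.1 then g (D.vec q.1 ᵥ* M') else 0)]
    · exact tsum_congr fun q => if_pos q.2
    · intro q hq
      by_cases h : Par p q.1
      · exact ⟨⟨q, h⟩, rfl⟩
      · exact absurd (if_neg h) hq
  rw [h2]
  choose φ hφ using fun q : {q : primRows O n // Par p q.1} => q.2.exists_smul
  have hφ0 : ∀ q, φ q ≠ 0 := fun q h => by
    have h3 := hφ q
    rw [h, zero_smul] at h3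
    exact D.primRows_ne_zero q.1.2 h3
  have hinj : Function.Injective fun q => (⟨φ q, hφ0 q⟩ : {o : O // o ≠ 0}) := by
    intro q q' h
    have h3 : φ q = φ q' := congr_arg Subtype.val h
    exact Subtype.ext (Subtype.ext ((hφ q).trans (by rw [h3]; exact (hφ q').symm)))
  refine le_trans (le_of_eq (tsum_congr fun q => ?_)) (ENNReal.tsum_comp_le_tsum_of_injective hinj
    fun o => g (D.ι o.1 • D.vec p.1 ᵥ* M'))
  rw [hφ q, vec_smul, smul_vecMul]

/-- The weighted measure on matrices with determinant in `E`. -/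
noncomputable def weightMeasure (n : ℕ) (E : Set A) : Measure (Matrix (Fin n) (Fin n) A) :=
  (volume.withDensity (D.weight n)).restrict {M | M.det ∈ E}

lemma lintegral_weightMeasure {n : ℕ} {E : Set A} (hE : MeasurableSet E)
    {h : Matrix (Fin n) (Fin n) A → ℝ≥0∞} (hh : Measurable h) :
    ∫⁻ M, h M ∂(D.weightMeasure n E) = ∫⁻ M, D.weight n M * (E.indicator 1 M.det * h M) := by
  have hE' : MeasurableSet {M : Matrix (Fin n) (Fin n) A | M.det ∈ E} := measurable_det hE
  unfold weightMeasure
  rw [restrict_withDensity hE', lintegral_withDensity_eq_lintegral_mul _ (D.measurable_weight n) hh,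
    ← lintegral_indicator hE']
  refine lintegral_congr fun M => ?_
  by_cases h : M.det ∈ E <;> simp [h]

lemma weightMeasure_univ {n : ℕ} {E : Set A} (hE : MeasurableSet E) :
    D.weightMeasure n E Set.univ = D.detMeasure n E := by
  rw [detMeasure_apply _ hE, ← lintegral_one, D.lintegral_weightMeasure hE measurable_const]
  simp only [mul_one]

/-- First moment of the number of primitive vectors in `B`. -/
lemma lintegral_primSum {n : ℕ} {E : Set A} (hE : D.IsBase E)
    {g : (Fin (n + 2) → A) → ℝ≥0∞} (hg : Measurable g) :
    ∫⁻ M, D.primSum g M ∂(D.weightMeasure (n + 2) E) =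
      D.detMeasure (n + 2) E * ((∫⁻ r, g r) / D.zeta (n + 2)) := by
  rw [D.lintegral_weightMeasure hE.measurableSet (D.measurable_primSum hg), ← mul_div_assoc,
    ← D.lintegral_weight_primSum hE hg]
  exact (ENNReal.eq_div_iff (D.zeta_ne_zero _) (D.zeta_ne_top _)).mpr rfl

/-- Second moment of the number of primitive vectors in `B`. -/
lemma lintegral_primSum_sq_le {n : ℕ} {E : Set A} (hE : D.IsBase E)
    {B : Set (Fin (n + 3) → A)} (hB : MeasurableSet B) (hfin : volume B ≠ ∞) :
    ∫⁻ M, D.primSum (B.indicator 1) M ^ 2 ∂(D.weightMeasure (n + 3) E) ≤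
      D.detMeasure (n + 3) E * (volume B / D.zeta (n + 3)) ^ 2 +
        D.detMeasure (n + 3) E * (D.parSum B / D.zeta (n + 3)) := by
  classical
  have hg : Measurable (B.indicator (1 : (Fin (n + 3) → A) → ℝ≥0∞)) := measurable_one.indicator hB
  have h1 : ∫⁻ r, B.indicator (1 : (Fin (n + 3) → A) → ℝ≥0∞) r = volume B := lintegral_indicator_one hB
  refine (lintegral_mono fun M => D.primSum_sq_le _ M).trans ?_
  rw [lintegral_add_right _ (D.measurable_primSum (D.measurable_overlap hg)),
    D.lintegral_primSum hE (D.measurable_overlap hg), D.lintegral_overlap hB]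
  gcongr
  have hm : Measurable fun M : Matrix (Fin (n + 3)) (Fin (n + 3)) A =>
      ∑' p : primRows O (n + 2), B.indicator (1 : (Fin (n + 3) → A) → ℝ≥0∞)
          (D.vec p.1 ᵥ* (M * diagCons (Ring.inverse M.det))) *
        ∑' q : primRows O (n + 2), (if Par p q.1 then 0 else B.indicator 1
          (D.vec q.1 ᵥ* (M * diagCons (Ring.inverse M.det)))) := by
    refine Measurable.tsum fun p => (hg.comp (measurable_vecMul_normalize _)).mul
      (Measurable.tsum fun q => ?_)
    split_ifs
    · exact measurable_const
    · exact hg.comp (measurable_vecMul_normalize _)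
  rw [D.lintegral_weightMeasure hE.measurableSet hm]
  have h2 := D.lintegral_weight_primPairs_normalized hE hg (by rwa [h1])
  have hz0 : D.zeta (n + 3) ^ 2 ≠ 0 := pow_ne_zero _ (D.zeta_ne_zero _)
  have hzt : D.zeta (n + 3) ^ 2 ≠ ∞ := ENNReal.pow_ne_top (D.zeta_ne_top (n + 1))
  rw [div_eq_mul_inv, mul_pow, ← ENNReal.inv_pow, ← mul_assoc, ← div_eq_mul_inv, ← h1, ← h2]
  exact ((ENNReal.eq_div_iff hz0 hzt).mpr rfl).le

/-- Variance bound for the number of primitive vectors in `B`. -/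
lemma lintegral_primSum_sub_sq_le {n : ℕ} {E : Set A} (hE : D.IsBase E)
    {B : Set (Fin (n + 3) → A)} (hB : MeasurableSet B) (hfin : volume B ≠ ∞) :
    (∀ᵐ M ∂(D.weightMeasure (n + 3) E), D.primSum (B.indicator 1) M ≠ ∞) ∧
    ∫⁻ M, ENNReal.ofReal (((D.primSum (B.indicator 1) M).toReal -
        (volume B / D.zeta (n + 3)).toReal) ^ 2) ∂(D.weightMeasure (n + 3) E) ≤
      D.detMeasure (n + 3) E * (D.parSum B / D.zeta (n + 3)) := by
  have hg : Measurable (B.indicator (1 : (Fin (n + 3) → A) → ℝ≥0∞)) := measurable_one.indicator hB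
  have hN := D.measurable_primSum hg
  have h1 := D.lintegral_primSum hE hg
  rw [lintegral_indicator_one hB] at h1
  set W := D.detMeasure (n + 3) E
  set c := volume B / D.zeta (n + 3)
  have hW : W ≠ ∞ := D.detMeasure_ne_top hE
  have hc : c ≠ ∞ := ENNReal.div_ne_top hfin (D.zeta_ne_zero _)
  have hae : ∀ᵐ M ∂(D.weightMeasure (n + 3) E), D.primSum (B.indicator 1) M ≠ ∞ := by
    filter_upwards [ae_lt_top hN (by rw [h1]; exact ENNReal.mul_ne_top hW hc)] with M hM
    exact hM.ne
  refine ⟨hae, ?_⟩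
  have h2 : ∀ᵐ M ∂(D.weightMeasure (n + 3) E),
      ENNReal.ofReal (((D.primSum (B.indicator 1) M).toReal - c.toReal) ^ 2) +
        2 * c * D.primSum (B.indicator 1) M = D.primSum (B.indicator 1) M ^ 2 + c ^ 2 := by
    filter_upwards [hae] with M hM
    lift D.primSum (B.indicator 1) M to NNReal using hM with x
    lift c to NNReal using hc with c
    have h3 : (2 : ℝ≥0∞) * c * x = ENNReal.ofReal (2 * c * x) := by
      rw [ENNReal.ofReal_mul (by positivity), ENNReal.ofReal_mul (by positivity)]
      simp
    have h4 : (x : ℝ≥0∞) ^ 2 + (c : ℝ≥0∞) ^ 2 = ENNReal.ofReal ((x : ℝ) ^ 2 + (c : ℝ) ^ 2) := by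
      rw [ENNReal.ofReal_add (by positivity) (by positivity), ENNReal.ofReal_pow (by positivity),
        ENNReal.ofReal_pow (by positivity)]
      simp
    rw [h3, h4, ← ENNReal.ofReal_add (by positivity) (by positivity)]
    congr 1
    simp only [ENNReal.coe_toReal]
    ring
  have h3 := lintegral_congr_ae h2
  rw [lintegral_add_right _ (hN.const_mul _), lintegral_const_mul _ hN, h1,
    lintegral_add_right _ measurable_const, lintegral_const, D.weightMeasure_univ hE.measurableSet] at h3
  have h4 := D.lintegral_primSum_sq_le hE hB hfin
  refine (ENNReal.add_le_add_iff_right (a := 2 * c * (W * c)) ?_).mp ?_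
  · finiteness
  · rw [h3]
    calc _ ≤ W * c ^ 2 + W * (D.parSum B / D.zeta (n + 3)) + c ^ 2 * W := by gcongr
      _ = _ := by ring

end ArithRing

/-- The sum of squared increments of a sequence over dyadic intervals in `[0, 2^K]`. -/
def dyadicSq : ℕ → (ℕ → ℝ) → ℝ
  | 0, x => (x 1 - x 0) ^ 2
  | K + 1, x => (∑ m ∈ Finset.range (2 ^ (K + 1)), (x (m + 1) - x m) ^ 2) +
      dyadicSq K fun m => x (2 * m)

lemma dyadicSq_nonneg (K : ℕ) (x : ℕ → ℝ) : 0 ≤ dyadicSq K x := by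
  induction K generalizing x with
  | zero => exact sq_nonneg _
  | succ K ih => exact add_nonneg (Finset.sum_nonneg fun _ _ => sq_nonneg _) (ih _)

lemma sq_sub_le_dyadicSq (K : ℕ) (x : ℕ → ℝ) {j : ℕ} (hj : j ≤ 2 ^ K) :
    (x j - x 0) ^ 2 ≤ (K + 1) * dyadicSq K x := by
  induction K generalizing x j with
  | zero =>
    interval_cases j
    · simpa using dyadicSq_nonneg 0 x
    · simp [dyadicSq]
  | succ K ih =>
    have h1 := ih (fun m => x (2 * m)) (j := j / 2) (by rw [pow_succ] at hj; omega)
    simp only [mul_zero] at h1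
    simp only [dyadicSq]
    set R := ∑ m ∈ Finset.range (2 ^ (K + 1)), (x (m + 1) - x m) ^ 2
    set S := dyadicSq K fun m => x (2 * m)
    have h2 : (x j - x (2 * (j / 2))) ^ 2 ≤ R := by
      rcases Nat.even_or_odd' j with ⟨m, hm | hm⟩
      · have : 2 * (j / 2) = j := by omega
        rw [this, sub_self, zero_pow two_ne_zero]
        exact Finset.sum_nonneg fun _ _ => sq_nonneg _
      · have h3 : 2 * (j / 2) = 2 * m := by omega
        rw [h3, hm]
        exact Finset.single_le_sum (f := fun m => (x (m + 1) - x m) ^ 2)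
          (fun _ _ => sq_nonneg _) (Finset.mem_range.mpr (by omega))
    set a := x j - x (2 * (j / 2))
    set b := x (2 * (j / 2)) - x 0
    have h4 : x j - x 0 = a + b := by simp only [a, b]; ring
    rw [h4]
    push_cast
    have hK : (0 : ℝ) < K + 1 := by positivity
    have h5 : (a + b) ^ 2 * (K + 1) ≤ (K + 1 + 1) * ((K + 1) * a ^ 2 + b ^ 2) := by
      nlinarith [sq_nonneg ((K + 1) * a - b)]
    have h6 : (K + 1 + 1) * ((K + 1) * a ^ 2 + b ^ 2) ≤
        (K + 1 + 1) * ((K + 1) * R + (K + 1) * S) := by gcongr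
    refine le_of_mul_le_mul_right (h5.trans (h6.trans (le_of_eq ?_))) hK
    ring

lemma measurable_dyadicSq {Ω : Type*} [MeasurableSpace Ω] (K : ℕ) {X : ℕ → Ω → ℝ}
    (hX : ∀ j, Measurable (X j)) : Measurable fun ω => dyadicSq K fun j => X j ω := by
  induction K generalizing X with
  | zero => exact ((hX 1).sub (hX 0)).pow_const 2
  | succ K ih =>
    exact (Finset.measurable_fun_sum _ fun m _ => ((hX (m + 1)).sub (hX m)).pow_const 2).add
      (ih fun j => hX (2 * j))

lemma lintegral_dyadicSq_le {Ω : Type*} [MeasurableSpace Ω] {μ : Measure Ω} (K : ℕ)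
    {X : ℕ → Ω → ℝ} (hX : ∀ j, Measurable (X j)) {c : ℝ≥0∞}
    (h : ∀ a b, a ≤ b → ∫⁻ ω, ENNReal.ofReal ((X b ω - X a ω) ^ 2) ∂μ ≤ c * ((b - a : ℕ) : ℝ≥0∞)) :
    ∫⁻ ω, ENNReal.ofReal (dyadicSq K fun j => X j ω) ∂μ ≤ (K + 1) * c * 2 ^ K := by
  induction K generalizing X c with
  | zero => simpa [dyadicSq] using h 0 1 zero_le_one
  | succ K ih =>
    simp only [dyadicSq]
    have h1 := ih (X := fun j => X (2 * j)) (c := 2 * c) (fun j => hX _) fun a b hab => by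
      refine (h (2 * a) (2 * b) (by omega)).trans (le_of_eq ?_)
      rw [← Nat.mul_sub]
      push_cast
      ring
    have hm : ∀ m, Measurable fun ω => ENNReal.ofReal ((X (m + 1) ω - X m ω) ^ 2) := fun m =>
      (((hX (m + 1)).sub (hX m)).pow_const 2).ennreal_ofReal
    have h2 : ∀ ω, ENNReal.ofReal ((∑ m ∈ Finset.range (2 ^ (K + 1)), (X (m + 1) ω - X m ω) ^ 2) +
        dyadicSq K fun m => X (2 * m) ω) =
        (∑ m ∈ Finset.range (2 ^ (K + 1)), ENNReal.ofReal ((X (m + 1) ω - X m ω) ^ 2)) +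
          ENNReal.ofReal (dyadicSq K fun m => X (2 * m) ω) := fun ω => by
      rw [ENNReal.ofReal_add (Finset.sum_nonneg fun _ _ => sq_nonneg _) (dyadicSq_nonneg _ _),
        ENNReal.ofReal_sum_of_nonneg fun _ _ => sq_nonneg _]
    simp_rw [h2]
    rw [lintegral_add_right _ (measurable_dyadicSq K fun j => hX (2 * j)).ennreal_ofReal,
      lintegral_finsetSum _ fun m _ => hm m]
    have h3 : ∑ m ∈ Finset.range (2 ^ (K + 1)), ∫⁻ ω, ENNReal.ofReal ((X (m + 1) ω - X m ω) ^ 2) ∂μ ≤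
        ∑ m ∈ Finset.range (2 ^ (K + 1)), c := Finset.sum_le_sum fun m _ => by
      simpa using h m (m + 1) (Nat.le_succ m)
    refine (add_le_add h3 h1).trans (le_of_eq ?_)
    rw [Finset.sum_const, Finset.card_range, nsmul_eq_mul]
    push_cast
    ring

lemma summable_pow_mul_two_rpow {δ : ℝ} (hδ : 1 / 2 < δ) (s : ℕ) :
    Summable fun K : ℕ => ((K : ℝ) + 1) ^ s * ((2 : ℝ) ^ (1 - 2 * δ)) ^ K := by
  have hr : (2 : ℝ) ^ (1 - 2 * δ) < 1 := Real.rpow_lt_one_of_one_lt_of_neg one_lt_two (by linarith)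
  have hr0 : (0 : ℝ) < (2 : ℝ) ^ (1 - 2 * δ) := by positivity
  have h1 := (summable_nat_add_iff 1).mpr (summable_pow_mul_geometric_of_norm_lt_one s
    (r := (2 : ℝ) ^ (1 - 2 * δ)) (by rwa [Real.norm_of_nonneg hr0.le]))
  refine (h1.mul_left ((2 : ℝ) ^ (1 - 2 * δ))⁻¹).congr fun K => ?_
  push_cast
  rw [pow_succ]
  field_simp

/-- A maximal inequality of Rademacher–Menshov–Schmidt type. -/
lemma ae_exists_sq_le_of_lintegral_sq_le {Ω : Type*} [MeasurableSpace Ω] {μ : Measure Ω} {s : ℕ}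
    {X : (Fin s → ℕ) → ℕ → Ω → ℝ} (hX : ∀ z j, Measurable (X z j)) {c : ℝ≥0∞} (hc : c ≠ ∞)
    (h : ∀ z a b, a ≤ b → ∫⁻ ω, ENNReal.ofReal ((X z b ω - X z a ω) ^ 2) ∂μ ≤
      c * ((b - a : ℕ) : ℝ≥0∞)) {δ : ℝ} (hδ : 1 / 2 < δ) :
    ∀ᵐ ω ∂μ, ∃ C : ℝ, 0 < C ∧ ∀ (K : ℕ) (z : Fin s → ℕ), (∀ i, z i ≤ K) → ∀ j ≤ 2 ^ K,
      |X z j ω - X z 0 ω| ≤ C * ((2 : ℝ) ^ K) ^ δ := by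
  classical
  let F : ℕ → Ω → ℝ≥0∞ := fun K ω => ∑ z ∈ Fintype.piFinset fun _ : Fin s => Finset.range (K + 1),
    (ENNReal.ofReal (((K : ℝ) + 1) * (((2 : ℝ) ^ (2 * δ)) ^ K)⁻¹)) *
      ENNReal.ofReal (dyadicSq K fun j => X z j ω)
  have hFm : ∀ K, Measurable (F K) := fun K => Finset.measurable_fun_sum _ fun z _ =>
    (measurable_dyadicSq K (hX z)).ennreal_ofReal.const_mul _
  have hFi : ∀ K, ∫⁻ ω, F K ω ∂μ ≤
      c * ENNReal.ofReal (((K : ℝ) + 1) ^ (s + 2) * ((2 : ℝ) ^ (1 - 2 * δ)) ^ K) := by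
    intro K
    simp only [F]
    rw [lintegral_finsetSum _ fun z _ => (measurable_dyadicSq K (hX z)).ennreal_ofReal.const_mul _]
    refine (Finset.sum_le_sum (g := fun _ => ENNReal.ofReal (((K : ℝ) + 1) *
      (((2 : ℝ) ^ (2 * δ)) ^ K)⁻¹) * ((K + 1) * c * 2 ^ K)) fun z _ => ?_).trans (le_of_eq ?_)
    · rw [lintegral_const_mul _ (measurable_dyadicSq K (hX z)).ennreal_ofReal]
      gcongr
      exact lintegral_dyadicSq_le K (hX z) (h z)
    · rw [Finset.sum_const, Fintype.card_piFinset]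
      simp only [Finset.card_range, Finset.prod_const, Finset.card_univ, Fintype.card_fin]
      rw [nsmul_eq_mul]
      have h2 : ((K : ℝ≥0∞) + 1) = ENNReal.ofReal ((K : ℝ) + 1) := by
        rw [ENNReal.ofReal_add (by positivity) zero_le_one]; simp
      have h3 : (2 : ℝ≥0∞) = ENNReal.ofReal 2 := by simp
      push_cast
      rw [h2, h3, ← ENNReal.ofReal_pow (by positivity), ← ENNReal.ofReal_pow (by positivity)]
      have h4 : ∀ x y z w : ℝ≥0∞, x * (y * (z * c * w)) = c * (x * (y * (z * w))) := by
        intros; ring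
      rw [h4, ← ENNReal.ofReal_mul (by positivity), ← ENNReal.ofReal_mul (by positivity),
        ← ENNReal.ofReal_mul (by positivity)]
      congr 2
      rw [Real.rpow_sub two_pos, Real.rpow_one, div_pow, div_eq_mul_inv]
      ring
  have hsum : ∫⁻ ω, ∑' K, F K ω ∂μ ≠ ∞ := by
    rw [lintegral_tsum fun K => (hFm K).aemeasurable]
    refine ne_top_of_le_ne_top ?_ (ENNReal.tsum_le_tsum hFi)
    rw [ENNReal.tsum_mul_left]
    exact ENNReal.mul_ne_top hc (summable_pow_mul_two_rpow hδ (s + 2)).tsum_ofReal_ne_top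
  filter_upwards [ae_lt_top (Measurable.tsum hFm) hsum] with ω hω
  set T := ∑' K, F K ω
  refine ⟨Real.sqrt T.toReal + 1, by positivity, fun K z hz j hj => ?_⟩
  have h1 : ENNReal.ofReal (((K : ℝ) + 1) * (((2 : ℝ) ^ (2 * δ)) ^ K)⁻¹) *
      ENNReal.ofReal (dyadicSq K fun j => X z j ω) ≤ T := by
    refine le_trans ?_ (ENNReal.le_tsum K)
    exact Finset.single_le_sum (f := fun z => ENNReal.ofReal (((K : ℝ) + 1) *
      (((2 : ℝ) ^ (2 * δ)) ^ K)⁻¹) * ENNReal.ofReal (dyadicSq K fun j => X z j ω))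
      (fun _ _ => zero_le) (Fintype.mem_piFinset.mpr fun i => Finset.mem_range.mpr
        (Nat.lt_succ_of_le (hz i)))
  rw [← ENNReal.ofReal_mul (by positivity), ENNReal.ofReal_le_iff_le_toReal hω.ne] at h1
  have h2 := sq_sub_le_dyadicSq K (fun j => X z j ω) hj
  have h4 : (X z j ω - X z 0 ω) ^ 2 ≤ T.toReal * ((2 : ℝ) ^ (2 * δ)) ^ K := by
    refine h2.trans ?_
    rw [mul_right_comm, ← div_eq_mul_inv, div_le_iff₀ (by positivity)] at h1
    exact h1
  have h5 : ((2 : ℝ) ^ (2 * δ)) ^ K = (((2 : ℝ) ^ K) ^ δ) ^ 2 := by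
    rw [← Real.rpow_natCast, ← Real.rpow_natCast, ← Real.rpow_natCast, ← Real.rpow_mul (by norm_num),
      ← Real.rpow_mul (by norm_num), ← Real.rpow_mul (by norm_num)]
    congr 1
    push_cast
    ring
  rw [h5] at h4
  have h6 : |X z j ω - X z 0 ω| ≤ Real.sqrt T.toReal * ((2 : ℝ) ^ K) ^ δ := by
    rw [← Real.sqrt_sq (show (0 : ℝ) ≤ ((2 : ℝ) ^ K) ^ δ by positivity), ← Real.sqrt_mul
      ENNReal.toReal_nonneg]
    exact Real.abs_le_sqrt h4
  refine h6.trans ?_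
  gcongr
  linarith

/-- A variance bound on increments gives an almost sure asymptotic count. -/
lemma ae_exists_count_bound {Ω : Type*} [MeasurableSpace Ω] {μ : Measure Ω} {s : ℕ}
    {N : (Fin s → ℕ) → ℝ → Ω → ℝ≥0∞} (hN : ∀ z (j : ℕ), Measurable (N z j))
    (hmono : ∀ z ω a b, 0 ≤ a → a ≤ b → N z a ω ≤ N z b ω) (hzero : ∀ z ω, N z 0 ω = 0)
    (hfin : ∀ z (j : ℕ), ∀ᵐ ω ∂μ, N z j ω ≠ ∞) {θ : ℝ} (hθ : 0 ≤ θ) {c : ℝ≥0∞} (hc : c ≠ ∞)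
    (hvar : ∀ z (a b : ℕ), a ≤ b → ∫⁻ ω, ENNReal.ofReal (((N z b ω).toReal - (N z a ω).toReal -
      θ * ((b : ℝ) - a)) ^ 2) ∂μ ≤ c * ((b - a : ℕ) : ℝ≥0∞)) {δ : ℝ} (hδ : 1 / 2 < δ) :
    ∀ᵐ ω ∂μ, ∃ C : ℝ, 0 < C ∧ ∀ (z : Fin s → ℕ) (v : ℝ), 1 ≤ v → (∀ i, (2 : ℝ) ^ z i ≤ v) →
      N z v ω ≤ ENNReal.ofReal (θ * v + C * v ^ δ) ∧
        ENNReal.ofReal (θ * v - C * v ^ δ) ≤ N z v ω := by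
  have h1 := ae_exists_sq_le_of_lintegral_sq_le (μ := μ)
    (X := fun z j ω => (N z j ω).toReal - θ * j)
    (fun z j => (hN z j).ennreal_toReal.sub_const _) hc (fun z a b hab => by
      refine le_trans (le_of_eq (lintegral_congr fun ω => ?_)) (hvar z a b hab)
      congr 2
      ring) hδ
  have h2 : ∀ᵐ ω ∂μ, ∀ z (j : ℕ), N z j ω ≠ ∞ := ae_all_iff.mpr fun z => ae_all_iff.mpr (hfin z)
  filter_upwards [h1, h2] with ω ⟨C, hC, h⟩ hfin
  refine ⟨C * 4 ^ δ + θ, by positivity, fun z v hv hz => ?_⟩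
  have hv0 : (0 : ℝ) ≤ v := by linarith
  have hδ0 : 0 ≤ δ := by linarith
  set j := ⌊v⌋₊
  have hj1 : (j : ℝ) ≤ v := Nat.floor_le hv0
  have hj2 : v < j + 1 := Nat.lt_floor_add_one v
  have hj3 : 1 ≤ j := Nat.one_le_floor_iff v |>.mpr hv
  set K := Nat.clog 2 (j + 1)
  have hK1 : j + 1 ≤ 2 ^ K := Nat.le_pow_clog one_lt_two _
  have hK2 : 2 ^ K ≤ 4 * j := by
    have h3 : 2 ^ (K - 1) < j + 1 := Nat.pow_pred_clog_lt_self one_lt_two (by omega)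
    have h4 : 0 < K := Nat.clog_pos one_lt_two (by omega)
    have h5 : 2 ^ K = 2 * 2 ^ (K - 1) := by
      rw [← pow_succ']
      congr 1
      omega
    omega
  have hzK : ∀ i, z i ≤ K := fun i => by
    have h3 : (2 : ℝ) ^ z i < 2 ^ K := by
      refine (hz i).trans_lt (hj2.trans_le ?_)
      exact_mod_cast hK1
    exact ((pow_lt_pow_iff_right₀ (one_lt_two (α := ℝ))).mp h3).le
  have hpow : ((2 : ℝ) ^ K) ^ δ ≤ 4 ^ δ * v ^ δ := by
    rw [← Real.mul_rpow (by norm_num) hv0]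
    refine Real.rpow_le_rpow (by positivity) ?_ hδ0
    refine le_trans (b := 4 * (j : ℝ)) (by exact_mod_cast hK2) (by linarith)
  have hvδ : 1 ≤ v ^ δ := Real.one_le_rpow hv hδ0
  have key : ∀ i : ℕ, i ≤ 2 ^ K → |(N z (i : ℝ) ω).toReal - θ * i| ≤ C * 4 ^ δ * v ^ δ := fun i hi => by
    have h3 := h K z hzK i hi
    simp only [Nat.cast_zero, hzero, ENNReal.toReal_zero, mul_zero, sub_zero] at h3
    refine h3.trans ?_
    rw [mul_assoc]
    gcongr
  constructor
  · have h3 := (abs_le.mp (key (j + 1) hK1)).2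
    refine (hmono z ω v ((j + 1 : ℕ) : ℝ) hv0 (by push_cast; exact hj2.le)).trans ?_
    rw [← ENNReal.ofReal_toReal (hfin z (j + 1))]
    refine ENNReal.ofReal_le_ofReal ?_
    push_cast at h3 ⊢
    nlinarith [mul_le_mul_of_nonneg_left hj1 hθ, mul_le_mul_of_nonneg_left hvδ hθ]
  · have h3 := (abs_le.mp (key j (by omega))).1
    refine le_trans ?_ (hmono z ω (j : ℝ) v (by positivity) hj1)
    rw [← ENNReal.ofReal_toReal (hfin z j)]
    refine ENNReal.ofReal_le_ofReal ?_
    nlinarith [mul_le_mul_of_nonneg_left hj2.le hθ, mul_le_mul_of_nonneg_left hvδ hθ]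

namespace ArithRing

variable {A O : Type} [NormedCommRing A] [ProperSpace A] [MeasureSpace A] [BorelSpace A]
  [(volume : Measure A).IsAddHaarMeasure] [CommRing O] (D : ArithRing A O) [CompleteSpace A]
  [Countable O]

lemma parSum_add_le {n : ℕ} {B₁ B₂ : Set (Fin n → A)} (h1 : MeasurableSet B₁)
    (hd : Disjoint B₁ B₂) : D.parSum B₁ + D.parSum B₂ ≤ D.parSum (B₁ ∪ B₂) := by
  unfold parSum
  rw [← ENNReal.tsum_add]
  refine ENNReal.tsum_le_tsum fun o => ?_
  have hm : Measurable fun x : Fin n → A => D.ι o.1 • x := (continuous_const_smul _).measurable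
  rw [← measure_union' (hd.mono Set.inter_subset_left Set.inter_subset_left) (h1.inter (hm h1))]
  refine measure_mono (Set.union_subset ?_ ?_)
  · exact Set.inter_subset_inter Set.subset_union_left (Set.preimage_mono Set.subset_union_left)
  · exact Set.inter_subset_inter Set.subset_union_right (Set.preimage_mono Set.subset_union_right)

lemma primSum_indicator_add {n : ℕ} {B₁ B₂ : Set (Fin (n + 1) → A)} (hd : Disjoint B₁ B₂)
    (M : Matrix (Fin (n + 1)) (Fin (n + 1)) A) :
    D.primSum ((B₁ ∪ B₂).indicator 1) M =
      D.primSum (B₁.indicator 1) M + D.primSum (B₂.indicator 1) M := by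
  unfold primSum
  rw [← ENNReal.tsum_add]
  refine tsum_congr fun p => ?_
  rw [Set.indicator_union_of_disjoint hd]

lemma primSum_mono {n : ℕ} {B₁ B₂ : Set (Fin (n + 1) → A)} (h : B₁ ⊆ B₂)
    (M : Matrix (Fin (n + 1)) (Fin (n + 1)) A) :
    D.primSum (B₁.indicator 1) M ≤ D.primSum (B₂.indicator 1) M :=
  ENNReal.tsum_le_tsum fun _ => Set.indicator_le_indicator_of_subset h (fun _ => zero_le) _

/-- Right multiplication by `γ` permutes the primitive rows. -/
def primRowsEquiv {n : ℕ} (γ : SpecialLinearGroup (Fin (n + 1)) O) :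
    primRows O n ≃ primRows O n where
  toFun p := ⟨p.1 ᵥ* γ.1, by
    obtain ⟨p, γ', rfl⟩ := p
    exact ⟨γ' * γ, rfl⟩⟩
  invFun p := ⟨p.1 ᵥ* (γ⁻¹).1, by
    obtain ⟨p, γ', rfl⟩ := p
    exact ⟨γ' * γ⁻¹, rfl⟩⟩
  left_inv p := Subtype.ext (vecMul_vecMul_cancel (mul_inv_cancel γ) p.1)
  right_inv p := Subtype.ext (vecMul_vecMul_cancel (inv_mul_cancel γ) p.1)

lemma primSum_mat_mul {n : ℕ} (g : (Fin (n + 1) → A) → ℝ≥0∞)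
    (γ : SpecialLinearGroup (Fin (n + 1)) O) (M : Matrix (Fin (n + 1)) (Fin (n + 1)) A) :
    D.primSum g (D.mat γ * M) = D.primSum g M := by
  unfold primSum
  rw [← (primRowsEquiv γ).tsum_eq fun p : primRows O n =>
    g (D.vec p.1 ᵥ* (M * diagCons (Ring.inverse M.det)))]
  refine tsum_congr fun p => ?_
  rw [det_mul, det_mat, one_mul, Matrix.mul_assoc, ← vecMul_vecMul]
  congr 2
  funext j
  simp [primRowsEquiv, vec, mat, vecMul, dotProduct]

/-- A statement invariant under the lattice group that holds almost everywhere for the weighted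
measure holds almost everywhere. -/
lemma ae_of_ae_weightMeasure {n : ℕ} {E : Set A} (hE : D.IsBase E)
    {P : Matrix (Fin (n + 1)) (Fin (n + 1)) A → Prop}
    (hP : ∀ (γ : SpecialLinearGroup (Fin (n + 1)) O) M, P (D.mat γ * M) ↔ P M)
    (h : ∀ᵐ M ∂(D.weightMeasure (n + 1) E), P M) :
    ∀ᵐ M ∂((volume : Measure (Matrix (Fin (n + 1)) (Fin (n + 1)) A)).restrict {M | M.det ∈ E}),
      P M := by
  have hE' : MeasurableSet {M : Matrix (Fin (n + 1)) (Fin (n + 1)) A | M.det ∈ E} :=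
    measurable_det hE.measurableSet
  unfold weightMeasure at h
  rw [ae_restrict_iff' hE', ae_withDensity_iff (D.measurable_weight _)] at h
  rw [ae_restrict_iff' hE']
  have h1 : ∀ᵐ M : Matrix (Fin (n + 1)) (Fin (n + 1)) A,
      ∀ γ : SpecialLinearGroup (Fin (n + 1)) O, D.weight (n + 1) (D.mat γ * M) ≠ 0 →
        (D.mat γ * M).det ∈ E → P (D.mat γ * M) := by
    rw [ae_all_iff]
    intro γ
    exact (D.measurePreserving_mul_left (D.det_mat γ)).quasiMeasurePreserving.ae h
  filter_upwards [h1] with M hM hdet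
  by_contra hcon
  have h2 := D.tsum_weight (hE.isUnit _ hdet)
  have h3 : ∀ γ, D.weight (n + 1) (D.mat γ * M) = 0 := fun γ => by
    by_contra h4
    have h5 := hM γ h4
    rw [det_mul, det_mat, one_mul] at h5
    exact hcon ((hP γ M).mp (h5 hdet))
  simp [h3] at h2

/-- Almost every unimodular lattice has the expected number of primitive vectors in every member of
a family of sets increasing with the volume. -/
theorem ae_primSum_bound {n s : ℕ} {E : Set A} (hE : D.IsBase E)
    {U : (Fin s → ℕ) → ℝ → Set (Fin (n + 3) → A)} (hU : ∀ z v, MeasurableSet (U z v))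
    (hvol : ∀ z v, 0 ≤ v → volume (U z v) = ENNReal.ofReal v) {κ : ℝ≥0∞} (hκ : κ ≠ ∞)
    (hpar : ∀ z v, 0 ≤ v → D.parSum (U z v) = κ * ENNReal.ofReal v)
    (hmono : ∀ z a b, 0 ≤ a → a ≤ b → U z a ⊆ U z b) (hzero : ∀ z, U z 0 = ∅)
    {δ : ℝ} (hδ : 1 / 2 < δ) :
    ∀ᵐ M ∂((volume : Measure (Matrix (Fin (n + 3)) (Fin (n + 3)) A)).restrict {M | M.det ∈ E}),
      ∃ C : ℝ, 0 < C ∧ ∀ (z : Fin s → ℕ) (v : ℝ), 1 ≤ v → (∀ i, (2 : ℝ) ^ z i ≤ v) →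
        D.primSum ((U z v).indicator 1) M ≤
          ENNReal.ofReal ((D.zeta (n + 3))⁻¹.toReal * v + C * v ^ δ) ∧
        ENNReal.ofReal ((D.zeta (n + 3))⁻¹.toReal * v - C * v ^ δ) ≤
          D.primSum ((U z v).indicator 1) M := by
  refine D.ae_of_ae_weightMeasure hE (fun γ M => by simp only [primSum_mat_mul]) ?_
  have hz0 : D.zeta (n + 3) ≠ 0 := D.zeta_ne_zero _
  refine ae_exists_count_bound (N := fun z v M => D.primSum ((U z v).indicator 1) M)
    (c := D.detMeasure (n + 3) E * (κ / D.zeta (n + 3)))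
    (fun z j => D.measurable_primSum (measurable_one.indicator (hU z j)))
    (fun z M a b ha hab => D.primSum_mono (hmono z a b ha hab) M)
    (fun z M => by simp [primSum, hzero]) (fun z j => (D.lintegral_primSum_sub_sq_le hE (hU z j)
      (by rw [hvol z _ (Nat.cast_nonneg j)]; exact ENNReal.ofReal_ne_top)).1)
    ENNReal.toReal_nonneg (ENNReal.mul_ne_top (D.detMeasure_ne_top hE) (ENNReal.div_ne_top hκ hz0))
    (fun z a b hab => ?_) hδ
  have ha0 : (0 : ℝ) ≤ a := Nat.cast_nonneg a
  have hb0 : (0 : ℝ) ≤ b := Nat.cast_nonneg b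
  have hab' : (a : ℝ) ≤ b := Nat.cast_le.mpr hab
  have hsub : U z a ⊆ U z b := hmono z a b ha0 hab'
  have hun : U z a ∪ (U z b \ U z a) = U z b := Set.union_sdiff_cancel hsub
  have hdis : Disjoint (U z a) (U z b \ U z a) := Set.disjoint_sdiff_right
  have hft : ∀ j : ℕ, volume (U z j) ≠ ∞ := fun j => by
    rw [hvol z _ (Nat.cast_nonneg j)]; exact ENNReal.ofReal_ne_top
  have hv : volume (U z b \ U z a) = ENNReal.ofReal ((b : ℝ) - a) := by
    rw [measure_sdiff hsub (hU z a).nullMeasurableSet (hft a), hvol z _ ha0, hvol z _ hb0,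
      ENNReal.ofReal_sub _ ha0]
  have hba : ENNReal.ofReal ((b : ℝ) - a) = ((b - a : ℕ) : ℝ≥0∞) := by
    rw [← Nat.cast_sub hab, ENNReal.ofReal_natCast]
  have hp : D.parSum (U z b \ U z a) ≤ κ * ENNReal.ofReal ((b : ℝ) - a) := by
    have h1 := D.parSum_add_le (hU z a) hdis
    rw [hun, hpar z _ ha0, hpar z _ hb0] at h1
    have h2 : ENNReal.ofReal (b : ℝ) = ENNReal.ofReal a + ENNReal.ofReal ((b : ℝ) - a) := by
      rw [← ENNReal.ofReal_add ha0 (by linarith)]; congr 1; ring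
    rw [h2, mul_add] at h1
    exact (ENNReal.add_le_add_iff_left (ENNReal.mul_ne_top hκ ENNReal.ofReal_ne_top)).mp h1
  have h3 := (D.lintegral_primSum_sub_sq_le hE ((hU z b).diff (hU z a))
    (by rw [hv]; exact ENNReal.ofReal_ne_top)).2
  have h4 := (D.lintegral_primSum_sub_sq_le hE (hU z b) (hft b)).1
  refine le_trans (le_of_eq (lintegral_congr_ae ?_)) (h3.trans ?_)
  · filter_upwards [h4] with M hM
    have h5 := D.primSum_indicator_add hdis M
    rw [hun] at h5
    rw [h5] at hM ⊢
    rw [ENNReal.toReal_add (ne_top_of_le_ne_top hM le_self_add)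
      (ne_top_of_le_ne_top hM le_add_self), hv, div_eq_mul_inv, ENNReal.toReal_mul,
      ENNReal.toReal_ofReal (by linarith)]
    congr 2
    ring
  · rw [mul_assoc, div_eq_mul_inv, div_eq_mul_inv, ← hba, mul_right_comm κ]
    gcongr

end ArithRing

section PadicMeasure

variable {p : ℕ} [Fact p.Prime]

/-- The Haar measure on `ℚ_[p]` giving `ℤ_[p]` measure one. -/
noncomputable instance Padic.instMeasureSpaceHaar : MeasureSpace ℚ_[p] :=
  ⟨Measure.addHaarMeasure ⟨⟨Metric.closedBall 0 1, isCompact_closedBall _ _⟩,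
    ⟨0, mem_interior_iff_mem_nhds.mpr (Metric.closedBall_mem_nhds _ one_pos)⟩⟩⟩

instance Padic.instIsAddHaarMeasureVolume : (volume : Measure ℚ_[p]).IsAddHaarMeasure := by
  change (Measure.addHaarMeasure _).IsAddHaarMeasure
  infer_instance

lemma Padic.volume_closedBall_one : volume (Metric.closedBall (0 : ℚ_[p]) 1) = 1 :=
  Measure.addHaarMeasure_self

open Metric in
lemma Padic.volume_smul_eq_mul (g : ℚ_[p]ˣ) (s : Set ℚ_[p]) :
    volume (g • s) = distribHaarChar ℚ_[p] g * volume s :=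
  (distribHaarChar_mul volume g s).symm

lemma Padic.smul_closedBall (g : ℚ_[p]ˣ) :
    g • Metric.closedBall (0 : ℚ_[p]) 1 = Metric.closedBall 0 ‖(g : ℚ_[p])‖ := by
  have := _root_.smul_closedBall' (c := (g : ℚ_[p])) g.ne_zero (0 : ℚ_[p]) 1
  rw [smul_zero, mul_one] at this
  exact this

lemma Padic.volume_closedBall_prime :
    (p : ℝ≥0∞) * volume (Metric.closedBall (0 : ℚ_[p]) ‖(p : ℚ_[p])‖) = 1 := by
  have hp := (Fact.out : p.Prime)
  rw [← Padic.volume_closedBall_one (p := p)]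
  have hnp : ‖(p : ℚ_[p])‖ < 1 := Padic.norm_p_lt_one
  have h1 : Metric.closedBall (0 : ℚ_[p]) 1 =
      ⋃ a : Fin p, ((a : ℕ) : ℚ_[p]) +ᵥ Metric.closedBall (0 : ℚ_[p]) ‖(p : ℚ_[p])‖ := by
    ext x
    simp only [Set.mem_iUnion, Set.mem_vadd_set_iff_neg_vadd_mem, mem_closedBall_zero_iff,
      vadd_eq_add]
    constructor
    · intro hx
      let y : ℤ_[p] := ⟨x, hx⟩
      refine ⟨⟨PadicInt.zmodRepr y, PadicInt.zmodRepr_lt_p y⟩, ?_⟩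
      have h2 := PadicInt.sub_zmodRepr_mem y
      rw [PadicInt.maximalIdeal_eq_span_p, ← pow_one (p : ℤ_[p]),
        ← PadicInt.norm_le_pow_iff_mem_span_pow, PadicInt.norm_def] at h2
      rw [Padic.norm_p, neg_add_eq_sub]
      rw [PadicInt.coe_sub, PadicInt.coe_natCast] at h2
      simpa only [Nat.cast_one, _root_.zpow_neg, zpow_one] using h2
    · rintro ⟨a, ha⟩
      have h2 : x = (a : ℕ) + (-((a : ℕ) : ℚ_[p]) + x) := by ring
      rw [h2]
      refine (Padic.nonarchimedean _ _).trans (max_le ?_ (ha.trans hnp.le))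
      exact_mod_cast Padic.norm_int_le_one (p := p) ((a : ℕ) : ℤ)
  have hdis : Pairwise (Function.onFun Disjoint fun a : Fin p =>
      ((a : ℕ) : ℚ_[p]) +ᵥ Metric.closedBall (0 : ℚ_[p]) ‖(p : ℚ_[p])‖) := by
    intro a b hab
    refine Set.disjoint_left.mpr fun x hx hx' => hab ?_
    simp only [Set.mem_vadd_set_iff_neg_vadd_mem, mem_closedBall_zero_iff, vadd_eq_add] at hx hx'
    have h2 : ‖(((a : ℕ) : ℤ) - ((b : ℕ) : ℤ) : ℚ_[p])‖ ≤ ‖(p : ℚ_[p])‖ := by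
      have h3 : (((a : ℕ) : ℤ) - ((b : ℕ) : ℤ) : ℚ_[p]) = (-((b : ℕ) : ℚ_[p]) + x) + -(-((a : ℕ) : ℚ_[p]) + x) := by
        push_cast; ring
      rw [h3]
      exact (Padic.nonarchimedean _ _).trans (max_le hx' (by rwa [norm_neg]))
    have h4 : ‖((((a : ℕ) : ℤ) - ((b : ℕ) : ℤ) : ℤ) : ℚ_[p])‖ < 1 := by
      push_cast at h2 ⊢
      exact h2.trans_lt hnp
    rw [Padic.norm_intCast_lt_one_iff] at h4
    have h5 := a.2
    have h6 := b.2
    have h7 := Int.eq_zero_of_abs_lt_dvd h4 (by rw [abs_lt]; omega)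
    exact Fin.ext (by omega)
  rw [h1, measure_iUnion hdis fun a => by
    simpa using (Metric.isClosed_closedBall (x := ((a : ℕ) : ℚ_[p])) (ε := ‖(p : ℚ_[p])‖)).measurableSet]
  simp only [measure_vadd, tsum_fintype, Finset.sum_const, Finset.card_univ, Fintype.card_fin,
    nsmul_eq_mul]

lemma Padic.distribHaarChar_eq (g : ℚ_[p]ˣ) : distribHaarChar ℚ_[p] g = ‖(g : ℚ_[p])‖₊ := by
  have hp := (Fact.out : p.Prime)
  have h1 : ∀ g : ℚ_[p]ˣ, (distribHaarChar ℚ_[p] g : ℝ≥0∞) =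
      volume (Metric.closedBall (0 : ℚ_[p]) ‖(g : ℚ_[p])‖) := fun g => by
    rw [← Padic.smul_closedBall, ← distribHaarChar_mul volume, Padic.volume_closedBall_one, mul_one]
  let π : ℚ_[p]ˣ := Units.mk0 (p : ℚ_[p]) (Nat.cast_ne_zero.mpr hp.ne_zero)
  have h2 : distribHaarChar ℚ_[p] π = (p : NNReal)⁻¹ := by
    have h3 := Padic.volume_closedBall_prime (p := p)
    rw [show (p : ℚ_[p]) = (π : ℚ_[p]) from rfl, ← h1] at h3
    refine eq_inv_of_mul_eq_one_right ?_
    exact_mod_cast h3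
  have h4 : ‖(g : ℚ_[p])‖ = ‖((π ^ (g : ℚ_[p]).valuation : ℚ_[p]ˣ) : ℚ_[p])‖ := by
    rw [Padic.norm_eq_zpow_neg_valuation g.ne_zero, Units.val_zpow_eq_zpow_val]
    simp [π]
  have h5 : distribHaarChar ℚ_[p] g =
      distribHaarChar ℚ_[p] (π ^ (g : ℚ_[p]).valuation) := by
    have h6 := h1 g
    rw [h4, ← h1] at h6
    exact_mod_cast h6
  rw [h5, map_zpow, h2]
  refine NNReal.coe_injective ?_
  rw [coe_nnnorm, Padic.norm_eq_zpow_neg_valuation g.ne_zero]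
  simp

lemma Padic.enorm_mul_volume_preimage {u : ℚ_[p]} (hu : u ≠ 0) (s : Set ℚ_[p]) :
    ‖u‖ₑ * volume ((fun x => u * x) ⁻¹' s) = volume s := by
  have h1 := Padic.volume_smul_eq_mul (Units.mk0 u hu) ((fun x => u * x) ⁻¹' s)
  rw [Padic.distribHaarChar_eq] at h1
  rw [show ‖u‖ₑ = (‖((Units.mk0 u hu : ℚ_[p]ˣ) : ℚ_[p])‖₊ : ℝ≥0∞) from rfl, ← h1]
  congr 1
  exact Set.image_preimage_eq s fun y => ⟨u⁻¹ * y, mul_inv_cancel_left₀ hu y⟩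

end PadicMeasure

section FieldMeasure

variable {K : Type} [Field K] [TopologicalSpace K] [IsTopologicalRing K] [MeasureSpace K]
  [BorelSpace K] [SecondCountableTopology K] [SigmaFinite (volume : Measure K)]
  [(volume : Measure K).IsAddLeftInvariant] {c : K →* ℝ≥0∞} {ι : Type} [Fintype ι] [DecidableEq ι]

lemma measurable_toLin' (M : Matrix ι ι K) : Measurable (toLin' M) :=
  (continuous_const.matrix_mulVec continuous_id (A := fun _ : ι → K => M)).measurable

lemma smul_map_diagonal_volume (hc : ∀ u : K, u ≠ 0 → ∀ s : Set K, MeasurableSet s →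
    c u * volume ((fun x => u * x) ⁻¹' s) = volume s) {D : ι → K} (h : det (diagonal D) ≠ 0) :
    c (det (diagonal D)) • Measure.map (toLin' (diagonal D)) volume =
      (volume : Measure (ι → K)) := by
  refine (Measure.pi_eq fun s hs => ?_).symm
  simp only [det_diagonal, Measure.coe_smul, smul_eq_mul, Pi.smul_apply]
  rw [Measure.map_apply (measurable_toLin' _) (MeasurableSet.univ_pi hs)]
  have : (Matrix.toLin' (diagonal D) ⁻¹' Set.pi Set.univ fun i : ι => s i) =
      Set.pi Set.univ fun i : ι => (D i * ·) ⁻¹' s i := by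
    ext f
    simp [diagonal_toLin']
  rw [this, volume_pi_pi, map_prod, ← Finset.prod_mul_distrib]
  rw [det_diagonal] at h
  exact Finset.prod_congr rfl fun i _ => hc _ (Finset.prod_ne_zero_iff.1 h i (Finset.mem_univ i)) _ (hs i)

lemma measurePreserving_transvectionStruct (t : TransvectionStruct ι K) :
    MeasurePreserving (toLin' t.toMatrix) := by
  have ht : Measurable (toLin' t.toMatrix) := measurable_toLin' _
  refine ⟨ht, ?_⟩
  refine (Measure.pi_eq fun s hs ↦ ?_).symm
  have h2s : MeasurableSet (Set.univ.pi s) := .pi Set.countable_univ fun i _ ↦ hs i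
  rw [← volume_pi_pi, ← lintegral_indicator_one h2s, ← lintegral_indicator_one h2s]
  rw [lintegral_map (measurable_one.indicator h2s) ht, volume_pi]
  refine lintegral_eq_of_lmarginal_eq {t.i} ((measurable_one.indicator h2s).comp ht)
    (measurable_one.indicator h2s) ?_
  simp_rw [lmarginal_singleton]
  ext x
  cases t with | mk t_i t_j t_hij t_c =>
  simp [transvection, single_mulVec, t_hij.symm, ← Function.update_add,
    lintegral_add_right_eq_self fun xᵢ ↦ Set.indicator (Set.univ.pi s) 1 (Function.update x t_i xᵢ)]

lemma smul_map_toLin'_volume (hc : ∀ u : K, u ≠ 0 → ∀ s : Set K, MeasurableSet s →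
    c u * volume ((fun x => u * x) ⁻¹' s) = volume s) {M : Matrix ι ι K} (hM : det M ≠ 0) :
    c (det M) • Measure.map (toLin' M) volume = (volume : Measure (ι → K)) := by
  apply diagonal_transvection_induction_of_det_ne_zero (P := fun M : Matrix ι ι K =>
    c (det M) • Measure.map (toLin' M) volume = (volume : Measure (ι → K))) M hM
  · intro D hD
    exact smul_map_diagonal_volume hc hD
  · intro t
    rw [Matrix.TransvectionStruct.det, map_one, one_smul,
      (measurePreserving_transvectionStruct _).map_eq]
  · intro A B _ _ IHA IHB
    rw [toLin'_mul, det_mul, LinearMap.coe_comp, ← Measure.map_map (measurable_toLin' _)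
      (measurable_toLin' _), map_mul, mul_smul, ← Measure.map_smul, IHB, IHA]

lemma measurePreserving_vecMul_of_det_eq_one (hc : ∀ u : K, u ≠ 0 → ∀ s : Set K, MeasurableSet s →
    c u * volume ((fun x => u * x) ⁻¹' s) = volume s) {M : Matrix ι ι K} (hM : det M = 1) :
    MeasurePreserving (fun x : ι → K => x ᵥ* M) := by
  have h1 := smul_map_toLin'_volume hc (M := Mᵀ) (by rw [det_transpose, hM]; exact one_ne_zero)
  rw [det_transpose, hM, map_one, one_smul] at h1
  have h2 : (fun x : ι → K => x ᵥ* M) = toLin' Mᵀ := by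
    funext x
    rw [toLin'_apply, mulVec_transpose]
  rw [h2]
  exact ⟨measurable_toLin' _, h1⟩

end FieldMeasure

namespace PrimeTup

variable (S : PrimeTup)

/-- The ring `ℚ_S = ℝ × ∏ᵢ ℚ_{pᵢ}`. -/
abbrev AS : Type := ℝ × (∀ i : Fin S.s, S.Qp i)

instance : (volume : Measure (∀ i : Fin S.s, S.Qp i)).IsAddHaarMeasure := inferInstance
instance : (volume : Measure S.AS).IsAddHaarMeasure := Measure.prod.instIsAddHaarMeasure _ _
instance (d : ℕ) : (volume : Measure (Fin d → S.AS)).IsAddHaarMeasure :=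
  Measure.instIsAddHaarMeasureForallVolumeOfMeasurableAddOfSigmaFinite
instance (d : ℕ) : (volume : Measure (∀ i : Fin S.s, Fin d → S.Qp i)).IsAddHaarMeasure :=
  Measure.instIsAddHaarMeasureForallVolumeOfMeasurableAddOfSigmaFinite
instance (d : ℕ) : (volume : Measure (S.QS d)).IsAddHaarMeasure := Measure.prod.instIsAddHaarMeasure _ _

/-- The identification of vectors over `ℚ_S` with tuples of local vectors. -/
def coordEquiv (d : ℕ) : (Fin d → S.AS) ≃ₜ+ S.QS d where
  toFun x := (fun j => (x j).1, fun i j => (x j).2 i)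
  invFun y := fun j => (y.1 j, fun i => y.2 i j)
  left_inv _ := rfl
  right_inv _ := rfl
  map_add' _ _ := rfl
  continuous_toFun := by fun_prop
  continuous_invFun := by fun_prop

lemma _root_.MeasureTheory.Measure.addHaar_eq_of_measure_eq {V : Type*} [AddCommGroup V]
    [TopologicalSpace V] [IsTopologicalAddGroup V] [MeasurableSpace V] [BorelSpace V]
    [LocallyCompactSpace V] [SecondCountableTopology V] (μ ν : Measure V) [μ.IsAddHaarMeasure]
    [ν.IsAddHaarMeasure] {s : Set V} (h : μ s = ν s) (h0 : ν s ≠ 0) (ht : ν s ≠ ∞) : μ = ν := by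
  have h1 := Measure.isAddLeftInvariant_eq_smul μ ν
  have h2 : (Measure.addHaarScalarFactor μ ν : ℝ≥0∞) * ν s = 1 * ν s := by
    rw [one_mul]
    refine Eq.trans ?_ h
    conv_rhs => rw [h1]
    rfl
  have h3 := (ENNReal.mul_left_inj h0 ht).mp h2
  rw [h1, ENNReal.coe_eq_one.mp h3, one_smul]

/-- The fundamental box `[0,1) × ∏ᵢ ℤ_{pᵢ}` of `ℤ_S` in `ℚ_S`. -/
def box : Set S.AS := Set.Ico 0 1 ×ˢ Set.univ.pi fun _ => Metric.closedBall 0 1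

lemma measurableSet_box : MeasurableSet S.box :=
  measurableSet_Ico.prod (MeasurableSet.univ_pi fun _ => measurableSet_closedBall)

lemma volume_box : volume S.box = 1 := by
  rw [box, Measure.volume_eq_prod, Measure.prod_prod, volume_pi_pi]
  simp [Padic.volume_closedBall_one]

lemma measurePreserving_coordEquiv (d : ℕ) : MeasurePreserving (S.coordEquiv d) := by
  have hm : Measurable (S.coordEquiv d) := (S.coordEquiv d).continuous.measurable
  refine ⟨hm, ?_⟩
  have : (Measure.map (S.coordEquiv d) volume).IsAddHaarMeasure :=
    (S.coordEquiv d).isAddHaarMeasure_map volume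
  have h1 : (volume : Measure (S.QS d)) ((Set.univ.pi fun _ => Set.Ico 0 1) ×ˢ
      Set.univ.pi fun _ => Set.univ.pi fun _ => Metric.closedBall 0 1) = 1 := by
    rw [Measure.volume_eq_prod, Measure.prod_prod, volume_pi_pi, volume_pi_pi]
    simp [Padic.volume_closedBall_one, volume_pi_pi]
  refine Measure.addHaar_eq_of_measure_eq _ _ (s := (Set.univ.pi fun _ => Set.Ico 0 1) ×ˢ
    Set.univ.pi fun _ => Set.univ.pi fun _ => Metric.closedBall 0 1) ?_ (by simp [h1])
    (by simp [h1])
  rw [h1, Measure.map_apply (f := S.coordEquiv d) hm]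
  · have : (S.coordEquiv d) ⁻¹' ((Set.univ.pi fun _ => Set.Ico 0 1) ×ˢ
        Set.univ.pi fun _ => Set.univ.pi fun _ => Metric.closedBall 0 1) =
        Set.univ.pi fun _ => S.box := by
      ext x
      simp only [Set.mem_preimage, Set.mem_prod, Set.mem_univ_pi, box, coordEquiv]
      exact ⟨fun h j => ⟨h.1 j, fun i => h.2 i j⟩, fun h => ⟨fun j => (h j).1, fun i j => (h j).2 i⟩⟩
    rw [this, volume_pi_pi]
    simp [volume_box]
  · exact (MeasurableSet.univ_pi fun _ => measurableSet_Ico).prod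
      (MeasurableSet.univ_pi fun _ => MeasurableSet.univ_pi fun _ => measurableSet_closedBall)

lemma real_enorm_mul_volume_preimage {u : ℝ} (hu : u ≠ 0) (s : Set ℝ) :
    ‖u‖ₑ * volume ((fun x => u * x) ⁻¹' s) = volume s := by
  rw [Real.volume_preimage_mul_left hu, ← mul_assoc, ← ofReal_norm, Real.norm_eq_abs,
    ← ENNReal.ofReal_mul (abs_nonneg _), ← abs_mul, mul_inv_cancel₀ hu, abs_one,
    ENNReal.ofReal_one, one_mul]

lemma measurePreserving_vecMul (d : ℕ) (M : Matrix (Fin d) (Fin d) S.AS) (hM : M.det = 1) :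
    MeasurePreserving (fun x : Fin d → S.AS => x ᵥ* M) := by
  let f1 := RingHom.fst ℝ (∀ i : Fin S.s, S.Qp i)
  let f2 (i : Fin S.s) := (Pi.evalRingHom (fun i => S.Qp i) i).comp
    (RingHom.snd ℝ (∀ i : Fin S.s, S.Qp i))
  have h1 : (f1.mapMatrix M).det = 1 := by rw [← RingHom.map_det, hM, map_one]
  have h2 (i) : ((f2 i).mapMatrix M).det = 1 := by rw [← RingHom.map_det, hM, map_one]
  have e1 : MeasurePreserving (fun x : Fin d → ℝ => x ᵥ* f1.mapMatrix M) :=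
    measurePreserving_vecMul_of_det_eq_one
      (c := (ENNReal.ofNNRealHom : NNReal →* ℝ≥0∞).comp (nnnormHom : ℝ →*₀ NNReal))
      (fun u hu s _ => real_enorm_mul_volume_preimage hu s) h1
  have e2 (i) : MeasurePreserving (fun x : Fin d → S.Qp i => x ᵥ* (f2 i).mapMatrix M) :=
    measurePreserving_vecMul_of_det_eq_one
      (c := (ENNReal.ofNNRealHom : NNReal →* ℝ≥0∞).comp (nnnormHom : S.Qp i →*₀ NNReal))
      (fun u hu s _ => Padic.enorm_mul_volume_preimage hu s) (h2 i)
  have e3 := e1.prod (volume_preserving_pi e2)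
  have hm : Measurable (S.coordEquiv d).symm := (S.coordEquiv d).symm.continuous.measurable
  have e4 : MeasurePreserving (S.coordEquiv d).symm :=
    (S.measurePreserving_coordEquiv d).symm (S.coordEquiv d).toHomeomorph.toMeasurableEquiv
  have e5 := e4.comp (e3.comp (S.measurePreserving_coordEquiv d))
  convert e5 using 1
  funext x j
  refine Prod.ext ?_ (funext fun i => ?_)
  · exact map_sum f1 (fun k => x k * M k j) Finset.univ
  · exact map_sum (f2 i) (fun k => x k * M k j) Finset.univ

end PrimeTup

namespace PrimeTup

variable (S : PrimeTup)

/-- The module `∏_{p ∈ S} |x|_p` of an element of `ℚ_S`. -/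
noncomputable def md (x : S.AS) : ℝ≥0∞ := ‖x.1‖ₑ * ∏ i, ‖x.2 i‖ₑ

lemma measurable_md : Measurable S.md := by
  unfold md
  fun_prop

variable {S} in
lemma isUnit_iff {x : S.AS} : IsUnit x ↔ x.1 ≠ 0 ∧ ∀ i, x.2 i ≠ 0 := by
  rw [Prod.isUnit_iff, isUnit_iff_ne_zero, Pi.isUnit_iff]
  simp only [isUnit_iff_ne_zero]

lemma md_ne_zero (x : S.AS) (hx : IsUnit x) : S.md x ≠ 0 := by
  rw [isUnit_iff] at hx
  exact mul_ne_zero (by simpa using hx.1) (Finset.prod_ne_zero_iff.mpr fun i _ => by simpa using hx.2 i)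

lemma md_ne_top (x : S.AS) : S.md x ≠ ∞ :=
  ENNReal.mul_ne_top enorm_ne_top (ENNReal.prod_ne_top fun _ _ => enorm_ne_top)

lemma md_mul (x y : S.AS) : S.md (x * y) = S.md x * S.md y := by
  simp only [md, Prod.fst_mul, Prod.snd_mul, Pi.mul_apply, enorm_mul, Finset.prod_mul_distrib]
  ring

lemma md_one : S.md 1 = 1 := by simp [md]

lemma md_smul_map_mul (u : S.AS) (hu : IsUnit u) :
    S.md u • Measure.map (fun x => u * x) volume = volume := by
  rw [isUnit_iff] at hu
  have h1 : (∏ i, ‖u.2 i‖ₑ) • Measure.map (fun x => u.2 * x) volume = volume := by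
    refine (Measure.pi_eq fun s hs => ?_).symm
    rw [Measure.smul_apply, Measure.map_apply (measurable_const_mul _) (MeasurableSet.univ_pi hs),
      smul_eq_mul]
    have : (fun x => u.2 * x) ⁻¹' Set.univ.pi s = Set.univ.pi fun i => (fun x => u.2 i * x) ⁻¹' s i := by
      ext x
      simp
    rw [this, volume_pi_pi, ← Finset.prod_mul_distrib]
    exact Finset.prod_congr rfl fun i _ => Padic.enorm_mul_volume_preimage (hu.2 i) _
  refine (Measure.prod_eq fun s t hs ht => ?_).symm
  rw [Measure.smul_apply, Measure.map_apply (measurable_const_mul _) (hs.prod ht), smul_eq_mul]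
  have : (fun x => u * x) ⁻¹' s ×ˢ t = ((fun x => u.1 * x) ⁻¹' s) ×ˢ ((fun x => u.2 * x) ⁻¹' t) := rfl
  rw [this, Measure.volume_eq_prod, Measure.prod_prod, ← real_enorm_mul_volume_preimage hu.1 s]
  conv_rhs => rw [← h1]
  rw [Measure.smul_apply, Measure.map_apply (measurable_const_mul _) ht, smul_eq_mul, md]
  ring

lemma md_mul_lintegral (u : S.AS) (hu : IsUnit u) (f : S.AS → ℝ≥0∞) (hf : Measurable f) :
    S.md u * ∫⁻ x, f (u * x) = ∫⁻ x, f x := by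
  conv_rhs => rw [← S.md_smul_map_mul u hu]
  rw [lintegral_smul_measure, lintegral_map hf (measurable_const_mul u), smul_eq_mul]

lemma ae_isUnit : ∀ᵐ a : S.AS, IsUnit a := by
  have h1 : ∀ᵐ a : S.AS, a.1 ≠ 0 :=
    Measure.quasiMeasurePreserving_fst.ae (measure_eq_zero_iff_ae_notMem.mp (measure_singleton (0 : ℝ)))
  have h2 : ∀ᵐ x : (∀ i : Fin S.s, S.Qp i), ∀ i, x i ≠ 0 :=
    ae_all_iff.mpr fun i => (Measure.tendsto_eval_ae_ae (i := i)).eventually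
      (measure_eq_zero_iff_ae_notMem.mp (measure_singleton (0 : S.Qp i)))
  filter_upwards [h1, Measure.quasiMeasurePreserving_snd.ae h2] with a ha hb
  exact isUnit_iff.mpr ⟨ha, hb⟩

lemma isBounded_box : Bornology.IsBounded S.box :=
  (Metric.isBounded_Ico 0 1).prod (Bornology.IsBounded.pi fun _ => Metric.isBounded_closedBall)

/-- An exhaustion of `ℚ_S` by boxes. -/
def boxes (x k : ℕ) : Set S.AS :=
  Set.Ico (-(x : ℝ)) x ×ˢ Set.univ.pi fun i => Metric.closedBall 0 ((S.p i : ℝ) ^ k)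

lemma measurableSet_boxes (x k : ℕ) : MeasurableSet (S.boxes x k) :=
  measurableSet_Ico.prod (MeasurableSet.univ_pi fun _ => measurableSet_closedBall)

lemma _root_.Padic.volume_closedBall_pow {p : ℕ} [Fact p.Prime] (k : ℕ) :
    volume (Metric.closedBall (0 : ℚ_[p]) ((p : ℝ) ^ k)) = (p : ℝ≥0∞) ^ k := by
  have hp := Nat.cast_ne_zero (R := ℚ_[p]).mpr (Fact.out : p.Prime).ne_zero
  have h1 := Padic.volume_smul_eq_mul (Units.mk0 ((p : ℚ_[p]) ^ (-(k : ℤ))) (zpow_ne_zero _ hp))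
    (Metric.closedBall 0 1)
  rw [Padic.smul_closedBall, Padic.volume_closedBall_one, mul_one, Padic.distribHaarChar_eq,
    ← enorm_eq_nnnorm, ← ofReal_norm, Units.val_mk0, Padic.norm_p_zpow, neg_neg, zpow_natCast] at h1
  rw [h1, ENNReal.ofReal_pow (Nat.cast_nonneg _), ENNReal.ofReal_natCast]

lemma volume_boxes (x k : ℕ) :
    volume (S.boxes x k) = x * (2 * ∏ i, (S.p i : ℝ≥0∞) ^ k) := by
  rw [boxes, Measure.volume_eq_prod, Measure.prod_prod, volume_pi_pi, Real.volume_Ico]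
  simp only [Padic.volume_closedBall_pow]
  rw [sub_neg_eq_add, ← two_mul, ENNReal.ofReal_mul two_pos.le, ENNReal.ofReal_natCast,
    ENNReal.ofReal_ofNat]
  ring

lemma boxes_add (R : ℕ) : ∃ k₀ : ℕ, ∀ k ≥ k₀, ∀ x, ∀ a ∈ S.boxes x k, ∀ b, ‖b‖ ≤ R →
    a + b ∈ S.boxes (x + R) k := by
  refine ⟨R, fun k hk x a ha b hb => ⟨?_, fun i _ => ?_⟩⟩
  · have h1 : ‖b.1‖ ≤ R := (norm_fst_le b).trans hb
    rw [Real.norm_eq_abs, abs_le] at h1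
    have h2 := ha.1
    rw [Set.mem_Ico] at h2 ⊢
    push_cast
    constructor <;> simp only [Prod.fst_add] <;> linarith
  · have h1 : ‖b.2 i‖ ≤ R := (norm_le_pi_norm b.2 i).trans ((norm_snd_le b).trans hb)
    have h2 := mem_closedBall_zero_iff.mp (ha.2 i trivial)
    rw [mem_closedBall_zero_iff]
    refine (Padic.nonarchimedean _ _).trans (max_le h2 (h1.trans ?_))
    have h3 : k < S.p i ^ k := Nat.lt_pow_self (S.hp i).one_lt
    exact_mod_cast hk.le.trans h3.le

end PrimeTup

namespace PrimeTup

variable (S : PrimeTup)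

lemma exists_eq_of_dvd_den {q : ℚ} (hq : q ∈ S.Zs) : ∀ l : ℕ, l.Prime → l ∣ q.den → ∃ i, l = S.p i := by
  intro l hl
  have key (q₁ q₂ q₃ : ℚ) (h : q₃.den ∣ q₁.den * q₂.den) (h1 : l ∣ q₁.den → ∃ i, l = S.p i)
      (h2 : l ∣ q₂.den → ∃ i, l = S.p i) (h3 : l ∣ q₃.den) : ∃ i, l = S.p i :=
    ((Nat.Prime.dvd_mul hl).mp (h3.trans h)).elim h1 h2
  refine Subring.closure_induction ?_ (fun h => ?_) (fun h => ?_)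
    (fun x y _ _ => key x y _ (Rat.add_den_dvd x y)) (fun x _ h => by rwa [Rat.neg_den])
    (fun x y _ _ => key x y _ (Rat.mul_den_dvd x y)) hq
  · rintro _ ⟨i, rfl⟩ h
    rw [Rat.inv_natCast_den_of_pos (S.hp i).pos] at h
    exact ⟨i, (Nat.prime_dvd_prime_iff_eq hl (S.hp i)).mp h⟩
  · exact absurd (Nat.dvd_one.mp h) hl.ne_one
  · exact absurd (Nat.dvd_one.mp h) hl.ne_one

lemma natCast_inv_mem {n : ℕ} (hn : ∀ l : ℕ, l.Prime → l ∣ n → ∃ i, l = S.p i) :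
    ((n : ℚ))⁻¹ ∈ S.Zs := by
  induction n using induction_on_primes with
  | zero => simp
  | one => simp
  | prime_mul l n hl ih =>
    rw [Nat.cast_mul, mul_inv]
    obtain ⟨i, rfl⟩ := hn l hl (dvd_mul_right _ _)
    exact S.Zs.mul_mem (Subring.subset_closure ⟨i, rfl⟩) (ih fun l' hl' h => hn l' hl' (h.mul_left _))

lemma den_inv_mem {q : ℚ} (hq : q ∈ S.Zs) : ((q.den : ℚ))⁻¹ ∈ S.Zs :=
  S.natCast_inv_mem (S.exists_eq_of_dvd_den hq)

lemma exists_smooth_mul {n : ℕ} (hn : n ≠ 0) : ∃ a m : ℕ, n = a * m ∧ m ∈ S.NS ∧ ((a : ℚ))⁻¹ ∈ S.Zs := by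
  induction n using Nat.strong_induction_on with
  | _ n ih =>
    by_cases h : ∃ i, S.p i ∣ n
    · obtain ⟨i, k, rfl⟩ := h
      have hk : k ≠ 0 := right_ne_zero_of_mul hn
      obtain ⟨a, m, rfl, hm, ha⟩ := ih k (lt_mul_of_one_lt_left (Nat.pos_of_ne_zero hk) (S.hp i).one_lt) hk
      refine ⟨S.p i * a, m, (mul_assoc _ _ _).symm, hm, ?_⟩
      rw [Nat.cast_mul, mul_inv]
      exact S.Zs.mul_mem (Subring.subset_closure ⟨i, rfl⟩) ha
    · push Not at h
      exact ⟨1, n, (one_mul _).symm, ⟨Nat.pos_of_ne_zero hn, h⟩, by simp⟩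

lemma exists_unit_mul (x : S.Zs) (hx : x ≠ 0) : ∃ ε : S.Zsˣ, ∃ m ∈ S.NS, x = ε * (m : S.Zs) := by
  have hx' : (x : ℚ) ≠ 0 := fun h => hx (Subtype.ext h)
  obtain ⟨a, m, h1, hm, ha⟩ := S.exists_smooth_mul (Int.natAbs_ne_zero.mpr (Rat.num_ne_zero.mpr hx'))
  have hm0 : (m : ℚ) ≠ 0 := Nat.cast_ne_zero.mpr hm.1.ne'
  have hd0 : ((x : ℚ).den : ℚ) ≠ 0 := Nat.cast_ne_zero.mpr (x : ℚ).den_nz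
  have ha0 : (a : ℚ) ≠ 0 := by
    rintro h
    rw [Nat.cast_eq_zero.mp h, zero_mul] at h1
    exact Rat.num_ne_zero.mpr hx' (Int.natAbs_eq_zero.mp h1)
  have h3 : ∃ σ : ℤ, σ * σ = 1 ∧ (x : ℚ).num = σ * (a * m : ℕ) := by
    rcases Int.natAbs_eq (x : ℚ).num with h | h
    · exact ⟨1, rfl, by rw [one_mul, ← h1, ← h]⟩
    · exact ⟨-1, rfl, by rw [neg_one_mul, ← h1, ← h]⟩
  obtain ⟨σ, hσ, h3⟩ := h3
  have hσ' : (σ : ℚ) * σ = 1 := by exact_mod_cast hσ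
  have h4 : (x : ℚ) = σ * a * m / (x : ℚ).den := by
    conv_lhs => rw [← Rat.num_div_den (x : ℚ), h3]
    push_cast
    ring
  let y : S.Zs := σ * a * ⟨_, S.den_inv_mem x.2⟩
  let y' : S.Zs := σ * ⟨_, ha⟩ * ((x : ℚ).den : S.Zs)
  have hy : y * y' = 1 := by
    refine Subtype.ext ?_
    simp only [y, y', Subring.coe_mul, Subring.coe_intCast, Subring.coe_natCast, Subring.coe_one]
    field_simp
    linear_combination hσ'
  refine ⟨⟨y, y', hy, by rw [mul_comm, hy]⟩, m, hm, Subtype.ext ?_⟩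
  simp only [y, Subring.coe_mul, Subring.coe_intCast, Subring.coe_natCast]
  exact h4.trans (by rw [div_eq_mul_inv]; ring)

lemma dvd_of_natCast_dvd {m m' : ℕ} (hm' : m' ∈ S.NS) (h : (m' : S.Zs) ∣ (m : S.Zs)) : m' ∣ m := by
  obtain ⟨q, hq⟩ := h
  have h1 : (m : ℚ) = m' * q := by
    have := congrArg Subtype.val hq
    simpa using this
  have h2 : (q : ℚ).den = 1 := by
    by_contra hne
    obtain ⟨l, hl, hd⟩ := Nat.exists_prime_and_dvd hne
    obtain ⟨i, rfl⟩ := S.exists_eq_of_dvd_den q.2 l hl hd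
    refine hm'.2 i (hd.trans ?_)
    have h3 : (q : ℚ) = Rat.divInt m m' := by
      rw [Rat.divInt_eq_div]
      push_cast
      rw [h1, mul_div_cancel_left₀ _ (Nat.cast_ne_zero.mpr hm'.1.ne')]
    rw [h3]
    exact_mod_cast Rat.den_dvd m m'
  have h4 : (q : ℚ) = (q : ℚ).num := (Rat.coe_int_num_of_den_eq_one h2).symm
  rw [h4] at h1
  have h5 : (m : ℤ) = m' * (q : ℚ).num := by exact_mod_cast h1
  exact Int.natCast_dvd_natCast.mp ⟨_, h5⟩

lemma exists_bezout (a b : S.Zs) : ∃ g a' b' x y : S.Zs, a = g * a' ∧ b = g * b' ∧ x * a' + y * b' = 1 := by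
  let D : ℚ := (a : ℚ).den * (b : ℚ).den
  let m : ℤ := (a : ℚ).num * (b : ℚ).den
  let n : ℤ := (b : ℚ).num * (a : ℚ).den
  by_cases h : Int.gcd m n = 0
  · rw [Int.gcd_eq_zero_iff] at h
    have ha : a = 0 := by
      have := (mul_eq_zero.mp h.1).resolve_right (by exact_mod_cast (b : ℚ).den_nz)
      exact Subtype.ext (Rat.num_eq_zero.mp this)
    have hb : b = 0 := by
      have := (mul_eq_zero.mp h.2).resolve_right (by exact_mod_cast (a : ℚ).den_nz)
      exact Subtype.ext (Rat.num_eq_zero.mp this)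
    exact ⟨0, 1, 0, 1, 0, by simp [ha], by simp [hb], by simp⟩
  · obtain ⟨m', hm'⟩ := Int.gcd_dvd_left m n
    obtain ⟨n', hn'⟩ := Int.gcd_dvd_right m n
    have ha0 : ((a : ℚ).den : ℚ) ≠ 0 := Nat.cast_ne_zero.mpr (a : ℚ).den_nz
    have hb0 : ((b : ℚ).den : ℚ) ≠ 0 := Nat.cast_ne_zero.mpr (b : ℚ).den_nz
    refine ⟨(Int.gcd m n : S.Zs) * (⟨_, S.den_inv_mem a.2⟩ * ⟨_, S.den_inv_mem b.2⟩), m', n',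
      (Int.gcdA m n : S.Zs), (Int.gcdB m n : S.Zs), Subtype.ext ?_, Subtype.ext ?_, ?_⟩
    · have h1 : (m : ℚ) = Int.gcd m n * m' := by exact_mod_cast hm'
      simp only [Subring.coe_mul, Subring.coe_intCast, Subring.coe_natCast]
      rw [mul_right_comm, ← h1]
      simp only [m, Int.cast_mul, Int.cast_natCast]
      field_simp
      exact Rat.mul_den_eq_num _
    · have h1 : (n : ℚ) = Int.gcd m n * n' := by exact_mod_cast hn'
      simp only [Subring.coe_mul, Subring.coe_intCast, Subring.coe_natCast]
      rw [mul_right_comm, ← h1]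
      simp only [n, Int.cast_mul, Int.cast_natCast]
      field_simp
      exact Rat.mul_den_eq_num _
    · have h1 := Int.gcd_eq_gcd_ab m n
      have h2 : (Int.gcd m n : ℤ) * (Int.gcdA m n * m' + Int.gcdB m n * n') = Int.gcd m n * 1 := by
        linear_combination -h1 - Int.gcdA m n * hm' - Int.gcdB m n * hn'
      have h3 := mul_left_cancel₀ (by exact_mod_cast h) h2
      exact_mod_cast h3

end PrimeTup

lemma exists_smul_mem_primRows {R : Type} [CommRing R]
    (hR : ∀ a b : R, ∃ g a' b' x y : R, a = g * a' ∧ b = g * b' ∧ x * a' + y * b' = 1) (n : ℕ)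
    (v : Fin (n + 1) → R) : ∃ c : R, ∃ p ∈ primRows R n, v = c • p := by
  induction n with
  | zero =>
    refine ⟨v 0, _, ⟨1, rfl⟩, funext fun i => ?_⟩
    obtain rfl : i = 0 := Fin.fin_one_eq_zero i
    simp
  | succ n ih =>
    obtain ⟨c, _, ⟨γ, rfl⟩, hv⟩ := ih (Fin.tail v)
    obtain ⟨g, a, b, x, y, h0, hc, h1⟩ := hR (v 0) c
    let M : Matrix (Fin (n + 2)) (Fin (n + 2)) R :=
      Matrix.of (Fin.cons (Fin.cons a (b • γ.1 0)) (Fin.cons (Fin.cons (-y) (x • γ.1 0))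
        fun i => Fin.cons 0 (γ.1 i.succ)))
    have hdet : M.det = 1 := by
      have e1 : M.submatrix (Fin.succAbove 0) Fin.succ = γ.1.updateRow 0 (x • γ.1 0) := by
        ext i j
        refine Fin.cases ?_ (fun i => ?_) i <;> simp [M]
      have e2 : M.submatrix (Fin.succAbove 1) Fin.succ = γ.1.updateRow 0 (b • γ.1 0) := by
        ext i j
        refine Fin.cases ?_ (fun i => ?_) i <;> simp [M]
      have e3 (t : R) : (γ.1.updateRow 0 (t • γ.1 0)).det = t := by
        rw [det_updateRow_smul, updateRow_eq_self, γ.2, mul_one]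
      rw [det_succ_column_zero, Fin.sum_univ_succ, Fin.sum_univ_succ, Finset.sum_eq_zero]
      · rw [e1, show Fin.succ (0 : Fin (n + 1)) = 1 from rfl, e2, e3, e3]
        simp [M]
        linear_combination h1
      · intro i _
        simp [M]
    refine ⟨g, _, ⟨⟨M, hdet⟩, rfl⟩, ?_⟩
    rw [← Fin.cons_self_tail v, hv, h0, hc]
    ext j
    refine Fin.cases ?_ (fun j => ?_) j <;> simp [M, mul_assoc]

lemma units_smul_mem_primRows {R : Type} [CommRing R] {n : ℕ} (ε : Rˣ) {p : Fin (n + 2) → R}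
    (hp : p ∈ primRows R (n + 1)) : (ε : R) • p ∈ primRows R (n + 1) := by
  obtain ⟨γ, rfl⟩ := hp
  refine ⟨⟨(γ.1.updateRow 0 ((ε : R) • γ.1 0)).updateRow 1 ((ε⁻¹ : Rˣ).1 • γ.1 1), ?_⟩, ?_⟩
  · have h1 : γ.1 1 = (γ.1.updateRow 0 ((ε : R) • γ.1 0)) 1 := by simp
    rw [det_updateRow_smul]
    conv_lhs => rw [h1, updateRow_eq_self]
    rw [det_updateRow_smul, updateRow_eq_self, γ.2]
    simp
  · simp

lemma exists_dotProduct_eq_one {R : Type} [CommRing R] {n : ℕ} {p : Fin (n + 1) → R}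
    (hp : p ∈ primRows R n) : ∃ c, p ⬝ᵥ c = 1 := by
  obtain ⟨γ, rfl⟩ := hp
  have h1 : (γ * γ⁻¹).1 0 0 = 1 := by
    rw [mul_inv_cancel]
    simp
  exact ⟨_, h1⟩

namespace PrimeTup

variable (S : PrimeTup)

lemma natCast_ne_zero {m : ℕ} (hm : m ∈ S.NS) : (m : S.Zs) ≠ 0 := Nat.cast_ne_zero.mpr hm.1.ne'

lemma content (n : ℕ) (v : Fin (n + 2) → S.Zs) (hv : v ≠ 0) :
    ∃ m ∈ S.NS, ∃ p ∈ primRows S.Zs (n + 1), v = (m : S.Zs) • p ∧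
      ∀ m' ∈ S.NS, ∀ p' ∈ primRows S.Zs (n + 1), v = (m' : S.Zs) • p' → m' = m ∧ p' = p := by
  obtain ⟨c, p, hp, hvc⟩ := exists_smul_mem_primRows S.exists_bezout (n + 1) v
  have hc : c ≠ 0 := by
    rintro rfl
    exact hv (by rw [hvc, zero_smul])
  obtain ⟨ε, m, hm, rfl⟩ := S.exists_unit_mul c hc
  have hvm : v = (m : S.Zs) • (ε : S.Zs) • p := by rw [hvc, smul_smul, mul_comm]
  have key (m₁ m₂ : ℕ) (h₂ : m₂ ∈ S.NS) (p₁ p₂ : Fin (n + 2) → S.Zs)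
      (hp₁ : p₁ ∈ primRows S.Zs (n + 1)) (h : (m₁ : S.Zs) • p₁ = (m₂ : S.Zs) • p₂) : m₂ ∣ m₁ := by
    obtain ⟨c, hc⟩ := exists_dotProduct_eq_one hp₁
    refine S.dvd_of_natCast_dvd h₂ ⟨p₂ ⬝ᵥ c, ?_⟩
    rw [← smul_eq_mul, ← smul_dotProduct, ← h, smul_dotProduct, hc, smul_eq_mul, mul_one]
  have hp' := units_smul_mem_primRows ε hp
  refine ⟨m, hm, _, hp', hvm, fun m' hm' p' hp'' h => ?_⟩
  have h1 : m' = m := Nat.dvd_antisymm (key _ _ hm' _ _ hp' (hvm.symm.trans h))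
    (key _ _ hm _ _ hp'' (h.symm.trans hvm))
  subst h1
  exact ⟨rfl, (smul_right_injective _ (S.natCast_ne_zero hm) (hvm.symm.trans h)).symm⟩

/-- The diagonal embedding of `ℤ_S` into `ℚ_S`. -/
noncomputable def ι : S.Zs →+* S.AS :=
  RingHom.prod ((Rat.castHom ℝ).comp S.Zs.subtype)
    (RingHom.pi fun i => (Rat.castHom (S.Qp i)).comp S.Zs.subtype)

@[simp] lemma ι_fst (q : S.Zs) : (S.ι q).1 = ((q : ℚ) : ℝ) := rfl

@[simp] lemma ι_snd (q : S.Zs) (i : Fin S.s) : (S.ι q).2 i = ((q : ℚ) : S.Qp i) := rfl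

lemma isUnit_ι (q : S.Zs) (hq : q ≠ 0) : IsUnit (S.ι q) := by
  have h : (q : ℚ) ≠ 0 := fun h => hq (Subtype.ext h)
  exact isUnit_iff.mpr ⟨by simpa using h, fun i => by simpa using h⟩

lemma den_eq_one_of_norm_le_one (q : S.Zs) (h : ∀ i, ‖((q : ℚ) : S.Qp i)‖ ≤ 1) : (q : ℚ).den = 1 := by
  by_contra hne
  obtain ⟨l, hl, hd⟩ := Nat.exists_prime_and_dvd hne
  obtain ⟨i, rfl⟩ := S.exists_eq_of_dvd_den q.2 l hl hd
  have h1 : ‖((q : ℚ).den : S.Qp i)‖ < 1 := Padic.norm_natCast_lt_one_iff.mpr hd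
  have h2 : ‖((q : ℚ).num : S.Qp i)‖ = 1 := by
    rw [Padic.norm_intCast_eq_one_iff, Int.isCoprime_iff_gcd_eq_one]
    exact Nat.Coprime.coprime_dvd_right hd (q : ℚ).reduced
  have h3 : ((q : ℚ) : S.Qp i) * ((q : ℚ).den : S.Qp i) = ((q : ℚ).num : S.Qp i) := by
    exact_mod_cast congrArg (fun x : ℚ => (x : S.Qp i)) (Rat.mul_den_eq_num (q : ℚ))
  have h4 := congrArg norm h3
  rw [norm_mul, h2] at h4
  nlinarith [h i, norm_nonneg ((q : ℚ).den : S.Qp i), norm_nonneg ((q : ℚ) : S.Qp i)]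

lemma eq_zero_of_norm_lt (q : S.Zs) (h1 : |((q : ℚ) : ℝ)| < 1) (h : ∀ i, ‖((q : ℚ) : S.Qp i)‖ ≤ 1) :
    q = 0 := by
  have h2 : (q : ℚ) = (q : ℚ).num := (Rat.coe_int_num_of_den_eq_one (S.den_eq_one_of_norm_le_one q h)).symm
  rw [h2, Rat.cast_intCast] at h1
  have h3 : |(q : ℚ).num| < 1 := by exact_mod_cast h1
  exact Subtype.ext (Rat.num_eq_zero.mp (Int.abs_lt_one_iff.mp h3))

lemma sep : ∃ ε > (0 : ℝ), ∀ q, ‖S.ι q‖ < ε → q = 0 :=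
  ⟨1, one_pos, fun q h => S.eq_zero_of_norm_lt q ((norm_fst_le _).trans_lt h) fun i =>
    ((norm_le_pi_norm (S.ι q).2 i).trans ((norm_snd_le _).trans h.le))⟩

lemma exists_zs_near (i : Fin S.s) (a : S.Qp i) : ∃ q : S.Zs, ‖((q : ℚ) : S.Qp i) + a‖ ≤ 1 ∧
    ∀ j, j ≠ i → ‖((q : ℚ) : S.Qp j)‖ ≤ 1 := by
  have hp0 : (S.p i : S.Qp i) ≠ 0 := Nat.cast_ne_zero.mpr (S.hp i).ne_zero
  obtain ⟨k, hk⟩ : ∃ k : ℕ, ‖a‖ < (S.p i : ℝ) ^ k :=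
    pow_unbounded_of_one_lt _ (by exact_mod_cast (S.hp i).one_lt)
  let x : ℤ_[S.p i] := ⟨-((S.p i : S.Qp i) ^ k * a), by
    rw [norm_neg, norm_mul, norm_pow, Padic.norm_p, inv_pow]
    exact (inv_mul_le_one₀ (pow_pos (by exact_mod_cast (S.hp i).pos) _)).mpr hk.le⟩
  have hx := PadicInt.appr_spec k x
  rw [← PadicInt.norm_le_pow_iff_mem_span_pow] at hx
  let q : S.Zs := ⟨(x.appr k : ℚ) * ((S.p i : ℚ)⁻¹) ^ k, S.Zs.mul_mem (natCast_mem _ _)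
    (S.Zs.pow_mem (show ((S.p i : ℚ))⁻¹ ∈ S.Zs from Subring.subset_closure ⟨i, rfl⟩) _)⟩
  have hq (j) : ((q : ℚ) : S.Qp j) = (x.appr k : S.Qp j) * ((S.p i : S.Qp j)⁻¹) ^ k := by
    simp [q]
  refine ⟨q, ?_, fun j hj => ?_⟩
  · have h1 : ((q : ℚ) : S.Qp i) + a =
        -((S.p i : S.Qp i) ^ k)⁻¹ * ((x - x.appr k : ℤ_[S.p i]) : S.Qp i) := by
      have h2 : ((x - x.appr k : ℤ_[S.p i]) : S.Qp i) = -((S.p i : S.Qp i) ^ k * a) - x.appr k := by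
        push_cast
        rfl
      rw [hq, h2, inv_pow]
      field_simp
      ring
    rw [h1, norm_mul, norm_neg, norm_inv, norm_pow, Padic.norm_p, inv_pow, inv_inv, ← PadicInt.norm_def]
    calc (S.p i : ℝ) ^ k * ‖x - x.appr k‖ ≤ (S.p i : ℝ) ^ k * (S.p i : ℝ) ^ (-(k : ℤ)) := by gcongr
      _ = 1 := by
        rw [_root_.zpow_neg, zpow_natCast]
        exact mul_inv_cancel₀ (pow_ne_zero _ (Nat.cast_ne_zero.mpr (S.hp i).ne_zero))
  · rw [hq, norm_mul, norm_pow, norm_inv, Padic.norm_natCast_eq_one_iff (n := S.p i) |>.mpr, inv_one, one_pow, mul_one]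
    · exact_mod_cast Padic.norm_int_le_one (p := S.p j) (x.appr k)
    · exact (Nat.coprime_primes (S.hp j) (S.hp i)).mpr fun h => hj (S.inj h)

lemma box_tile (a : S.AS) : ∃! q, S.ι q + a ∈ S.box := by
  choose r hr1 hr2 using fun i => S.exists_zs_near i (a.2 i)
  have mem_box (q : S.Zs) : S.ι q + a ∈ S.box ↔ (((q : ℚ) : ℝ) + a.1 ∈ Set.Ico (0 : ℝ) 1) ∧
      ∀ i, ‖((q : ℚ) : S.Qp i) + a.2 i‖ ≤ 1 := by
    simp [box, Set.mem_prod]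
  let q₀ : S.Zs := ∑ i, r i
  have add_le {i : Fin S.s} {x y : S.Qp i} (hx : ‖x‖ ≤ 1) (hy : ‖y‖ ≤ 1) : ‖x + y‖ ≤ 1 :=
    (Padic.nonarchimedean _ _).trans (max_le hx hy)
  have h1 (i) : ‖((q₀ : ℚ) : S.Qp i) + a.2 i‖ ≤ 1 := by
    have h2 : ((q₀ : ℚ) : S.Qp i) + a.2 i =
        (((r i : ℚ) : S.Qp i) + a.2 i) + ∑ j ∈ Finset.univ.erase i, ((r j : ℚ) : S.Qp i) := by
      have : (q₀ : ℚ) = ∑ j, (r j : ℚ) := by simp [q₀]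
      rw [this, Rat.cast_sum, ← Finset.add_sum_erase _ _ (Finset.mem_univ i)]
      ring
    rw [h2]
    refine add_le (hr1 i) ?_
    refine Finset.sum_induction _ (fun x : S.Qp i => ‖x‖ ≤ 1) (fun _ _ => add_le) (by simp)
      fun j hj => hr2 j i (Finset.ne_of_mem_erase hj).symm
  refine existsUnique_of_exists_of_unique ⟨q₀ - (⌊((q₀ : ℚ) : ℝ) + a.1⌋ : S.Zs), ?_⟩
    fun q q' hq hq' => ?_
  · rw [mem_box]
    push_cast
    refine ⟨⟨?_, ?_⟩, fun i => ?_⟩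
    · linarith [Int.floor_le (((q₀ : ℚ) : ℝ) + a.1)]
    · linarith [Int.lt_floor_add_one (((q₀ : ℚ) : ℝ) + a.1)]
    · rw [sub_add_eq_add_sub, sub_eq_add_neg]
      exact add_le (h1 i) (by rw [norm_neg]; exact Padic.norm_int_le_one _)
  · rw [mem_box] at hq hq'
    refine sub_eq_zero.mp (S.eq_zero_of_norm_lt _ ?_ fun i => ?_)
    · rw [abs_lt]
      push_cast
      constructor <;> linarith [hq.1.1, hq.1.2, hq'.1.1, hq'.1.2]
    · have : (((q - q' : S.Zs) : ℚ) : S.Qp i) =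
          (((q : ℚ) : S.Qp i) + a.2 i) + -(((q' : ℚ) : S.Qp i) + a.2 i) := by
        push_cast
        ring
      rw [this]
      exact add_le (hq.2 i) (by rw [norm_neg]; exact hq'.2 i)

end PrimeTup

namespace PrimeTup

variable (S : PrimeTup)

lemma md_natCast {m : ℕ} (hm : m ∈ S.NS) : S.md (m : S.AS) = m := by
  have h1 (i) : ‖(m : S.Qp i)‖ₑ = 1 := by
    rw [← ofReal_norm, Padic.norm_natCast_eq_one_iff.mpr, ENNReal.ofReal_one]
    exact ((S.hp i).coprime_iff_not_dvd).mpr (hm.2 i)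
  simp [md, h1]

/-- `ℤ_S` as an arithmetic lattice in `ℚ_S`. -/
noncomputable def arith : ArithRing S.AS S.Zs where
  ι := S.ι
  isUnit_ι := S.isUnit_ι
  box := S.box
  measurableSet_box := S.measurableSet_box
  isBounded_box := S.isBounded_box
  box_tile := S.box_tile
  volume_box := S.volume_box
  ae_isUnit := S.ae_isUnit
  md := S.md
  measurable_md := S.measurable_md
  md_ne_zero := S.md_ne_zero
  md_ne_top a _ := S.md_ne_top a
  lintegral_mul := S.md_mul_lintegral
  measurePreserving_vecMul := S.measurePreserving_vecMul
  sep := S.sep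
  N := S.NS
  N_pos _ h := h.1
  N_one := ⟨one_pos, fun i => (S.hp i).one_lt.not_ge.imp (Nat.le_of_dvd one_pos)⟩
  N_mul m hm m' hm' := ⟨Nat.mul_pos hm.1 hm'.1, fun i h =>
    ((S.hp i).dvd_mul.mp h).elim (hm.2 i) (hm'.2 i)⟩
  N_dvd m hm m' h := ⟨Nat.pos_of_dvd_of_pos h hm.1, fun i hi => hm.2 i (hi.trans h)⟩
  md_natCast _ := S.md_natCast
  natCast_ne_zero _ := S.natCast_ne_zero
  content := S.content
  C := S.boxes
  measurableSet_C := S.measurableSet_boxes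
  cvol k := 2 * ∏ i, (S.p i : ℝ≥0∞) ^ k
  one_le_cvol k := one_le_two.trans (le_mul_of_one_le_right (zero_le) (by
    refine Finset.one_le_prod' fun i _ => one_le_pow₀ ?_
    exact_mod_cast (S.hp i).one_lt.le))
  cvol_ne_top k := ENNReal.mul_ne_top ENNReal.ofNat_ne_top (ENNReal.prod_ne_top fun i _ =>
    ENNReal.pow_ne_top (ENNReal.natCast_ne_top _))
  volume_C := S.volume_boxes
  C_add := S.boxes_add

lemma zeta_eq {d : ℕ} (hd : 2 ≤ d) : S.arith.zeta d = ENNReal.ofReal (S.zetaS d) := by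
  have h1 := (Real.summable_one_div_nat_pow (p := d)).mpr (by omega)
  have h2 := h1.comp_injective (Subtype.val_injective (p := fun m => m ∈ S.NS))
  unfold zetaS ArithRing.zeta
  refine Eq.trans ?_ (ENNReal.ofReal_tsum_of_nonneg (f := fun m : S.NS => 1 / ((m : ℕ) : ℝ) ^ d)
    (fun _ => by positivity) h2).symm
  refine tsum_congr fun m => ?_
  rw [one_div, ENNReal.ofReal_inv_of_pos (pow_pos (Nat.cast_pos.mpr m.2.1) _),
    ENNReal.ofReal_pow (Nat.cast_nonneg _), ENNReal.ofReal_natCast]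

lemma zeta_inv_toReal {d : ℕ} (hd : 2 ≤ d) : (S.arith.zeta d)⁻¹.toReal = (S.zetaS d)⁻¹ := by
  rw [S.zeta_eq hd, ENNReal.toReal_inv, ENNReal.toReal_ofReal]
  exact tsum_nonneg fun _ => by positivity

/-- A neighbourhood of one in `ℚ_S` consisting of units. -/
def base : Set S.AS := Set.Ioo (1 / 2) 2 ×ˢ Set.univ.pi fun _ => Metric.ball 1 1

lemma isOpen_base : IsOpen S.base := isOpen_Ioo.prod (isOpen_set_pi Set.finite_univ fun _ _ => Metric.isOpen_ball)

lemma one_mem_base : (1 : S.AS) ∈ S.base :=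
  ⟨by norm_num, fun _ _ => Metric.mem_ball_self one_pos⟩

lemma isBase_base : S.arith.IsBase S.base where
  measurableSet := S.isOpen_base.measurableSet
  isUnit a ha := by
    refine isUnit_iff.mpr ⟨(by norm_num : (0 : ℝ) < 1 / 2).trans ha.1.1 |>.ne', fun i h => ?_⟩
    have := ha.2 i trivial
    simp [h] at this
  volume_ne_top := ((Metric.isBounded_Ioo _ _).prod
    (Bornology.IsBounded.pi fun _ => Metric.isBounded_ball)).measure_lt_top.ne
  md_le := by
    refine ⟨2 * ∏ _i : Fin S.s, 1, by simp, fun a ha => ?_⟩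
    refine mul_le_mul' ?_ (Finset.prod_le_prod' fun i _ => ?_)
    · rw [← ofReal_norm, Real.norm_eq_abs, abs_of_pos ((by norm_num : (0 : ℝ) < 1 / 2).trans ha.1.1),
        ← ENNReal.ofReal_ofNat]
      exact ENNReal.ofReal_le_ofReal ha.1.2.le
    · have h := ha.2 i trivial
      rw [mem_ball_iff_norm] at h
      rw [← ofReal_norm, ← ENNReal.ofReal_one]
      refine ENNReal.ofReal_le_ofReal ?_
      have h2 := Padic.nonarchimedean (a.2 i - 1) 1
      rw [sub_add_cancel, norm_one] at h2
      exact h2.trans (max_le h.le le_rfl)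

end PrimeTup

namespace PrimeTup

variable (S : PrimeTup)

lemma measurable_smul_left {k : ℕ} (u : S.AS) : Measurable fun x : Fin k → S.AS => u • x :=
  (continuous_const_smul u).measurable

lemma md_pow_mul_volume_preimage {u : S.AS} (hu : IsUnit u) {k : ℕ} {B : Set (Fin k → S.AS)}
    (hB : MeasurableSet B) : S.md u ^ k * volume ((fun x => u • x) ⁻¹' B) = volume B := by
  have h := S.arith.lintegral_smul_pi hu (measurable_one.indicator (f := (1 : (Fin k → S.AS) → ℝ≥0∞)) hB)
  rw [lintegral_indicator_one hB] at h
  have h2 : (fun r => B.indicator (1 : (Fin k → S.AS) → ℝ≥0∞) (u • r)) =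
      ((fun x => u • x) ⁻¹' B).indicator 1 := by
    funext r
    rfl
  rwa [h2, lintegral_indicator_one (S.measurable_smul_left u hB)] at h

lemma md_pow_mul_parSum_preimage {u : S.AS} (hu : IsUnit u) {k : ℕ} {B : Set (Fin k → S.AS)}
    (hB : MeasurableSet B) :
    S.md u ^ k * S.arith.parSum ((fun x => u • x) ⁻¹' B) = S.arith.parSum B := by
  unfold ArithRing.parSum
  rw [← ENNReal.tsum_mul_left]
  refine tsum_congr fun o => ?_
  rw [← S.md_pow_mul_volume_preimage hu (hB.inter (S.measurable_smul_left _ hB))]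
  congr 2
  ext x
  simp only [Set.mem_inter_iff, Set.mem_preimage, smul_comm u]

/-- The inverse of the scalar by which a set is dilated. -/
noncomputable def shrink (t : ℝ) (z : Fin S.s → ℕ) : S.AS := (t⁻¹, fun i => (S.p i : S.Qp i) ^ z i)

lemma prod_pow_pos (z : Fin S.s → ℕ) : 0 < ∏ i, (S.p i : ℝ) ^ z i :=
  Finset.prod_pos fun i _ => pow_pos (Nat.cast_pos.mpr (S.hp i).pos) _

lemma one_le_prod_pow (z : Fin S.s → ℕ) : 1 ≤ ∏ i, (S.p i : ℝ) ^ z i := by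
  have : 1 ≤ ∏ i, S.p i ^ z i := Finset.one_le_prod' fun i _ => Nat.one_le_pow _ _ (S.hp i).pos
  exact_mod_cast this

lemma le_prod_pow (z : Fin S.s → ℕ) (i : Fin S.s) : (S.p i : ℝ) ^ z i ≤ ∏ i, (S.p i : ℝ) ^ z i := by
  have := Finset.single_le_prod' (f := fun i => S.p i ^ z i)
    (fun i _ => Nat.one_le_pow _ _ (S.hp i).pos) (Finset.mem_univ i)
  exact_mod_cast this

lemma isUnit_shrink {t : ℝ} (ht : 0 < t) (z : Fin S.s → ℕ) : IsUnit (S.shrink t z) :=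
  isUnit_iff.mpr ⟨inv_ne_zero ht.ne', fun i => pow_ne_zero _ (Nat.cast_ne_zero.mpr (S.hp i).ne_zero)⟩

lemma md_shrink {t : ℝ} (ht : 0 < t) (z : Fin S.s → ℕ) :
    S.md (S.shrink t z) = ENNReal.ofReal (t * ∏ i, (S.p i : ℝ) ^ z i)⁻¹ := by
  have h (i) : ‖(S.p i : S.Qp i) ^ z i‖ₑ = ENNReal.ofReal ((S.p i : ℝ) ^ z i)⁻¹ := by
    rw [← ofReal_norm, norm_pow, Padic.norm_p, inv_pow]
  rw [md, shrink, mul_inv, ENNReal.ofReal_mul (inv_pos.mpr ht).le, ← Finset.prod_inv_distrib,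
    ENNReal.ofReal_prod_of_nonneg fun i _ => (inv_pos.mpr (pow_pos (Nat.cast_pos.mpr (S.hp i).pos) _)).le]
  simp only [h]
  rw [← ofReal_norm, Real.norm_eq_abs, abs_of_pos (inv_pos.mpr ht)]

lemma eq_ofReal_mul_of_md_shrink {t : ℝ} (ht : 0 < t) (z : Fin S.s → ℕ) {k : ℕ} {a b : ℝ≥0∞}
    (h : S.md (S.shrink t z) ^ k * a = b) :
    a = ENNReal.ofReal ((t * ∏ i, (S.p i : ℝ) ^ z i) ^ k) * b := by
  have h1 : 0 < t * ∏ i, (S.p i : ℝ) ^ z i := mul_pos ht (S.prod_pow_pos z)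
  rw [← h, S.md_shrink ht, ← ENNReal.ofReal_pow (inv_pos.mpr h1).le, ← mul_assoc,
    ← ENNReal.ofReal_mul (pow_pos h1 _).le, ← mul_pow, mul_inv_cancel₀ h1.ne', one_pow,
    ENNReal.ofReal_one, one_mul]

theorem ae_primSum_dilate {n : ℕ} {B : Set (Fin (n + 3) → S.AS)} (hB : MeasurableSet B)
    (h0 : volume B ≠ 0) (ht : volume B ≠ ∞) (hpar : S.arith.parSum B ≠ ∞)
    (hstar : ∀ c : ℝ, 0 < c → c ≤ 1 → ∀ x ∈ B, ((c, 1) : S.AS) • x ∈ B)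
    {δ : ℝ} (hδ : 1 / 2 < δ) :
    ∀ᵐ M ∂((volume : Measure (Matrix (Fin (n + 3)) (Fin (n + 3)) S.AS)).restrict
      {M | M.det ∈ S.base}),
      ∃ C : ℝ, 0 < C ∧ ∀ (z : Fin S.s → ℕ) (t : ℝ), 0 < t → 1 ≤ t ^ (n + 3) * (volume B).toReal →
        S.arith.primSum (((fun x => S.shrink t z • x) ⁻¹' B).indicator 1) M ≤
          ENNReal.ofReal ((volume ((fun x => S.shrink t z • x) ⁻¹' B)).toReal / S.zetaS (n + 3) +
            C * (volume ((fun x => S.shrink t z • x) ⁻¹' B)).toReal ^ δ) ∧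
        ENNReal.ofReal ((volume ((fun x => S.shrink t z • x) ⁻¹' B)).toReal / S.zetaS (n + 3) -
            C * (volume ((fun x => S.shrink t z • x) ⁻¹' B)).toReal ^ δ) ≤
          S.arith.primSum (((fun x => S.shrink t z • x) ⁻¹' B).indicator 1) M := by
  have hV : 0 < (volume B).toReal := ENNReal.toReal_pos h0 ht
  set V := (volume B).toReal with hVdef
  have hBV : volume B = ENNReal.ofReal V := (ENNReal.ofReal_toReal ht).symm
  let P (z : Fin S.s → ℕ) : ℝ := ∏ i, (S.p i : ℝ) ^ z i
  have hP (z) : 0 < P z := S.prod_pow_pos z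
  let t (z : Fin S.s → ℕ) (v : ℝ) : ℝ := (v / V) ^ ((n + 3 : ℕ) : ℝ)⁻¹ / P z
  have htpos (z) {v} (hv : 0 < v) : 0 < t z v := div_pos (Real.rpow_pos_of_pos (div_pos hv hV) _) (hP z)
  have htpow (z) {v} (hv : 0 < v) : (t z v * P z) ^ (n + 3) = v / V := by
    rw [div_mul_cancel₀ _ (hP z).ne', Real.rpow_inv_natCast_pow (div_pos hv hV).le (by omega)]
  have hvolt (z) {t : ℝ} (ht : 0 < t) : volume ((fun x => S.shrink t z • x) ⁻¹' B) =
      ENNReal.ofReal ((t * P z) ^ (n + 3) * V) := by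
    rw [S.eq_ofReal_mul_of_md_shrink ht z (S.md_pow_mul_volume_preimage (S.isUnit_shrink ht z) hB),
      hBV, ← ENNReal.ofReal_mul (pow_pos (mul_pos ht (hP z)) _).le]
  let U (z : Fin S.s → ℕ) (v : ℝ) : Set (Fin (n + 3) → S.AS) :=
    if 0 < v then (fun x => S.shrink (t z v) z • x) ⁻¹' B else ∅
  have hmain := S.arith.ae_primSum_bound S.isBase_base (U := U) (κ := S.arith.parSum B / ENNReal.ofReal V)
    (fun z v => ?_) (fun z v hv => ?_) (ENNReal.div_ne_top hpar (by simpa using hV)) (fun z v hv => ?_)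
    (fun z a b ha hab => ?_) (fun z => if_neg (lt_irrefl _)) hδ
  · filter_upwards [hmain] with M hM
    obtain ⟨C, hC, hM⟩ := hM
    refine ⟨C, hC, fun z t' ht' h1 => ?_⟩
    have hP1 : 1 ≤ P z := S.one_le_prod_pow z
    have hvol : (volume ((fun x => S.shrink t' z • x) ⁻¹' B)).toReal = (t' * P z) ^ (n + 3) * V := by
      rw [hvolt z ht', ENNReal.toReal_ofReal (by have := hP z; positivity)]
    have hge : P z ≤ (t' * P z) ^ (n + 3) * V := by
      calc P z ≤ P z ^ (n + 3) := le_self_pow₀ hP1 (by omega)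
        _ ≤ P z ^ (n + 3) * (t' ^ (n + 3) * V) := le_mul_of_one_le_right (pow_pos (hP z) _).le h1
        _ = _ := by ring
    have hv0 : 0 < (t' * P z) ^ (n + 3) * V := (hP z).trans_le hge
    have hU : U z ((t' * P z) ^ (n + 3) * V) = (fun x => S.shrink t' z • x) ⁻¹' B := by
      have : t z ((t' * P z) ^ (n + 3) * V) = t' := by
        simp only [t]
        rw [mul_div_cancel_right₀ _ hV.ne', Real.pow_rpow_inv_natCast (mul_pos ht' (hP z)).le (by omega),
          mul_div_cancel_right₀ _ (hP z).ne']
      simp only [U, this, if_pos hv0]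
    have h2 := hM z ((t' * P z) ^ (n + 3) * V) (hP1.trans hge) fun i => ?_
    · rw [hvol, div_eq_inv_mul, ← S.zeta_inv_toReal (by omega), ← hU]
      exact h2
    · calc (2 : ℝ) ^ z i ≤ (S.p i : ℝ) ^ z i := by
            gcongr
            exact_mod_cast (S.hp i).two_le
        _ ≤ P z := S.le_prod_pow z i
        _ ≤ _ := hge
  · simp only [U]
    split_ifs
    · exact S.measurable_smul_left _ hB
    · exact MeasurableSet.empty
  · rcases hv.eq_or_lt with rfl | hv
    · simp [U]
    · simp only [U, if_pos hv]
      rw [hvolt z (htpos z hv), htpow z hv, div_mul_cancel₀ _ hV.ne']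
  · rcases hv.eq_or_lt with rfl | hv
    · simp [U, ArithRing.parSum]
    · simp only [U, if_pos hv]
      rw [S.eq_ofReal_mul_of_md_shrink (htpos z hv) z
        (S.md_pow_mul_parSum_preimage (S.isUnit_shrink (htpos z hv) z) hB)]
      change ENNReal.ofReal ((t z v * P z) ^ (n + 3)) * _ = _
      rw [htpow z hv, ENNReal.ofReal_div_of_pos hV, ENNReal.div_eq_inv_mul, ENNReal.div_eq_inv_mul]
      ring
  · simp only [U]
    split_ifs with h1 h2 h2
    · intro x hx
      have h3 : t z a ≤ t z b := by
        simp only [t]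
        have := hP z
        gcongr
      have h4 : S.shrink (t z b) z = (t z a / t z b, 1) * S.shrink (t z a) z := by
        have := htpos z h1
        refine Prod.ext ?_ ?_
        · simp only [shrink, Prod.fst_mul]
          field_simp
        · simp [shrink]
      rw [Set.mem_preimage, h4, mul_smul]
      exact hstar _ (div_pos (htpos z h1) (htpos z h2)) ((div_le_one (htpos z h2)).mpr h3) _ hx
    · exact absurd (h1.trans_le hab) h2
    · exact Set.empty_subset _
    · exact subset_rfl

end PrimeTup

lemma Padic.volume_closedBall_norm {p : ℕ} [Fact p.Prime] {g : ℚ_[p]} (hg : g ≠ 0) :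
    volume (Metric.closedBall (0 : ℚ_[p]) ‖g‖) = ‖g‖ₑ := by
  have h1 := Padic.volume_smul_eq_mul (Units.mk0 g hg) (Metric.closedBall 0 1)
  rw [Padic.smul_closedBall, Padic.volume_closedBall_one, mul_one, Padic.distribHaarChar_eq] at h1
  exact h1

lemma Padic.min_one_inv_norm_le_norm_den {p : ℕ} [Fact p.Prime] {q : ℚ} {c x : ℝ}
    (h1 : x ≤ c) (h2 : ‖(q : ℚ_[p])‖ * x ≤ c) : x ≤ c * ‖(q.den : ℚ_[p])‖ := by
  by_cases hd : p ∣ q.den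
  · have h3 : ‖(q.num : ℚ_[p])‖ = 1 := by
      rw [Padic.norm_intCast_eq_one_iff, Int.isCoprime_iff_gcd_eq_one]
      exact Nat.Coprime.coprime_dvd_right hd q.reduced
    have h4 : (q : ℚ_[p]) * (q.den : ℚ_[p]) = (q.num : ℚ_[p]) := by
      exact_mod_cast congrArg (fun x : ℚ => (x : ℚ_[p])) (Rat.mul_den_eq_num q)
    have h5 := congrArg norm h4
    rw [norm_mul, h3] at h5
    calc x = ‖(q : ℚ_[p])‖ * x * ‖(q.den : ℚ_[p])‖ := by linear_combination -x * h5
      _ ≤ _ := by gcongr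
  · rw [Padic.norm_natCast_eq_one_iff.mpr (((Fact.out : p.Prime).coprime_iff_not_dvd).mpr hd), mul_one]
    exact h1

namespace PrimeTup

variable (S : PrimeTup)

lemma md_prime (i : Fin S.s) : S.md (S.p i : S.AS) = 1 := by
  have h0 := (S.hp i).pos
  have h1 (j) (hj : j ≠ i) : ‖(S.p i : S.Qp j)‖ₑ = 1 := by
    rw [← ofReal_norm, Padic.norm_natCast_eq_one_iff.mpr, ENNReal.ofReal_one]
    exact (Nat.coprime_primes (S.hp j) (S.hp i)).mpr fun h => hj (S.inj h)
  simp only [md, Prod.fst_natCast, Prod.snd_natCast, Pi.natCast_apply]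
  rw [Finset.prod_eq_single i (fun j _ => h1 j) (by simp), ← ofReal_norm, ← ofReal_norm,
    Padic.norm_p, ← ENNReal.ofReal_mul (norm_nonneg _)]
  simp [h0.ne']

lemma md_natCast_eq_one {n : ℕ} (hn0 : n ≠ 0) (hn : ∀ l : ℕ, l.Prime → l ∣ n → ∃ i, l = S.p i) :
    S.md (n : S.AS) = 1 := by
  induction n using induction_on_primes with
  | zero => exact absurd rfl hn0
  | one => simp [S.md_one]
  | prime_mul l n hl ih =>
    obtain ⟨i, rfl⟩ := hn l hl (dvd_mul_right _ _)
    rw [Nat.cast_mul, S.md_mul, S.md_prime, one_mul]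
    exact ih (right_ne_zero_of_mul hn0) fun l' hl' h => hn l' hl' (h.mul_left _)

lemma prod_enorm_den (q : S.Zs) :
    ∏ i, ‖(((q : ℚ).den : ℕ) : S.Qp i)‖ₑ = ENNReal.ofReal ((q : ℚ).den : ℝ)⁻¹ := by
  have h1 := S.md_natCast_eq_one (q : ℚ).den_nz (S.exists_eq_of_dvd_den q.2)
  simp only [md, Prod.fst_natCast, Prod.snd_natCast, Pi.natCast_apply] at h1
  have h0 : (0 : ℝ) < (q : ℚ).den := Nat.cast_pos.mpr (q : ℚ).den_pos
  rw [ENNReal.ofReal_inv_of_pos h0]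
  refine ENNReal.eq_inv_of_mul_eq_one_left ?_
  rw [mul_comm, ← h1, ← ofReal_norm, Real.norm_of_nonneg h0.le]

/-- The set of elements of `ℚ_S` of norm at most `R`, up to rounding at the finite places. -/
def ball (R : ℕ) : Set S.AS :=
  {x | |x.1| ≤ R ∧ ∀ i, ‖x.2 i‖ ≤ (S.p i : ℝ) ^ R}

lemma volume_ball_inter_le (R : ℕ) (q : S.Zs) (hq : q ≠ 0) :
    volume (S.ball R ∩ (fun x => S.ι q * x) ⁻¹' S.ball R) ≤
      (∏ i, ENNReal.ofReal ((S.p i : ℝ) ^ R)) * ENNReal.ofReal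
        (2 * R * min ((q : ℚ).den : ℝ)⁻¹ (|((q : ℚ).num : ℝ)|)⁻¹) := by
  have hden : (0 : ℝ) < (q : ℚ).den := Nat.cast_pos.mpr (q : ℚ).den_pos
  have hnum : (0 : ℝ) < |((q : ℚ).num : ℝ)| := by
    refine abs_pos.mpr (Int.cast_ne_zero.mpr (Rat.num_ne_zero.mpr fun h => hq (Subtype.ext h)))
  set m : ℝ := min ((q : ℚ).den : ℝ)⁻¹ (|((q : ℚ).num : ℝ)|)⁻¹ with hm
  have hm0 : 0 ≤ m := le_min (inv_pos.mpr hden).le (inv_pos.mpr hnum).le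
  have hsub : S.ball R ∩ (fun x => S.ι q * x) ⁻¹' S.ball R ⊆
      Metric.closedBall 0 (R * (m * (q : ℚ).den)) ×ˢ Set.univ.pi fun i =>
        Metric.closedBall 0 ‖(S.p i : S.Qp i) ^ (-(R : ℤ)) * ((q : ℚ).den : S.Qp i)‖ := by
    rintro x ⟨h1, h2⟩
    refine ⟨?_, fun i _ => ?_⟩
    · rw [mem_closedBall_zero_iff, Real.norm_eq_abs]
      have h3 : |((q : ℚ) : ℝ) * x.1| ≤ R := h2.1
      have h4 : ((q : ℚ) : ℝ) = (q : ℚ).num / (q : ℚ).den := Rat.cast_def _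
      rw [abs_mul, h4, abs_div, Nat.abs_cast] at h3
      rw [hm, min_mul_of_nonneg _ _ hden.le, inv_mul_cancel₀ hden.ne']
      rcases le_total 1 ((|((q : ℚ).num : ℝ)|)⁻¹ * (q : ℚ).den) with h | h
      · rw [min_eq_left h, mul_one]
        exact h1.1
      · rw [min_eq_right h]
        calc |x.1| = (|((q : ℚ).num : ℝ)| / (q : ℚ).den * |x.1|) * ((|((q : ℚ).num : ℝ)|)⁻¹ * (q : ℚ).den) := by
              field_simp
          _ ≤ _ := by gcongr
    · rw [mem_closedBall_zero_iff, norm_mul, Padic.norm_p_zpow, neg_neg, zpow_natCast]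
      refine Padic.min_one_inv_norm_le_norm_den (h1.2 i) ?_
      rw [← norm_mul]
      exact h2.2 i
  refine (measure_mono hsub).trans ?_
  have h5 (i) : volume (Metric.closedBall (0 : S.Qp i) ‖(S.p i : S.Qp i) ^ (-(R : ℤ)) * ((q : ℚ).den : S.Qp i)‖) =
      ENNReal.ofReal ((S.p i : ℝ) ^ R) * ‖((q : ℚ).den : S.Qp i)‖ₑ := by
    rw [Padic.volume_closedBall_norm, enorm_mul, ← ofReal_norm, Padic.norm_p_zpow, neg_neg, zpow_natCast]
    exact mul_ne_zero (zpow_ne_zero _ (Nat.cast_ne_zero.mpr (S.hp i).ne_zero))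
      (Nat.cast_ne_zero.mpr (q : ℚ).den_nz)
  rw [Measure.volume_eq_prod, Measure.prod_prod, volume_pi_pi, Real.volume_closedBall]
  simp only [h5]
  rw [Finset.prod_mul_distrib, S.prod_enorm_den, mul_left_comm, ← ENNReal.ofReal_mul (by positivity)]
  refine le_of_eq ?_
  congr 2
  field_simp

lemma tsum_min_pow_ne_top (n : ℕ) (K : ℝ≥0∞) (hK : K ≠ ∞) (R : ℕ) :
    ∑' q : {q : S.Zs // q ≠ 0}, (K * ENNReal.ofReal
        (2 * R * min ((q.1 : ℚ).den : ℝ)⁻¹ (|((q.1 : ℚ).num : ℝ)|)⁻¹)) ^ (n + 3) ≠ ∞ := by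
  let g (a : ℤ) : ℝ := |(a : ℝ)| ^ (-(3 / 2) : ℝ)
  let h (b : ℕ) : ℝ := (b : ℝ) ^ (-(3 / 2) : ℝ)
  have hg : Summable g := Real.summable_abs_int_rpow (by norm_num)
  have hh : Summable h := Real.summable_nat_rpow.mpr (by norm_num)
  have key (q : {q : S.Zs // q ≠ 0}) : (K * ENNReal.ofReal
        (2 * R * min ((q.1 : ℚ).den : ℝ)⁻¹ (|((q.1 : ℚ).num : ℝ)|)⁻¹)) ^ (n + 3) ≤
      (K * ENNReal.ofReal (2 * R)) ^ (n + 3) *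
        (ENNReal.ofReal (g (q.1 : ℚ).num) * ENNReal.ofReal (h (q.1 : ℚ).den)) := by
    have hden : (1 : ℝ) ≤ (q.1 : ℚ).den := Nat.one_le_cast.mpr (q.1 : ℚ).den_pos
    have hnum : (0 : ℝ) < |((q.1 : ℚ).num : ℝ)| :=
      abs_pos.mpr (Int.cast_ne_zero.mpr (Rat.num_ne_zero.mpr fun h0 => q.2 (Subtype.ext h0)))
    rw [ENNReal.ofReal_mul (by positivity), ← mul_assoc, mul_pow]
    gcongr
    rw [← ENNReal.ofReal_mul (by positivity), ← ENNReal.ofReal_pow (by positivity)]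
    refine ENNReal.ofReal_le_ofReal ?_
    set a := |((q.1 : ℚ).num : ℝ)|
    set b := ((q.1 : ℚ).den : ℝ)
    have h1 : min b⁻¹ a⁻¹ ≤ 1 := (min_le_left _ _).trans (inv_le_one_of_one_le₀ hden)
    have h0 : 0 ≤ min b⁻¹ a⁻¹ := by positivity
    calc min b⁻¹ a⁻¹ ^ (n + 3) ≤ min b⁻¹ a⁻¹ ^ 3 := pow_le_pow_of_le_one h0 h1 (by omega)
      _ = min b⁻¹ a⁻¹ ^ (3 / 2 : ℝ) * min b⁻¹ a⁻¹ ^ (3 / 2 : ℝ) := by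
        rw [← Real.rpow_add' h0 (by norm_num), ← Real.rpow_natCast]
        norm_num
      _ ≤ a⁻¹ ^ (3 / 2 : ℝ) * b⁻¹ ^ (3 / 2 : ℝ) := by
        gcongr
        · exact min_le_right _ _
        · exact min_le_left _ _
      _ = _ := by
        simp only [g, h]
        rw [Real.inv_rpow hnum.le, Real.inv_rpow (by positivity), ← Real.rpow_neg hnum.le,
          ← Real.rpow_neg (by positivity)]
  refine ne_top_of_le_ne_top ?_ (ENNReal.tsum_le_tsum key)
  rw [ENNReal.tsum_mul_left]
  refine ENNReal.mul_ne_top (ENNReal.pow_ne_top (ENNReal.mul_ne_top hK ENNReal.ofReal_ne_top)) ?_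
  have hinj : Function.Injective fun q : {q : S.Zs // q ≠ 0} => ((q.1 : ℚ).num, (q.1 : ℚ).den) := by
    intro q q' hqq
    rw [Prod.mk.injEq] at hqq
    exact Subtype.ext (Subtype.ext (Rat.ext hqq.1 hqq.2))
  refine ne_top_of_le_ne_top ?_ (ENNReal.tsum_comp_le_tsum_of_injective hinj
    fun x : ℤ × ℕ => ENNReal.ofReal (g x.1) * ENNReal.ofReal (h x.2))
  rw [ENNReal.tsum_prod (f := fun a b => ENNReal.ofReal (g a) * ENNReal.ofReal (h b))]
  simp only [ENNReal.tsum_mul_left, ENNReal.tsum_mul_right]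
  exact ENNReal.mul_ne_top hg.tsum_ofReal_ne_top hh.tsum_ofReal_ne_top

lemma parSum_ne_top {n : ℕ} {B : Set (Fin (n + 3) → S.AS)} (hB : Bornology.IsBounded B) :
    S.arith.parSum B ≠ ∞ := by
  obtain ⟨r, hr⟩ := hB.exists_norm_le
  obtain ⟨R, hR⟩ := exists_nat_ge r
  have hsub : B ⊆ Set.univ.pi fun _ => S.ball R := by
    intro x hx j _
    have h1 : ‖x j‖ ≤ R := (norm_le_pi_norm x j).trans ((hr x hx).trans hR)
    refine ⟨(norm_fst_le _).trans h1, fun i => ?_⟩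
    refine ((norm_le_pi_norm (x j).2 i).trans ((norm_snd_le _).trans h1)).trans ?_
    exact_mod_cast (Nat.lt_pow_self (S.hp i).one_lt (n := R)).le
  refine ne_top_of_le_ne_top (S.tsum_min_pow_ne_top n (∏ i, ENNReal.ofReal ((S.p i : ℝ) ^ R))
    (ENNReal.prod_ne_top fun i _ => ENNReal.ofReal_ne_top) R) (ENNReal.tsum_le_tsum fun q => ?_)
  have h2 : B ∩ (fun x => S.arith.ι q.1 • x) ⁻¹' B ⊆
      Set.univ.pi fun _ => S.ball R ∩ (fun x => S.ι q.1 * x) ⁻¹' S.ball R :=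
    fun x hx j _ => ⟨hsub hx.1 j trivial, hsub hx.2 j trivial⟩
  refine (measure_mono h2).trans ?_
  rw [volume_pi_pi, Finset.prod_const, Finset.card_univ, Fintype.card_fin]
  gcongr
  exact S.volume_ball_inter_le R q.1 q.2

end PrimeTup

lemma measurableSet_setOf_exists_lt {X Y : Type*} [MeasurableSpace X] [MeasurableSpace Y]
    {P : Y → Prop} (hP : MeasurableSet {y | P y}) {f : X → Y} (hf : Measurable f) {r : X → ℝ}
    (hr : Measurable r) {ρ : {y // P y} → ℝ} (hρ : Measurable ρ) :
    MeasurableSet {x | ∃ h : P (f x), r x < ρ ⟨f x, h⟩} := by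
  have h1 : {x | ∃ h : P (f x), r x < ρ ⟨f x, h⟩} =
      Subtype.val '' {x : {x // P (f x)} | r x.1 < ρ ⟨f x.1, x.2⟩} := by
    ext x
    exact ⟨fun ⟨h, h'⟩ => ⟨⟨x, h⟩, h', rfl⟩, fun ⟨y, hy, hyx⟩ => hyx ▸ ⟨y.2, hy⟩⟩
  rw [h1]
  exact MeasurableSet.subtype_image (hf hP) (measurableSet_lt (hr.comp measurable_subtype_coe)
    (hρ.comp ((hf.comp measurable_subtype_coe).subtype_mk)))

section Real

variable {d : ℕ} (ρ : {v : Fin d → ℝ // ‖v‖ = 1} → ℝ)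

/-- The star-shaped set in `ℝ^d` with a given radius function. -/
def realStar : Set (Fin d → ℝ) := {v | ∃ h : ‖(‖v‖⁻¹ • v)‖ = 1, ‖v‖ < ρ ⟨‖v‖⁻¹ • v, h⟩}

variable {ρ}

lemma measurableSet_realStar (hρ : Measurable ρ) : MeasurableSet (realStar ρ) :=
  measurableSet_setOf_exists_lt (P := fun v => ‖v‖ = 1)
    (measurable_norm (measurableSet_singleton 1))
    (measurable_norm.inv.smul measurable_id) measurable_norm hρ

lemma isBounded_realStar (hρ : ∃ M, ∀ v, ρ v ≤ M) : Bornology.IsBounded (realStar ρ) := by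
  obtain ⟨M, hM⟩ := hρ
  exact isBounded_iff_forall_norm_le.mpr ⟨M, fun v ⟨_, hv⟩ => hv.le.trans (hM _)⟩

lemma smul_mem_realStar_iff {c : ℝ} (hc : 0 < c) {v : Fin d → ℝ} :
    c • v ∈ realStar ρ ↔ ∃ h : ‖(‖v‖⁻¹ • v)‖ = 1, c * ‖v‖ < ρ ⟨‖v‖⁻¹ • v, h⟩ := by
  have h1 : ‖c • v‖⁻¹ • c • v = ‖v‖⁻¹ • v := by
    rw [norm_smul, Real.norm_of_nonneg hc.le, mul_inv, smul_smul, mul_right_comm,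
      inv_mul_cancel₀ hc.ne', one_mul]
  have h2 : ‖c • v‖ = c * ‖v‖ := by rw [norm_smul, Real.norm_of_nonneg hc.le]
  simp only [realStar, Set.mem_ofPred_eq, h1]
  simp only [h2]

lemma smul_mem_realStar {c : ℝ} (hc : 0 < c) (hc1 : c ≤ 1) {v : Fin d → ℝ}
    (hv : v ∈ realStar ρ) : c • v ∈ realStar ρ := by
  obtain ⟨h, hv⟩ := hv
  exact (smul_mem_realStar_iff hc).mpr
    ⟨h, (mul_le_of_le_one_left (norm_nonneg _) hc1).trans_lt hv⟩

lemma eventually_smul_mem_realStar (hρ : ∀ v, 0 < ρ v) {v : Fin d → ℝ} (hv : v ≠ 0) :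
    ∀ᶠ n : ℕ in Filter.atTop, ((n : ℝ) + 1)⁻¹ • v ∈ realStar ρ := by
  have h : ‖(‖v‖⁻¹ • v)‖ = 1 := by
    rw [norm_smul, norm_inv, norm_norm, inv_mul_cancel₀ (norm_ne_zero_iff.mpr hv)]
  have h1 : Filter.Tendsto (fun n : ℕ => ((n : ℝ) + 1)⁻¹ * ‖v‖) Filter.atTop (nhds (0 * ‖v‖)) := by
    refine Filter.Tendsto.mul_const _ ?_
    simpa using tendsto_one_div_add_atTop_nhds_zero_nat (𝕜 := ℝ)
  rw [zero_mul] at h1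
  filter_upwards [h1.eventually_lt_const (hρ ⟨_, h⟩)] with n hn
  rw [smul_mem_realStar_iff (by positivity)]
  exact ⟨h, hn⟩

end Real

section Padic

variable {p : ℕ} [Fact p.Prime] {d : ℕ} (ρ : {v : Fin d → ℚ_[p] // ‖v‖ = 1} → ℝ)

/-- The star-shaped set in `ℚ_p^d` with a given radius function. -/
def padicStar : Set (Fin d → ℚ_[p]) := {v | ∃ m : ℤ, ‖v‖ = (p : ℝ) ^ (-m) ∧
  ∃ h : ‖(((p : ℚ_[p]) ^ (-m)) • v)‖ = 1, ‖v‖ < ρ ⟨((p : ℚ_[p]) ^ (-m)) • v, h⟩}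

variable {ρ}

lemma measurableSet_padicStar (hρ : Measurable ρ) : MeasurableSet (padicStar ρ) := by
  rw [padicStar, Set.ofPred_exists]
  refine MeasurableSet.iUnion fun m => ?_
  refine (measurable_norm (measurableSet_singleton ((p : ℝ) ^ (-m)))).inter ?_
  exact measurableSet_setOf_exists_lt (P := fun v : Fin d → ℚ_[p] => ‖v‖ = 1)
    (measurable_norm (measurableSet_singleton 1))
    (continuous_const_smul _).measurable measurable_norm hρ

lemma isBounded_padicStar (hρ : ∃ M, ∀ v, ρ v ≤ M) : Bornology.IsBounded (padicStar ρ) := by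
  obtain ⟨M, hM⟩ := hρ
  exact isBounded_iff_forall_norm_le.mpr ⟨M, fun v ⟨_, _, _, hv⟩ => hv.le.trans (hM _)⟩

lemma Padic.exists_norm_pi_eq_zpow {v : Fin d → ℚ_[p]} (hv : v ≠ 0) :
    ∃ m : ℤ, ‖v‖ = (p : ℝ) ^ (-m) := by
  obtain ⟨j, hj⟩ := Function.ne_iff.mp hv
  have : Nonempty (Fin d) := ⟨j⟩
  obtain ⟨i, hi⟩ := Finite.exists_max fun i => ‖v i‖
  have h : ‖v‖ = ‖v i‖ :=
    le_antisymm ((pi_norm_le_iff_of_nonneg (norm_nonneg _)).mpr hi) (norm_le_pi_norm v i)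
  rw [h]
  refine ⟨_, Padic.norm_eq_zpow_neg_valuation fun h0 => hv ?_⟩
  rw [← norm_eq_zero, h, h0, norm_zero]

lemma eventually_smul_mem_padicStar (hρ : ∀ v, 0 < ρ v) {v : Fin d → ℚ_[p]} (hv : v ≠ 0) :
    ∀ᶠ n : ℕ in Filter.atTop, (p : ℚ_[p]) ^ n • v ∈ padicStar ρ := by
  obtain ⟨m, hm⟩ := Padic.exists_norm_pi_eq_zpow hv
  have hp : (1 : ℝ) < p := Nat.one_lt_cast.mpr (Fact.out : p.Prime).one_lt
  have hp0 : (p : ℚ_[p]) ≠ 0 := Nat.cast_ne_zero.mpr (Fact.out : p.Prime).ne_zero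
  have h : ‖((p : ℚ_[p]) ^ (-m)) • v‖ = 1 := by
    rw [norm_smul, hm, Padic.norm_p_zpow, ← zpow_add₀ (by positivity)]
    simp
  have h1 : Filter.Tendsto (fun n : ℕ => ((p : ℝ)⁻¹) ^ n * ‖v‖) Filter.atTop (nhds (0 * ‖v‖)) :=
    (tendsto_pow_atTop_nhds_zero_of_lt_one (by positivity) (inv_lt_one_of_one_lt₀ hp)).mul_const _
  rw [zero_mul] at h1
  filter_upwards [h1.eventually_lt_const (hρ ⟨_, h⟩)] with n hn
  have h2 : (p : ℚ_[p]) ^ (-(m + n)) • (p : ℚ_[p]) ^ n • v = (p : ℚ_[p]) ^ (-m) • v := by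
    rw [smul_smul, ← zpow_natCast, ← zpow_add₀ hp0]
    congr 2
    ring
  have h3 : ‖(p : ℚ_[p]) ^ n • v‖ = ((p : ℝ)⁻¹) ^ n * ‖v‖ := by
    rw [norm_smul, norm_pow, Padic.norm_p]
  refine ⟨m + n, ?_, ?_⟩
  · rw [h3, hm, inv_pow, ← zpow_natCast, ← _root_.zpow_neg, ← zpow_add₀ (by positivity)]
    congr 1
    ring
  · simp only [h2, h3]
    exact ⟨h, hn⟩

end Padic

namespace PrimeTup

variable (S : PrimeTup)

/-- The subset of `ℚ_S^d` cut out by sets at all places, in coordinates. -/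
def prodSet {d : ℕ} (A : Set (Fin d → ℝ)) (A' : ∀ i, Set (Fin d → S.Qp i)) :
    Set (Fin d → S.AS) :=
  S.coordEquiv d ⁻¹' (A ×ˢ Set.univ.pi A')

variable {S} {d : ℕ} {A : Set (Fin d → ℝ)} {A' : ∀ i, Set (Fin d → S.Qp i)}

lemma measurableSet_prodSet (hA : MeasurableSet A) (hA' : ∀ i, MeasurableSet (A' i)) :
    MeasurableSet (S.prodSet A A') :=
  (S.measurePreserving_coordEquiv d).measurable (hA.prod (MeasurableSet.univ_pi hA'))

lemma isBounded_prodSet (hA : Bornology.IsBounded A) (hA' : ∀ i, Bornology.IsBounded (A' i)) :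
    Bornology.IsBounded (S.prodSet A A') := by
  obtain ⟨r, hr⟩ := hA.exists_norm_le
  choose R hR using fun i => (hA' i).exists_norm_le
  refine isBounded_iff_forall_norm_le.mpr ⟨|r| + ∑ i, |R i|, fun x hx => ?_⟩
  have h0 : 0 ≤ ∑ i, |R i| := Finset.sum_nonneg fun i _ => abs_nonneg _
  refine (pi_norm_le_iff_of_nonneg (by positivity)).mpr fun j => norm_prod_le_iff.mpr ⟨?_, ?_⟩
  · refine (norm_le_pi_norm (S.coordEquiv d x).1 j).trans ((hr _ hx.1).trans ?_)
    exact (le_abs_self r).trans (le_add_of_nonneg_right h0)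
  · refine (pi_norm_le_iff_of_nonneg (by positivity)).mpr fun i => ?_
    refine (norm_le_pi_norm ((S.coordEquiv d x).2 i) j).trans ((hR i _ (hx.2 i trivial)).trans ?_)
    refine (le_abs_self (R i)).trans (le_trans ?_ (le_add_of_nonneg_left (abs_nonneg r)))
    exact Finset.single_le_sum (f := fun i => |R i|) (fun i _ => abs_nonneg _) (Finset.mem_univ i)

lemma shrink_smul_mem_prodSet_iff (t : ℝ) (z : Fin S.s → ℕ) (x : Fin d → S.AS) :
    S.shrink t z • x ∈ S.prodSet A A' ↔
      t⁻¹ • (S.coordEquiv d x).1 ∈ A ∧ ∀ i, (S.p i : S.Qp i) ^ z i • (S.coordEquiv d x).2 i ∈ A' i :=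
  ⟨fun h => ⟨h.1, fun i => h.2 i trivial⟩, fun h => ⟨h.1, fun i _ => h.2 i⟩⟩

lemma volume_prodSet_ne_zero {n : ℕ} {A : Set (Fin (n + 1) → ℝ)}
    {A' : ∀ i, Set (Fin (n + 1) → S.Qp i)}
    (hA : MeasurableSet A) (hA' : ∀ i, MeasurableSet (A' i))
    (h : ∀ v, v ≠ 0 → ∀ᶠ m : ℕ in Filter.atTop, ((m : ℝ) + 1)⁻¹ • v ∈ A)
    (h' : ∀ i (v : Fin (n + 1) → S.Qp i), v ≠ 0 →
      ∀ᶠ m : ℕ in Filter.atTop, (S.p i : S.Qp i) ^ m • v ∈ A' i) :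
    volume (S.prodSet A A') ≠ 0 := by
  intro h0
  have hB := measurableSet_prodSet hA hA'
  have h1 (m : ℕ) : volume ((fun x => S.shrink ((m : ℝ) + 1) (fun _ => m) • x) ⁻¹' S.prodSet A A') = 0 := by
    have hu := S.isUnit_shrink (t := (m : ℝ) + 1) (by positivity) (fun _ => m)
    have h2 := S.md_pow_mul_volume_preimage hu hB
    rw [h0] at h2
    exact (mul_eq_zero.mp h2).resolve_left (pow_ne_zero _ (S.md_ne_zero _ hu))
  have h2 : ∀ᵐ x : Fin (n + 1) → S.AS, IsUnit (x 0) :=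
    (Measure.tendsto_eval_ae_ae (μ := fun _ : Fin (n + 1) => (volume : Measure S.AS)) (i := 0)).eventually
      S.ae_isUnit
  have h3 : ∀ᵐ x : Fin (n + 1) → S.AS, False := by
    filter_upwards [h2, ae_all_iff.mpr fun m => measure_eq_zero_iff_ae_notMem.mp (h1 m)] with x hx hm
    have hx' := isUnit_iff.mp hx
    have e1 := h (S.coordEquiv _ x).1 fun h => hx'.1 (congrFun h 0)
    have e2 (i) := h' i ((S.coordEquiv _ x).2 i) fun h => hx'.2 i (congrFun h 0)
    obtain ⟨m, hm1, hm2⟩ := (e1.and (Filter.eventually_all.mpr e2)).exists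
    exact hm m ((shrink_smul_mem_prodSet_iff _ _ x).mpr ⟨hm1, hm2⟩)
  rw [Filter.eventually_false_iff_eq_bot, ae_eq_bot] at h3
  exact NeZero.ne _ h3

end PrimeTup

section SpecialLinearGroup

variable {n : Type*} [Fintype n] [DecidableEq n] {R : Type*} [CommRing R] [TopologicalSpace R]
  [IsTopologicalRing R]

lemma Matrix.SpecialLinearGroup.continuous_val :
    Continuous (Subtype.val : SpecialLinearGroup n R → Matrix n n R) :=
  continuous_subtype_val (p := fun A : Matrix n n R => A.det = 1)

lemma Matrix.SpecialLinearGroup.continuous_mul_left (g : SpecialLinearGroup n R) :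
    Continuous fun h : SpecialLinearGroup n R => g * h :=
  Continuous.subtype_mk (p := fun A : Matrix n n R => A.det = 1)
    (f := fun h : SpecialLinearGroup n R => g.1 * h.1)
    (continuous_const.matrix_mul SpecialLinearGroup.continuous_val) fun h => (g * h).2

lemma Matrix.SpecialLinearGroup.sigmaCompactSpace [T2Space R] [SigmaCompactSpace R] :
    SigmaCompactSpace (SpecialLinearGroup n R) := by
  have h0 : SigmaCompactSpace (Matrix n n R) := inferInstanceAs (SigmaCompactSpace (n → n → R))
  have h1 : IsClosed {A : Matrix n n R | A.det = 1} :=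
    isClosed_eq continuous_id.matrix_det continuous_const
  exact h1.isClosedEmbedding_subtypeVal.sigmaCompactSpace

instance : BorelSpace (SpecialLinearGroup n R) := ⟨rfl⟩

lemma Matrix.SpecialLinearGroup.measurable_apply [MeasurableSpace R] [BorelSpace R] (j k : n) :
    Measurable fun g : SpecialLinearGroup n R => g.1 j k :=
  (show Continuous fun g : SpecialLinearGroup n R => g.1 j k from
    SpecialLinearGroup.continuous_val.matrix_elem j k).measurable

end SpecialLinearGroup

namespace PrimeTup

variable (S : PrimeTup) {d : ℕ}

lemma measurable_mul_left_G (h : S.G d) : Measurable fun g : S.G d => h * g := by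
  refine Measurable.prodMk (f := fun g : S.G d => h.1 * g.1) ?_ (measurable_pi_lambda _ fun i => ?_)
  · exact (SpecialLinearGroup.continuous_mul_left h.1).measurable.comp measurable_fst
  · exact (SpecialLinearGroup.continuous_mul_left (h.2 i)).measurable.comp
      ((measurable_pi_apply i).comp measurable_snd)

lemma sigmaCompactSpace_G : SigmaCompactSpace (S.G d) := by
  have h1 : SigmaCompactSpace (SpecialLinearGroup (Fin d) ℝ) := SpecialLinearGroup.sigmaCompactSpace
  have h2 (i) : SigmaCompactSpace (SpecialLinearGroup (Fin d) (S.Qp i)) :=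
    SpecialLinearGroup.sigmaCompactSpace
  infer_instance

/-- An element of `G_d` as a transposed matrix over the ring `ℚ_S`. -/
def toMat (g : S.G d) : Matrix (Fin d) (Fin d) S.AS :=
  Matrix.of fun j k => (g.1.1 k j, fun i => (g.2 i).1 k j)

lemma measurable_toMat : Measurable (S.toMat (d := d)) := by
  refine measurable_pi_lambda _ fun j => measurable_pi_lambda _ fun k => ?_
  refine Measurable.prodMk (f := fun g : S.G d => g.1.1 k j) ?_ (measurable_pi_lambda _ fun i => ?_)
  · exact (SpecialLinearGroup.measurable_apply k j).comp measurable_fst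
  · exact (SpecialLinearGroup.measurable_apply k j).comp
      ((measurable_pi_apply i).comp measurable_snd)

/-- The projection of `ℚ_S` to its real component. -/
noncomputable def realHom : S.AS →+* ℝ := RingHom.fst ℝ (∀ i : Fin S.s, S.Qp i)

/-- The projection of `ℚ_S` to a `p`-adic component. -/
noncomputable def padicHom (i : Fin S.s) : S.AS →+* S.Qp i :=
  (Pi.evalRingHom (fun i => S.Qp i) i).comp (RingHom.snd ℝ (∀ i : Fin S.s, S.Qp i))

variable {S}

lemma AS_ext {x y : S.AS} (h : S.realHom x = S.realHom y)
    (h' : ∀ i, S.padicHom i x = S.padicHom i y) : x = y :=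
  Prod.ext h (funext h')

lemma realHom_mapMatrix_toMat (g : S.G d) : S.realHom.mapMatrix (S.toMat g) = g.1.1ᵀ := rfl

lemma padicHom_mapMatrix_toMat (g : S.G d) (i) :
    (S.padicHom i).mapMatrix (S.toMat g) = (g.2 i).1ᵀ := rfl

lemma mat_ext {M N : Matrix (Fin d) (Fin d) S.AS}
    (h : S.realHom.mapMatrix M = S.realHom.mapMatrix N)
    (h' : ∀ i, (S.padicHom i).mapMatrix M = (S.padicHom i).mapMatrix N) : M = N :=
  Matrix.ext fun j k => AS_ext (congrFun (congrFun h j) k) fun i => congrFun (congrFun (h' i) j) k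

lemma det_toMat (g : S.G d) : (S.toMat g).det = 1 := by
  refine AS_ext ?_ fun i => ?_
  · rw [RingHom.map_det, realHom_mapMatrix_toMat, det_transpose, g.1.2, map_one]
  · rw [RingHom.map_det, padicHom_mapMatrix_toMat, det_transpose, (g.2 i).2, map_one]

lemma toMat_mul (g h : S.G d) : S.toMat (g * h) = S.toMat h * S.toMat g := by
  refine mat_ext ?_ fun i => ?_
  · simp only [map_mul, realHom_mapMatrix_toMat]
    exact transpose_mul g.1.1 h.1.1
  · simp only [map_mul, padicHom_mapMatrix_toMat]
    exact transpose_mul (g.2 i).1 (h.2 i).1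

lemma exists_toMat_eq {N : Matrix (Fin d) (Fin d) S.AS} (hN : N.det = 1) :
    ∃ g : S.G d, S.toMat g = N := by
  refine ⟨(⟨(S.realHom.mapMatrix N)ᵀ, ?_⟩, fun i => ⟨((S.padicHom i).mapMatrix N)ᵀ, ?_⟩), ?_⟩
  · rw [det_transpose, ← RingHom.map_det, hN, map_one]
  · rw [det_transpose, ← RingHom.map_det, hN, map_one]
  · exact mat_ext (transpose_transpose _) fun i => transpose_transpose _

lemma coordEquiv_vecMul_toMat (g : S.G d) (v : Fin d → S.AS) :
    S.coordEquiv d (v ᵥ* S.toMat g) = S.act g (S.coordEquiv d v) := by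
  refine Prod.ext (funext fun j => ?_) (funext fun i => funext fun j => ?_)
  · refine (map_sum S.realHom (fun k => v k * S.toMat g k j) Finset.univ).trans ?_
    exact Finset.sum_congr rfl fun k _ => mul_comm (v k).1 (g.1.1 j k)
  · refine (map_sum (S.padicHom i) (fun k => v k * S.toMat g k j) Finset.univ).trans ?_
    exact Finset.sum_congr rfl fun k _ => mul_comm ((v k).2 i) ((g.2 i).1 j k)

/-- A property holding for almost every normalized matrix holds for almost every element of `G_d`. -/
lemma ae_toMat {n : ℕ} {ν : Measure (S.G (n + 1))} (hinv : ν.IsMulLeftInvariant) [SFinite ν]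
    {P : Matrix (Fin (n + 1)) (Fin (n + 1)) S.AS → Prop}
    (hP : ∀ᵐ M ∂((volume : Measure (Matrix (Fin (n + 1)) (Fin (n + 1)) S.AS)).restrict
      {M | M.det ∈ S.base}), P (M * diagCons (Ring.inverse M.det))) :
    ∀ᵐ g ∂ν, P (S.toMat g) := by
  let E : Set (Matrix (Fin (n + 1)) (Fin (n + 1)) S.AS) := {M | M.det ∈ S.base}
  have hEo : IsOpen E := S.isOpen_base.preimage continuous_id.matrix_det
  rw [ae_restrict_iff' hEo.measurableSet] at hP
  set Z := toMeasurable volume {M : Matrix (Fin (n + 1)) (Fin (n + 1)) S.AS |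
    ¬ (M ∈ E → P (M * diagCons (Ring.inverse M.det)))} with hZ
  have hZ0 : volume Z = 0 := by rw [hZ, measure_toMeasurable]; exact hP
  have hZm : MeasurableSet Z := measurableSet_toMeasurable _ _
  have h1 : ∀ᵐ g ∂ν, ∀ᵐ M : Matrix (Fin (n + 1)) (Fin (n + 1)) S.AS, S.toMat g * M ∉ Z :=
    .of_forall fun g => (S.arith.measurePreserving_mul_left (det_toMat g)).quasiMeasurePreserving.ae
      (measure_eq_zero_iff_ae_notMem.mp hZ0)
  have hm : Measurable fun x : Matrix (Fin (n + 1)) (Fin (n + 1)) S.AS × S.G (n + 1) =>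
      S.toMat x.2 * x.1 :=
    ArithRing.measurable_mul.comp ((S.measurable_toMat.comp measurable_snd).prodMk measurable_fst)
  have h2 : ∀ᵐ M : Matrix (Fin (n + 1)) (Fin (n + 1)) S.AS, ∀ᵐ g ∂ν, S.toMat g * M ∉ Z := by
    refine (Measure.ae_ae_comm ?_).mp h1
    exact (hm.comp measurable_swap hZm).compl
  have : (volume : Measure (Matrix (Fin (n + 1)) (Fin (n + 1)) S.AS)).IsOpenPosMeasure :=
    inferInstanceAs (volume : Measure (Fin (n + 1) → Fin (n + 1) → S.AS)).IsOpenPosMeasure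
  have hE0 : volume E ≠ 0 := (hEo.measure_pos volume ⟨1, by
    change (1 : Matrix _ _ S.AS).det ∈ S.base
    rw [det_one]; exact S.one_mem_base⟩).ne'
  obtain ⟨M, hME, hM⟩ : ∃ M ∈ E, ∀ᵐ g ∂ν, S.toMat g * M ∉ Z := by
    by_contra! hcon
    exact hE0 (measure_mono_null (fun M hME => hcon M hME) h2)
  have hu : IsUnit M.det := S.isBase_base.isUnit _ hME
  obtain ⟨h, hh⟩ := exists_toMat_eq (N := M * diagCons (Ring.inverse M.det)) (by
    rw [det_mul, det_diagCons, Ring.mul_inverse_cancel _ hu])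
  have h3 : ∀ᵐ g ∂ν, P (S.toMat (h * g)) := by
    filter_upwards [hM] with g hg
    by_contra hcon
    refine hg (subset_toMeasurable _ _ ?_)
    have hdet : (S.toMat g * M).det = M.det := by rw [det_mul, det_toMat, one_mul]
    simp only [Set.mem_ofPred_eq, E, hdet, Classical.not_imp]
    refine ⟨hME, ?_⟩
    rwa [Matrix.mul_assoc, ← hh, ← toMat_mul]
  have h4 : MeasurePreserving (fun g : S.G (n + 1) => h⁻¹ * g) ν ν :=
    ⟨S.measurable_mul_left_G _, hinv.map_mul_left_eq_self _⟩
  filter_upwards [h4.quasiMeasurePreserving.ae h3] with g hg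
  rwa [mul_inv_cancel_left] at hg

end PrimeTup

namespace PrimeTup

variable {S : PrimeTup}

lemma primZs_eq_primRows (n : ℕ) : S.primZs (n + 1) = primRows S.Zs n := by
  have h1 (γ : SpecialLinearGroup (Fin (n + 1)) S.Zs) :
      γ.1.mulVec (S.e1 (n + 1)) = fun j => γ.1 j 0 := by
    have h2 : S.e1 (n + 1) = Pi.single 0 1 := by
      funext j
      rw [e1, Pi.single_apply]
      exact if_congr Fin.val_eq_zero_iff rfl rfl
    rw [h2, mulVec_single_one]
    rfl
  ext w
  constructor
  · rintro ⟨γ, rfl⟩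
    exact ⟨γ.transpose, (h1 γ).symm⟩
  · rintro ⟨γ, rfl⟩
    exact ⟨γ.transpose, (h1 γ.transpose).symm⟩

lemma coordEquiv_vec {d : ℕ} (w : Fin d → S.Zs) :
    S.coordEquiv d (S.arith.vec w) = S.diag fun j => (w j : ℚ) := rfl

lemma tsum_prim {n : ℕ} (g : S.G (n + 1)) (T : Set (S.QS (n + 1))) :
    ∑' v : S.prim (n + 1), T.indicator (fun _ => (1 : ℝ≥0∞)) (S.act g v) =
      ∑' p : primRows S.Zs n, (S.coordEquiv (n + 1) ⁻¹' T).indicator (1 : (Fin (n + 1) → S.AS) → ℝ≥0∞)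
        (S.arith.vec p.1 ᵥ* S.toMat g) := by
  have hinj : Function.Injective fun w : Fin (n + 1) → S.Zs => S.diag fun j => (w j : ℚ) := by
    intro w w' h
    funext j
    exact Subtype.ext (Rat.cast_injective (α := ℝ) (congrFun (congrArg Prod.fst h) j))
  rw [prim, tsum_image (g := fun w : Fin (n + 1) → S.Zs => S.diag fun j => (w j : ℚ))
    (fun v => T.indicator (fun _ => (1 : ℝ≥0∞)) (S.act g v)) hinj.injOn, primZs_eq_primRows]
  refine tsum_congr fun p => ?_
  rw [← coordEquiv_vec, ← coordEquiv_vecMul_toMat]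
  rfl

lemma volP_eq_volume {d : ℕ} (i : Fin S.s) {μ : Measure (Fin d → S.Qp i)} [μ.IsAddHaarMeasure]
    (h : μ {v | ∀ j, ‖v j‖ ≤ 1} = 1) : μ = volume := by
  have h1 : {v : Fin d → S.Qp i | ∀ j, ‖v j‖ ≤ 1} = Set.univ.pi fun _ => Metric.closedBall 0 1 := by
    ext v
    simp
  have h2 : volume {v : Fin d → S.Qp i | ∀ j, ‖v j‖ ≤ 1} = 1 := by
    rw [h1, volume_pi_pi]
    simp [Padic.volume_closedBall_one]
  exact Measure.addHaar_eq_of_measure_eq μ volume (h.trans h2.symm) (by simp [h2]) (by simp [h2])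

lemma coordEquiv_preimage_dilate {d : ℕ} {A : Set (Fin d → ℝ)} {A' : ∀ i, Set (Fin d → S.Qp i)}
    {t : ℝ} (ht : 0 < t) {z : Fin S.s → ℤ} (hz : ∀ i, 0 ≤ z i) :
    S.coordEquiv d ⁻¹' {x | x.1 ∈ t • A ∧ ∀ i, x.2 i ∈ ((S.p i : S.Qp i) ^ (-(z i))) • A' i} =
      (fun x => S.shrink t (fun i => (z i).toNat) • x) ⁻¹' S.prodSet A A' := by
  ext x
  refine Iff.trans ?_ (shrink_smul_mem_prodSet_iff _ _ x).symm
  have h1 (i) (w : Fin d → S.Qp i) : w ∈ ((S.p i : S.Qp i) ^ (-(z i))) • A' i ↔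
      (S.p i : S.Qp i) ^ (z i).toNat • w ∈ A' i := by
    have h0 : (S.p i : S.Qp i) ^ (-(z i)) ≠ 0 :=
      zpow_ne_zero _ (Nat.cast_ne_zero.mpr (S.hp i).ne_zero)
    rw [Set.mem_smul_set_iff_inv_smul_mem₀ h0, _root_.zpow_neg, inv_inv, ← zpow_natCast,
      Int.toNat_of_nonneg (hz i)]
  exact and_congr (Set.mem_smul_set_iff_inv_smul_mem₀ ht.ne' _ _) (forall_congr' fun i => h1 i _)

end PrimeTup

open PrimeTup in
/-- **Counting in dilates of star-shaped sets, `d ≥ 3`** (Theorem 2.11).  For a star-shaped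
set `A ⊆ ℚ_S^d` given by bounded positive Borel radius functions on the unit spheres and
any `δ ∈ (1/2, 1)`, for Haar-almost every `g ∈ G_d` one has
`#(g·P(ℤ_S^d) ∩ T·A) = vol_S(T·A)/ζ_S(d) + O_g(vol_S(T·A)^δ)` for all `T ⪰ T⁰(g)`. -/
theorem star_shaped_counting_theorem
    (S : PrimeTup) (d : ℕ) (hd : 3 ≤ d) (δ : ℝ) (hδ₁ : 1/2 < δ) (hδ₂ : δ < 1)
    (volP : (i : Fin S.s) → Measure (Fin d → S.Qp i))
    (hvolP : ∀ i, (volP i).IsAddHaarMeasure ∧ (volP i).Regular ∧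
      volP i {v | ∀ j, ‖v j‖ ≤ 1} = 1)
    (volS : Measure (S.QS d))
    (hvolS : volS = (volume : Measure (Fin d → ℝ)).prod (Measure.pi volP))
    (ρinf : {v : Fin d → ℝ // ‖v‖ = 1} → ℝ)
    (hρinf : (∀ v, 0 < ρinf v) ∧ (∃ M, ∀ v, ρinf v ≤ M) ∧ Measurable ρinf)
    (ρp : (i : Fin S.s) → {v : Fin d → S.Qp i // ‖v‖ = 1} → ℝ)
    (hρp : ∀ i, (∀ v, 0 < ρp i v) ∧ (∃ M, ∀ v, ρp i v ≤ M) ∧ Measurable (ρp i))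
    (Ainf : Set (Fin d → ℝ))
    (hAinf : Ainf = {v | ∃ h : ‖(‖v‖⁻¹ • v)‖ = 1, ‖v‖ < ρinf ⟨‖v‖⁻¹ • v, h⟩})
    (Ap : (i : Fin S.s) → Set (Fin d → S.Qp i))
    (hAp : ∀ i, Ap i = {v | ∃ m : ℤ, ‖v‖ = (S.p i : ℝ) ^ (-m) ∧
      ∃ h : ‖(((S.p i : S.Qp i) ^ (-m)) • v)‖ = 1,
        ‖v‖ < ρp i ⟨((S.p i : S.Qp i) ^ (-m)) • v, h⟩})
    (ν : Measure (S.G d)) (hinv : ν.IsMulLeftInvariant) (hreg : ν.Regular)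
    (hfin : IsFiniteMeasureOnCompacts ν) (hne : ν ≠ 0) :
    ∀ᵐ g ∂ν, ∃ C > (0:ℝ), ∃ (T₀ : ℝ) (z₀ : Fin S.s → ℤ),
      ∀ (Tinf : ℝ) (z : Fin S.s → ℤ), 0 < Tinf → T₀ ≤ Tinf → (∀ i, z₀ i ≤ z i) →
      ∀ TA : Set (S.QS d),
        TA = {x | x.1 ∈ Tinf • Ainf ∧ ∀ i, x.2 i ∈ ((S.p i : S.Qp i) ^ (-(z i))) • Ap i} →
        (∑' v : S.prim d, TA.indicator (fun _ => (1:ℝ≥0∞)) (S.act g v)) ≤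
            ENNReal.ofReal ((volS TA).toReal / S.zetaS d + C * (volS TA).toReal ^ δ) ∧
          ENNReal.ofReal ((volS TA).toReal / S.zetaS d - C * (volS TA).toReal ^ δ) ≤
            ∑' v : S.prim d, TA.indicator (fun _ => (1:ℝ≥0∞)) (S.act g v) := by
  obtain ⟨n, rfl⟩ : ∃ n, d = n + 3 := ⟨d - 3, by omega⟩
  have hvolP' (i) : volP i = volume :=
    have := (hvolP i).1
    volP_eq_volume i (hvolP i).2.2
  have hvolS' : volS = volume := by
    rw [hvolS, funext hvolP']
    rfl
  have hAinf' : Ainf = realStar ρinf := hAinf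
  have hAp' (i) : Ap i = padicStar (ρp i) := hAp i
  have hmA : MeasurableSet Ainf := hAinf' ▸ measurableSet_realStar hρinf.2.2
  have hmA' (i) : MeasurableSet (Ap i) := hAp' i ▸ measurableSet_padicStar (hρp i).2.2
  have hbdd : Bornology.IsBounded (S.prodSet Ainf Ap) :=
    isBounded_prodSet (hAinf' ▸ isBounded_realStar hρinf.2.1)
      fun i => hAp' i ▸ isBounded_padicStar (hρp i).2.1
  have h0 : volume (S.prodSet Ainf Ap) ≠ 0 := by
    refine volume_prodSet_ne_zero hmA hmA' (fun v hv => ?_) fun i v hv => ?_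
    · rw [hAinf']
      exact eventually_smul_mem_realStar hρinf.1 hv
    · rw [hAp' i]
      exact eventually_smul_mem_padicStar (hρp i).1 hv
  have hV : 0 < (volume (S.prodSet Ainf Ap)).toReal :=
    ENNReal.toReal_pos h0 hbdd.measure_lt_top.ne
  have hstar (c : ℝ) (hc : 0 < c) (hc1 : c ≤ 1) (x) (hx : x ∈ S.prodSet Ainf Ap) :
      ((c, 1) : S.AS) • x ∈ S.prodSet Ainf Ap := by
    refine ⟨?_, fun i _ => ?_⟩
    · have h1 : (S.coordEquiv (n + 3) x).1 ∈ Ainf := hx.1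
      change c • (S.coordEquiv (n + 3) x).1 ∈ Ainf
      rw [hAinf'] at h1 ⊢
      exact smul_mem_realStar hc hc1 h1
    · change (1 : S.Qp i) • (S.coordEquiv (n + 3) x).2 i ∈ Ap i
      rw [one_smul]
      exact hx.2 i trivial
  have := S.sigmaCompactSpace_G (d := n + 3)
  filter_upwards [ae_toMat hinv (P := fun N => ∃ C : ℝ, 0 < C ∧ ∀ (z : Fin S.s → ℕ) (t : ℝ), 0 < t →
      1 ≤ t ^ (n + 3) * (volume (S.prodSet Ainf Ap)).toReal →
      (∑' p : primRows S.Zs (n + 2), ((fun x => S.shrink t z • x) ⁻¹' S.prodSet Ainf Ap).indicator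
          (1 : (Fin (n + 3) → S.AS) → ℝ≥0∞) (S.arith.vec p.1 ᵥ* N)) ≤
        ENNReal.ofReal ((volume ((fun x => S.shrink t z • x) ⁻¹' S.prodSet Ainf Ap)).toReal /
          S.zetaS (n + 3) +
          C * (volume ((fun x => S.shrink t z • x) ⁻¹' S.prodSet Ainf Ap)).toReal ^ δ) ∧
      ENNReal.ofReal ((volume ((fun x => S.shrink t z • x) ⁻¹' S.prodSet Ainf Ap)).toReal /
          S.zetaS (n + 3) -
          C * (volume ((fun x => S.shrink t z • x) ⁻¹' S.prodSet Ainf Ap)).toReal ^ δ) ≤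
        ∑' p : primRows S.Zs (n + 2), ((fun x => S.shrink t z • x) ⁻¹' S.prodSet Ainf Ap).indicator
          (1 : (Fin (n + 3) → S.AS) → ℝ≥0∞) (S.arith.vec p.1 ᵥ* N))
    (S.ae_primSum_dilate (measurableSet_prodSet hmA hmA') h0 hbdd.measure_lt_top.ne
      (S.parSum_ne_top hbdd) hstar hδ₁)] with g hg
  obtain ⟨C, hC, hg⟩ := hg
  refine ⟨C, hC, max 1 (volume (S.prodSet Ainf Ap)).toReal⁻¹, fun _ => 0, ?_⟩
  rintro t z ht hT hz TA rfl
  have hvol : volS {x | x.1 ∈ t • Ainf ∧ ∀ i, x.2 i ∈ ((S.p i : S.Qp i) ^ (-(z i))) • Ap i} =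
      volume ((fun x => S.shrink t (fun i => (z i).toNat) • x) ⁻¹' S.prodSet Ainf Ap) := by
    rw [hvolS', ← coordEquiv_preimage_dilate ht hz]
    exact ((S.measurePreserving_coordEquiv (n + 3)).measure_preimage_equiv
      (f := (S.coordEquiv (n + 3)).toHomeomorph.toMeasurableEquiv) _).symm
  rw [hvol, tsum_prim, coordEquiv_preimage_dilate ht hz]
  refine hg _ t ht ?_
  have h1 : (1 : ℝ) ≤ t := (le_max_left _ _).trans hT
  calc 1 = (volume (S.prodSet Ainf Ap)).toReal⁻¹ * (volume (S.prodSet Ainf Ap)).toReal :=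
        (inv_mul_cancel₀ hV.ne').symm
    _ ≤ t * (volume (S.prodSet Ainf Ap)).toReal := by
        gcongr
        exact (le_max_right _ _).trans hT
    _ ≤ t ^ (n + 3) * (volume (S.prodSet Ainf Ap)).toReal := by
        gcongr
        exact le_self_pow₀ h1 (by omega)
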